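/- (sl_n q-binomial theorem I, Corollary 7.3 of the paper) Fix a composition v ∈ ℕ^n and nonzero a, b ∈ ℂ. There exists ε > 0 such that for all x ∈ ℂ^n with max_i |x_i| < ε the family (⟦u, v⟧(a, b) 𝖤_u(x)), indexed by all compositions u ∈ ℕ^n, is absolutely summable and Σ_u ⟦u, v⟧(a, b) 𝖤_u(x) = 𝖤_v(x) · ∏_{i=1}^n (b x_i; q)_∞ / (a x_i; q)_∞. -/

import Mathlib

open scoped BigOperators
open MvPolynomial

noncomputable section
namespace LRW

variable {n : ℕ}

/-- `|u|`, the weight of a composition `u ∈ ℕⁿ`. -/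
def wt (u : Fin n → ℕ) : ℕ := ∑ i, u i

/-- `l'_u(i) = #{k > i : u_k > u_i} + #{k < i : u_k ≥ u_i}`. -/
def lp (u : Fin n → ℕ) (i : Fin n) : ℕ :=
  (Finset.univ.filter fun k => i < k ∧ u i < u k).card +
  (Finset.univ.filter fun k => k < i ∧ u i ≤ u k).card

/-- The spectral vector `⟨u⟩ : ⟨u⟩_i = q^{u_i} t^{n−1−l'_u(i)}`. -/
def spec (q t : ℂ) (u : Fin n → ℕ) : Fin n → ℂ :=
  fun i => q ^ u i * t ^ (n - 1 - lp u i)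

/-- Leg length `l(s)` of the cell `s = (i, j+1)` of `u` (so `j` ranges over
`0, …, u_i − 1`): `l(s) = #{k > i : j+1 ≤ u_k ≤ u_i} + #{k < i : j+1 ≤ u_k + 1 ≤ u_i}`. -/
def leg (u : Fin n → ℕ) (i : Fin n) (j : ℕ) : ℕ :=
  (Finset.univ.filter fun k => i < k ∧ j < u k ∧ u k ≤ u i).card +
  (Finset.univ.filter fun k => k < i ∧ j ≤ u k ∧ u k < u i).card

/-- `n(u) = Σ_{s ∈ u} l(s)`. -/
def nstat (u : Fin n → ℕ) : ℕ := ∑ i, ∑ j ∈ Finset.range (u i), leg u i j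

/-- `n'(u) = Σ_i C(u_i, 2)`. -/
def nstat' (u : Fin n → ℕ) : ℕ := ∑ i, Nat.choose (u i) 2

/-- `n(u⁺) = Σ_{i<j} min(u_i, u_j)`, the statistic `n` of the decreasing
rearrangement of `u`. -/
def nplus (u : Fin n → ℕ) : ℕ := ∑ i, ∑ j, if i < j then min (u i) (u j) else 0

/-- `τ_u = (−1)^{|u|} q^{n'(u)} t^{−n(u⁺)}`. -/
def tau (q t : ℂ) (u : Fin n → ℕ) : ℂ := (-1) ^ wt u * q ^ nstat' u / t ^ nplus u

/-- The generalized q-shifted factorial `(z)_u = ∏_{s ∈ u} (1 − z q^{a'(s)} t^{−l'(s)})`. -/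
def qfac (q t z : ℂ) (u : Fin n → ℕ) : ℂ :=
  ∏ i, ∏ j ∈ Finset.range (u i), (1 - z * q ^ j / t ^ lp u i)

/-- `c'_u = ∏_{s ∈ u} (1 − q^{a(s)+1} t^{l(s)})`. -/
def cp (q t : ℂ) (u : Fin n → ℕ) : ℂ :=
  ∏ i, ∏ j ∈ Finset.range (u i), (1 - q ^ (u i - j) * t ^ leg u i j)

/-- `M` is a family of interpolation Macdonald polynomials: `M u` has total degree
at most `|u|`, the coefficient of `x^u` in `M u` is `q^{−n'(u)}`, and `M u`
vanishes at `⟨v⟩` for every `v` with `|v| ≤ |u|`, `v ≠ u`. -/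
def IsInterpFamily (q t : ℂ) (M : (Fin n → ℕ) → MvPolynomial (Fin n) ℂ) : Prop :=
  ∀ u, (M u).totalDegree ≤ wt u ∧
    coeff (Finsupp.equivFunOnFinite.symm u) (M u) = (q ^ nstat' u)⁻¹ ∧
    ∀ v, wt v ≤ wt u → v ≠ u → eval (spec q t v) (M u) = 0

/-- `𝖬_u = q^{n'(u)} t^{n(u)} M_u / c'_u`. -/
def MM (q t : ℂ) (M : (Fin n → ℕ) → MvPolynomial (Fin n) ℂ) (u : Fin n → ℕ) :
    MvPolynomial (Fin n) ℂ :=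
  C (q ^ nstat' u * t ^ nstat u / cp q t u) * M u

/-- `𝖤_u = t^{n(u)} E_u / c'_u`, where `E_u` is the homogeneous component of
degree `|u|` of `M_u`. -/
def EE (q t : ℂ) (M : (Fin n → ℕ) → MvPolynomial (Fin n) ℂ) (u : Fin n → ℕ) :
    MvPolynomial (Fin n) ℂ :=
  C (t ^ nstat u / cp q t u) * homogeneousComponent (wt u) (M u)

/-- The generalized q-binomial coefficient `[u; v] = 𝖬_v(⟨u⟩)/𝖬_v(⟨v⟩)`. -/
def qbin (q t : ℂ) (M : (Fin n → ℕ) → MvPolynomial (Fin n) ℂ) (u v : Fin n → ℕ) : ℂ :=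
  eval (spec q t u) (MM q t M v) / eval (spec q t v) (MM q t M v)

/-- `⟨0⟩/a = (t^{n−1}/a, …, t/a, 1/a)`. -/
def spec0div (q t a : ℂ) : Fin n → ℂ := fun i => spec q t (fun _ => 0) i / a

/-- `cc` is the family of connection coefficients `c_{uv}(a,b)`:
`cc u v = 0` unless `|v| ≤ |u|`, and `𝖬_u(a·x) = Σ_v cc u v · 𝖬_v(b·x)`. -/
def IsConnection (q t : ℂ) (M : (Fin n → ℕ) → MvPolynomial (Fin n) ℂ) (a b : ℂ)
    (cc : (Fin n → ℕ) → (Fin n → ℕ) → ℂ) : Prop :=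
  (∀ u v, wt u < wt v → cc u v = 0) ∧
  ∀ u, aeval (fun i => C a * X i) (MM q t M u) =
    ∑ᶠ v, cc u v • aeval (fun i => C b * X i) (MM q t M v)

/-- `⟦u, v⟧(a, b) = (𝖤_v(⟨0⟩/a)/𝖤_u(⟨0⟩/b)) · c_{uv}(a, b)`. -/
def skew (q t : ℂ) (M : (Fin n → ℕ) → MvPolynomial (Fin n) ℂ) (a b : ℂ)
    (cc : (Fin n → ℕ) → (Fin n → ℕ) → ℂ) (u v : Fin n → ℕ) : ℂ :=
  eval (spec0div q t a) (EE q t M v) / eval (spec0div q t b) (EE q t M u) * cc u v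

/-- `(z; q)_∞ = ∏_{m ≥ 0} (1 − z q^m)`. -/
noncomputable def qpochInf (z q : ℂ) : ℂ := ∏' m : ℕ, (1 - z * q ^ m)

/-- The raising map `(u₁, …, uₙ) ↦ (u₂, …, uₙ, u₁ + 1)`. -/
def raise {m : ℕ} (u : Fin (m + 1) → ℕ) : Fin (m + 1) → ℕ :=
  Fin.snoc (α := fun _ => ℕ) (fun j => u j.succ) (u 0 + 1)

/-- The adjacent transposition exchanging positions `i` and `i + 1`. -/
abbrev adj {m : ℕ} (i : Fin m) : Equiv.Perm (Fin (m + 1)) := Equiv.swap i.castSucc i.succ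

@[simp] lemma raise_castSucc {m : ℕ} (u : Fin (m + 1) → ℕ) (j : Fin m) :
    raise u j.castSucc = u j.succ := by simp [raise]

@[simp] lemma raise_last {m : ℕ} (u : Fin (m + 1) → ℕ) :
    raise u (Fin.last m) = u 0 + 1 := by simp [raise]

lemma exists_raise_eq {m : ℕ} (u : Fin (m + 1) → ℕ) (h : u (Fin.last m) ≠ 0) :
    ∃ w, u = raise w := by
  refine ⟨Fin.cons (α := fun _ => ℕ) (u (Fin.last m) - 1) (fun j => u j.castSucc), ?_⟩
  funext i
  refine Fin.lastCases ?_ (fun j => ?_) i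
  · simp; omega
  · simp

lemma raise_injective {m : ℕ} : Function.Injective (raise (m := m)) := by
  intro u w h
  funext i
  refine Fin.cases ?_ (fun j => ?_) i
  · have := congrFun h (Fin.last m); simpa using this
  · have := congrFun h j.castSucc; simpa using this

lemma wt_raise {m : ℕ} (u : Fin (m + 1) → ℕ) : wt (raise u) = wt u + 1 := by
  simp only [wt]
  rw [Fin.sum_univ_castSucc, Fin.sum_univ_succ]
  simp; ring

lemma wt_snoc_zero {m : ℕ} (w : Fin m → ℕ) :
    wt (Fin.snoc (α := fun _ => ℕ) w 0 : Fin (m + 1) → ℕ) = wt w := by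
  simp [wt, Fin.sum_univ_castSucc]

lemma wt_comp_perm (u : Fin n → ℕ) (s : Equiv.Perm (Fin n)) : wt (u ∘ s) = wt u := by
  simp only [wt, Function.comp]
  exact Equiv.sum_comp s u

lemma card_filter_add_card_filter (p r : Fin n → Prop) [DecidablePred p] [DecidablePred r] :
    (Finset.univ.filter p).card + (Finset.univ.filter r).card =
      ∑ k, ((if p k then 1 else 0) + if r k then 1 else 0) := by
  rw [Finset.sum_add_distrib, Finset.card_filter, Finset.card_filter]

lemma lp_eq_sum (u : Fin n → ℕ) (i : Fin n) :
    lp u i = ∑ k, ((if i < k ∧ u i < u k then 1 else 0) +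
      if k < i ∧ u i ≤ u k then 1 else 0) := by
  rw [lp, card_filter_add_card_filter]

lemma leg_eq_sum (u : Fin n → ℕ) (i : Fin n) (j : ℕ) :
    leg u i j = ∑ k, ((if i < k ∧ j < u k ∧ u k ≤ u i then 1 else 0) +
      if k < i ∧ j ≤ u k ∧ u k < u i then 1 else 0) := by
  rw [leg, card_filter_add_card_filter]

lemma not_last_lt {m : ℕ} (i : Fin (m + 1)) : ¬ Fin.last m < i := (Fin.le_last i).not_gt

lemma lp_lt {m : ℕ} (u : Fin (m + 1) → ℕ) (i : Fin (m + 1)) : lp u i ≤ m := by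
  rw [lp, ← Finset.card_union_of_disjoint]
  · calc _ ≤ (Finset.univ.erase i).card := by
          apply Finset.card_le_card
          intro k hk
          simp only [Finset.mem_union, Finset.mem_filter, Finset.mem_univ, true_and] at hk
          simp only [Finset.mem_erase, Finset.mem_univ, and_true]
          rcases hk with h | h
          · exact h.1.ne'
          · exact h.1.ne
      _ = m := by simp
  · rw [Finset.disjoint_left]
    intro k hk hk'
    simp only [Finset.mem_filter] at hk hk'
    exact absurd hk.2.1 hk'.2.1.not_gt

lemma lp_raise_castSucc {m : ℕ} (u : Fin (m + 1) → ℕ) (i : Fin m) :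
    lp (raise u) i.castSucc = lp u i.succ := by
  rw [lp_eq_sum, lp_eq_sum, Fin.sum_univ_castSucc, Fin.sum_univ_succ, add_comm]
  simp [Fin.castSucc_lt_last, not_last_lt]

lemma lp_raise_last {m : ℕ} (u : Fin (m + 1) → ℕ) :
    lp (raise u) (Fin.last m) = lp u 0 := by
  rw [lp_eq_sum, lp_eq_sum, Fin.sum_univ_castSucc, Fin.sum_univ_succ]
  simp [Fin.castSucc_lt_last, not_last_lt]

lemma lp_snoc_castSucc {m : ℕ} (w : Fin m → ℕ) (i : Fin m) :
    lp (Fin.snoc (α := fun _ => ℕ) w 0 : Fin (m + 1) → ℕ) i.castSucc = lp w i := by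
  rw [lp_eq_sum, lp_eq_sum, Fin.sum_univ_castSucc]
  simp [not_last_lt]

lemma lp_snoc_last {m : ℕ} (w : Fin m → ℕ) :
    lp (Fin.snoc (α := fun _ => ℕ) w 0 : Fin (m + 1) → ℕ) (Fin.last m) = m := by
  rw [lp_eq_sum, Fin.sum_univ_castSucc]
  simp [Fin.castSucc_lt_last, not_last_lt]

lemma spec_raise {m : ℕ} (q t : ℂ) (u : Fin (m + 1) → ℕ) :
    spec q t (raise u) =
      Fin.snoc (α := fun _ => ℂ) (fun j => spec q t u j.succ) (q * spec q t u 0) := by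
  funext i
  refine Fin.lastCases ?_ (fun j => ?_) i
  · simp [spec, lp_raise_last, pow_succ]; ring
  · simp [spec, lp_raise_castSucc]

lemma spec_snoc_zero {m : ℕ} (q t : ℂ) (w : Fin m → ℕ) :
    spec q t (Fin.snoc (α := fun _ => ℕ) w 0 : Fin (m + 1) → ℕ) =
      Fin.snoc (α := fun _ => ℂ) (fun j => t * spec q t w j) 1 := by
  funext i
  refine Fin.lastCases ?_ (fun j => ?_) i
  · simp [spec, lp_snoc_last]
  · obtain ⟨k, rfl⟩ : ∃ k, m = k + 1 := ⟨m - 1, by have := j.pos; omega⟩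
    have := lp_lt w j
    simp only [spec, Fin.snoc_castSucc, lp_snoc_castSucc]
    rw [show k + 1 + 1 - 1 - lp w j = (k + 1 - 1 - lp w j) + 1 by omega, pow_succ]
    ring

lemma adj_lt_adj_iff {m : ℕ} (i : Fin m) (a b : Fin (m + 1))
    (h : ¬ (a = i.castSucc ∧ b = i.succ)) (h' : ¬ (b = i.castSucc ∧ a = i.succ)) :
    adj i a < adj i b ↔ a < b := by
  have key : ∀ a : Fin (m + 1), (adj i a : ℕ) =
      if (a : ℕ) = i then (i : ℕ) + 1 else if (a : ℕ) = i + 1 then (i : ℕ) else a := by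
    intro a
    simp only [adj, Equiv.swap_apply_def, Fin.ext_iff, Fin.val_castSucc, Fin.val_succ]
    split_ifs <;> simp
  simp only [Fin.ext_iff, Fin.val_castSucc, Fin.val_succ] at h h'
  rw [Fin.lt_def, Fin.lt_def, key, key]
  split_ifs <;> omega

lemma lp_comp_adj {m : ℕ} (u : Fin (m + 1) → ℕ) (i : Fin m) (h : u i.castSucc ≠ u i.succ)
    (k : Fin (m + 1)) : lp (u ∘ adj i) k = lp u (adj i k) := by
  rw [lp_eq_sum, lp_eq_sum]
  rw [← Equiv.sum_comp (adj i) (fun j => (if adj i k < j ∧ u (adj i k) < u j then 1 else 0) +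
      if j < adj i k ∧ u (adj i k) ≤ u j then 1 else 0)]
  refine Finset.sum_congr rfl fun j _ => ?_
  by_cases h1 : k = i.castSucc ∧ j = i.succ
  · obtain ⟨rfl, rfl⟩ := h1
    have : i.castSucc < i.succ := Fin.castSucc_lt_succ
    have := this.not_gt
    simp only [Function.comp, adj, Equiv.swap_apply_left, Equiv.swap_apply_right]
    simp [*, h.symm.le_iff_lt]
  by_cases h2 : j = i.castSucc ∧ k = i.succ
  · obtain ⟨rfl, rfl⟩ := h2
    have : i.castSucc < i.succ := Fin.castSucc_lt_succ
    have := this.not_gt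
    simp only [Function.comp, adj, Equiv.swap_apply_left, Equiv.swap_apply_right]
    simp [*, h.le_iff_lt]
  simp only [adj_lt_adj_iff i k j h1 h2, adj_lt_adj_iff i j k h2 h1, Function.comp]

lemma lp_succ_of_eq {m : ℕ} (u : Fin (m + 1) → ℕ) (i : Fin m) (h : u i.castSucc = u i.succ) :
    lp u i.succ = lp u i.castSucc + 1 := by
  have : lp u i.castSucc + 1 =
      lp u i.castSucc + ∑ k : Fin (m + 1), if k = i.castSucc then 1 else 0 := by simp
  rw [this, lp_eq_sum, lp_eq_sum, ← Finset.sum_add_distrib]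
  refine Finset.sum_congr rfl fun k _ => ?_
  rw [h]
  rcases lt_trichotomy k i.castSucc with hk | hk | hk
  · have h1 : k < i.succ := hk.trans Fin.castSucc_lt_succ
    simp [hk, h1, hk.not_gt, h1.not_gt, hk.ne]
  · subst hk
    simp [h, Fin.castSucc_lt_succ.not_gt]
  · rcases (Fin.castSucc_lt_iff_succ_le.mp hk).eq_or_lt with h1 | h1
    · subst h1
      simp [hk.ne', Fin.castSucc_lt_succ.not_gt]
    · simp [hk, h1, hk.not_gt, h1.not_gt, hk.ne']

lemma spec_comp_adj {m : ℕ} (q t : ℂ) (u : Fin (m + 1) → ℕ) (i : Fin m)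
    (h : u i.castSucc ≠ u i.succ) : spec q t (u ∘ adj i) = spec q t u ∘ adj i := by
  funext k
  simp [spec, lp_comp_adj u i h]

lemma spec_castSucc_of_eq {m : ℕ} (q t : ℂ) (u : Fin (m + 1) → ℕ) (i : Fin m)
    (h : u i.castSucc = u i.succ) : spec q t u i.castSucc = t * spec q t u i.succ := by
  have h1 := lp_succ_of_eq u i h
  have h2 := lp_lt u i.succ
  simp only [spec, h, h1]
  rw [show m + 1 - 1 - lp u i.castSucc = (m + 1 - 1 - (lp u i.castSucc + 1)) + 1 by omega,
    pow_succ]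
  ring

lemma leg_raise_castSucc {m : ℕ} (u : Fin (m + 1) → ℕ) (i : Fin m) (j : ℕ) :
    leg (raise u) i.castSucc j = leg u i.succ j := by
  rw [leg_eq_sum, leg_eq_sum, Fin.sum_univ_castSucc, Fin.sum_univ_succ, add_comm]
  simp [Fin.castSucc_lt_last, not_last_lt]

lemma leg_raise_last_succ {m : ℕ} (u : Fin (m + 1) → ℕ) (j : ℕ) :
    leg (raise u) (Fin.last m) (j + 1) = leg u 0 j := by
  rw [leg_eq_sum, leg_eq_sum, Fin.sum_univ_castSucc, Fin.sum_univ_succ]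
  simp [Fin.castSucc_lt_last, not_last_lt]

lemma leg_raise_last_zero {m : ℕ} (u : Fin (m + 1) → ℕ) :
    leg (raise u) (Fin.last m) 0 = m - lp u 0 := by
  have h : leg (raise u) (Fin.last m) 0 + lp u 0 = m := by
    rw [leg_eq_sum, lp_eq_sum, Fin.sum_univ_castSucc, Fin.sum_univ_succ]
    simp [Fin.castSucc_lt_last, not_last_lt]
    simpa using Finset.card_filter_add_card_filter_not (s := (Finset.univ : Finset (Fin m)))
      (fun j => u j.succ ≤ u 0)
  omega

lemma leg_snoc_castSucc {m : ℕ} (w : Fin m → ℕ) (i : Fin m) (j : ℕ) :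
    leg (Fin.snoc (α := fun _ => ℕ) w 0 : Fin (m + 1) → ℕ) i.castSucc j = leg w i j := by
  rw [leg_eq_sum, leg_eq_sum, Fin.sum_univ_castSucc]
  simp [not_last_lt]

/-- `Σ_{i<j} max(u_i, u_j)`. -/
def nmax (u : Fin n → ℕ) : ℕ := ∑ i, ∑ j, if i < j then max (u i) (u j) else 0

/-- The value of the normalised interpolation polynomial of index `u` at `⟨u⟩`. -/
def diagVal (q t : ℂ) (u : Fin n → ℕ) : ℂ := (-1) ^ wt u * q ^ nstat' u * t ^ nmax u

lemma two_mul_nmax (u : Fin n → ℕ) :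
    2 * nmax u + wt u = ∑ i, ∑ j, max (u i) (u j) := by
  have h1 : nmax u = ∑ i, ∑ j, if j < i then max (u i) (u j) else 0 := by
    rw [nmax, Finset.sum_comm]
    simp only [max_comm]
  have h2 : wt u = ∑ i, ∑ j, if i = j then max (u i) (u j) else 0 := by
    simp [wt]
  rw [two_mul]
  nth_rewrite 2 [h1]
  rw [nmax, h2]
  simp only [← Finset.sum_add_distrib]
  refine Finset.sum_congr rfl fun i _ => Finset.sum_congr rfl fun j _ => ?_
  rcases lt_trichotomy i j with h | h | h
  · simp [h, h.not_gt, h.ne]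
  · subst h; simp
  · simp [h, h.not_gt, h.ne']

lemma nmax_comp_perm (u : Fin n → ℕ) (s : Equiv.Perm (Fin n)) : nmax (u ∘ s) = nmax u := by
  have h1 := two_mul_nmax u
  have h2 := two_mul_nmax (u ∘ s)
  have h3 : ∑ i, ∑ j, max ((u ∘ s) i) ((u ∘ s) j) = ∑ i, ∑ j, max (u i) (u j) := by
    rw [← Equiv.sum_comp s (fun i => ∑ j, max (u i) (u j))]
    refine Finset.sum_congr rfl fun i _ => ?_
    exact Equiv.sum_comp s (fun j => max (u (s i)) (u j))
  have h4 := wt_comp_perm u s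
  omega

lemma diagVal_comp_perm (q t : ℂ) (u : Fin n → ℕ) (s : Equiv.Perm (Fin n)) :
    diagVal q t (u ∘ s) = diagVal q t u := by
  have : nstat' (u ∘ s) = nstat' u := Equiv.sum_comp s (fun i => (u i).choose 2)
  rw [diagVal, nmax_comp_perm, wt_comp_perm, this, diagVal]

lemma nmax_raise {m : ℕ} (u : Fin (m + 1) → ℕ) :
    nmax (raise u) = nmax u + (m - lp u 0) := by
  have h : nmax (raise u) + lp u 0 = nmax u + m := by
    rw [nmax, nmax, lp_eq_sum, Fin.sum_univ_castSucc, Fin.sum_univ_succ]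
    simp only [Fin.sum_univ_castSucc (fun j => if (Fin.castSucc _ : Fin (m + 1)) < j then _ else _)]
    simp only [Fin.sum_univ_succ (n := m)]
    simp [Fin.castSucc_lt_last, not_last_lt, Finset.sum_add_distrib]
    have : ∑ x : Fin m, max (u x.succ) (u 0 + 1) +
        (Finset.univ.filter fun x : Fin m => u 0 < u x.succ).card =
        ∑ x : Fin m, max (u 0) (u x.succ) + m := by
      rw [Finset.card_filter, ← Finset.sum_add_distrib]
      have hm : ∑ x : Fin m, max (u 0) (u x.succ) + m =
          ∑ x : Fin m, (max (u 0) (u x.succ) + 1) := by simp [Finset.sum_add_distrib]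
      rw [hm]
      refine Finset.sum_congr rfl fun j _ => ?_
      split_ifs <;> omega
    omega
  have := lp_lt u 0
  omega

lemma nmax_snoc_zero {m : ℕ} (w : Fin m → ℕ) :
    nmax (Fin.snoc (α := fun _ => ℕ) w 0 : Fin (m + 1) → ℕ) = nmax w + wt w := by
  simp only [nmax, wt, Fin.sum_univ_castSucc (n := m)]
  simp [Fin.castSucc_lt_last, not_last_lt, Finset.sum_add_distrib]

lemma diagVal_raise {m : ℕ} (q t : ℂ) (u : Fin (m + 1) → ℕ) :
    diagVal q t (raise u) = -spec q t u 0 * diagVal q t u := by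
  have : nstat' (raise u) = nstat' u + u 0 := by
    rw [nstat', nstat', Fin.sum_univ_castSucc, Fin.sum_univ_succ]
    simp [Nat.choose_succ_succ' (u 0) 1]
    ring
  rw [diagVal, diagVal, nmax_raise, wt_raise, this, spec]
  simp only [pow_add, Nat.add_sub_cancel]
  ring

lemma diagVal_snoc_zero {m : ℕ} (q t : ℂ) (w : Fin m → ℕ) :
    diagVal q t (Fin.snoc (α := fun _ => ℕ) w 0 : Fin (m + 1) → ℕ) =
      t ^ wt w * diagVal q t w := by
  have : nstat' (Fin.snoc (α := fun _ => ℕ) w 0 : Fin (m + 1) → ℕ) = nstat' w := by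
    simp [nstat', Fin.sum_univ_castSucc]
  rw [diagVal, diagVal, nmax_snoc_zero, wt_snoc_zero, this, pow_add]
  ring

lemma diagVal_ne_zero {q t : ℂ} (hq : q ≠ 0) (ht : t ≠ 0) (u : Fin n → ℕ) :
    diagVal q t u ≠ 0 := by
  simp [diagVal, hq, ht]

lemma nstat_raise {m : ℕ} (u : Fin (m + 1) → ℕ) :
    nstat (raise u) = nstat u + (m - lp u 0) := by
  rw [nstat, nstat, Fin.sum_univ_castSucc, Fin.sum_univ_succ]
  simp only [raise_last, raise_castSucc, leg_raise_castSucc, Finset.sum_range_succ',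
    leg_raise_last_succ, leg_raise_last_zero]
  ring

lemma nstat_snoc_zero {m : ℕ} (w : Fin m → ℕ) :
    nstat (Fin.snoc (α := fun _ => ℕ) w 0 : Fin (m + 1) → ℕ) = nstat w := by
  rw [nstat, nstat, Fin.sum_univ_castSucc]
  simp [leg_snoc_castSucc]

lemma cp_raise {m : ℕ} (q t : ℂ) (u : Fin (m + 1) → ℕ) :
    cp q t (raise u) = (1 - q * spec q t u 0) * cp q t u := by
  rw [cp, cp, Fin.prod_univ_castSucc, Fin.prod_univ_succ]
  simp only [raise_last, raise_castSucc, leg_raise_castSucc, Finset.prod_range_succ',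
    leg_raise_last_succ, leg_raise_last_zero, spec, Nat.add_sub_add_right, Nat.add_sub_cancel,
    Nat.sub_zero, pow_succ]
  ring

lemma cp_snoc_zero {m : ℕ} (q t : ℂ) (w : Fin m → ℕ) :
    cp q t (Fin.snoc (α := fun _ => ℕ) w 0 : Fin (m + 1) → ℕ) = cp q t w := by
  rw [cp, cp, Fin.prod_univ_castSucc]
  simp [leg_snoc_castSucc]

/-- The genericity assumption on `(q, t)`. -/
def Generic (q t : ℂ) : Prop := ∀ i j : ℤ, ¬(i = 0 ∧ j = 0) → q ^ i * t ^ j ≠ 1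

lemma Generic.pow_mul_pow_ne {q t : ℂ} (h : Generic q t) (i j : ℕ) (hi : i ≠ 0) :
    q ^ i * t ^ j ≠ 1 := by
  have := h i j (by simp [hi])
  simpa using this

lemma cp_ne_zero {q t : ℂ} (h : Generic q t) (u : Fin n → ℕ) : cp q t u ≠ 0 := by
  refine Finset.prod_ne_zero_iff.mpr fun i _ => Finset.prod_ne_zero_iff.mpr fun j hj => ?_
  have := h.pow_mul_pow_ne (u i - j) (leg u i j) (by simp at hj; omega)
  exact sub_ne_zero.mpr this.symm

lemma Generic.mul_spec_ne_one {q t : ℂ} (h : Generic q t) (u : Fin n → ℕ) (i : Fin n) :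
    q * spec q t u i ≠ 1 := by
  have := h.pow_mul_pow_ne (u i + 1) (n - 1 - lp u i) (by omega)
  rwa [pow_succ', mul_assoc] at this

lemma spec_ne_zero {q t : ℂ} (hq : q ≠ 0) (ht : t ≠ 0) (u : Fin n → ℕ) (i : Fin n) :
    spec q t u i ≠ 0 := by
  simp [spec, hq, ht]

section Divisibility
variable {σ : Type*}

lemma dvd_sub_aeval_update [DecidableEq σ] (k : σ) (c : ℂ) (f : MvPolynomial σ ℂ) :
    (X k - C c) ∣ f - aeval (Function.update X k (C c)) f := by
  rw [← Ideal.mem_span_singleton, ← Ideal.Quotient.mk_eq_mk_iff_sub_mem]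
  have : (Ideal.Quotient.mkₐ ℂ (Ideal.span {(X k - C c : MvPolynomial σ ℂ)})) =
      (Ideal.Quotient.mkₐ ℂ (Ideal.span {(X k - C c : MvPolynomial σ ℂ)})).comp
        (aeval (Function.update X k (C c))) := by
    refine MvPolynomial.algHom_ext fun i => ?_
    rcases eq_or_ne i k with rfl | h
    · simp only [AlgHom.comp_apply, aeval_X, Function.update_self, Ideal.Quotient.mkₐ_eq_mk]
      rw [Ideal.Quotient.mk_eq_mk_iff_sub_mem]
      exact Ideal.mem_span_singleton_self _
    · simp [h]
  exact DFunLike.congr_fun this f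

lemma eval_aeval {τ : Type*} (x : τ → ℂ) (g : σ → MvPolynomial τ ℂ) (f : MvPolynomial σ ℂ) :
    eval x (aeval g f) = eval (fun i => eval x (g i)) f := by
  have : ((aeval x).comp (aeval g) : MvPolynomial σ ℂ →ₐ[ℂ] ℂ) =
      aeval (fun i => eval x (g i)) := by
    refine MvPolynomial.algHom_ext fun i => ?_
    simp
  have := DFunLike.congr_fun this f
  simpa [coe_aeval_eq_eval] using this

lemma dvd_of_eval_eq_zero (k : σ) (c : ℂ) (f : MvPolynomial σ ℂ)
    (h : ∀ x : σ → ℂ, x k = c → eval x f = 0) : (X k - C c) ∣ f := by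
  classical
  have h0 : aeval (Function.update X k (C c)) f = 0 := by
    refine MvPolynomial.funext fun x => ?_
    have := h (Function.update x k c) (by simp)
    rw [map_zero, ← this, eval_aeval]
    congr 2
    funext s
    rcases eq_or_ne s k with rfl | h
    · simp
    · simp [h]
  have h1 := dvd_sub_aeval_update k c f
  rwa [h0, sub_zero] at h1

lemma totalDegree_X_sub_C (k : σ) (c : ℂ) :
    (X k - C c : MvPolynomial σ ℂ).totalDegree = 1 := by
  have h1 := totalDegree_sub_C_le (X k : MvPolynomial σ ℂ) c
  have h2 := totalDegree_add (X k - C c : MvPolynomial σ ℂ) (C c)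
  simp [totalDegree_X] at h1 h2
  omega

lemma X_sub_C_ne_zero (k : σ) (c : ℂ) : (X k - C c : MvPolynomial σ ℂ) ≠ 0 := by
  intro h
  have := totalDegree_X_sub_C k c
  simp [h] at this

lemma exists_factor (k : σ) (c : ℂ) (f : MvPolynomial σ ℂ)
    (h : ∀ x : σ → ℂ, x k = c → eval x f = 0) :
    ∃ g, f = (X k - C c) * g ∧ (g = 0 ∨ g.totalDegree + 1 = f.totalDegree) := by
  obtain ⟨g, hg⟩ := dvd_of_eval_eq_zero k c f h
  refine ⟨g, hg, or_iff_not_imp_left.mpr fun h0 => ?_⟩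
  rw [hg, totalDegree_mul_of_isDomain (X_sub_C_ne_zero k c) h0, totalDegree_X_sub_C, add_comm]

lemma totalDegree_aeval_le {τ : Type*} (g : σ → MvPolynomial τ ℂ)
    (hg : ∀ i, (g i).totalDegree ≤ 1) (f : MvPolynomial σ ℂ) :
    (aeval g f).totalDegree ≤ f.totalDegree := by
  rw [aeval_def, eval₂_eq]
  refine totalDegree_finsetSum_le fun s hs => ?_
  refine (totalDegree_mul _ _).trans ?_
  rw [algebraMap_eq, totalDegree_C, zero_add]
  refine (totalDegree_finsetProd _ _).trans ?_
  refine le_trans (Finset.sum_le_sum fun i _ => (totalDegree_pow _ _).trans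
    (Nat.mul_le_mul_left _ (hg i))) ?_
  simpa [Finsupp.sum] using le_totalDegree hs

end Divisibility

section Shift
variable {m : ℕ}

/-- `(ω f)(x) = f(x₂, …, xₙ, q x₁)`. -/
def shift (q : ℂ) : MvPolynomial (Fin (m + 1)) ℂ →ₐ[ℂ] MvPolynomial (Fin (m + 1)) ℂ :=
  aeval (Fin.snoc (α := fun _ => MvPolynomial (Fin (m + 1)) ℂ) (fun j => X j.succ) (C q * X 0))

/-- The inverse of `shift`: `(ω⁻¹ f)(x) = f(xₙ / q, x₁, …)`. -/
def unshift (q : ℂ) : MvPolynomial (Fin (m + 1)) ℂ →ₐ[ℂ] MvPolynomial (Fin (m + 1)) ℂ :=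
  aeval (Fin.cons (α := fun _ => MvPolynomial (Fin (m + 1)) ℂ) (C q⁻¹ * X (Fin.last m))
    (fun j => X j.castSucc))

@[simp] lemma shift_X_castSucc (q : ℂ) (j : Fin m) : shift q (X j.castSucc) = X j.succ := by
  simp [shift]

@[simp] lemma shift_X_last (q : ℂ) : shift q (X (Fin.last m)) = C q * X 0 := by
  simp [shift]

@[simp] lemma unshift_X_succ (q : ℂ) (j : Fin m) : unshift q (X j.succ) = X j.castSucc := by
  simp [unshift]

@[simp] lemma unshift_X_zero (q : ℂ) :
    unshift q (X (0 : Fin (m + 1))) = C q⁻¹ * X (Fin.last m) := by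
  simp [unshift]

lemma C_eq_algebraMap' {σ : Type*} (c : ℂ) :
    (C c : MvPolynomial σ ℂ) = algebraMap ℂ (MvPolynomial σ ℂ) c := rfl

@[simp] lemma algHom_C {σ τ : Type*} (φ : MvPolynomial σ ℂ →ₐ[ℂ] MvPolynomial τ ℂ) (c : ℂ) :
    φ (C c) = C c := φ.commutes c

lemma shift_unshift {q : ℂ} (hq : q ≠ 0) (f : MvPolynomial (Fin (m + 1)) ℂ) :
    shift q (unshift q f) = f := by
  have : (shift q).comp (unshift q) = AlgHom.id ℂ (MvPolynomial (Fin (m + 1)) ℂ) := by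
    refine MvPolynomial.algHom_ext fun i => ?_
    refine Fin.cases ?_ (fun j => ?_) i
    · simp only [AlgHom.comp_apply, unshift_X_zero, map_mul, algHom_C, shift_X_last,
        AlgHom.id_apply]
      rw [← mul_assoc, ← C_mul, inv_mul_cancel₀ hq, C_1, one_mul]
    · simp
  exact DFunLike.congr_fun this f

lemma unshift_shift {q : ℂ} (hq : q ≠ 0) (f : MvPolynomial (Fin (m + 1)) ℂ) :
    unshift q (shift q f) = f := by
  have : (unshift q).comp (shift q) = AlgHom.id ℂ (MvPolynomial (Fin (m + 1)) ℂ) := by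
    refine MvPolynomial.algHom_ext fun i => ?_
    refine Fin.lastCases ?_ (fun j => ?_) i
    · simp only [AlgHom.comp_apply, unshift_X_zero, map_mul, algHom_C, shift_X_last,
        AlgHom.id_apply]
      rw [← mul_assoc, ← C_mul, mul_inv_cancel₀ hq, C_1, one_mul]
    · simp
  exact DFunLike.congr_fun this f

lemma eval_shift (q : ℂ) (x : Fin (m + 1) → ℂ) (f : MvPolynomial (Fin (m + 1)) ℂ) :
    eval x (shift q f) =
      eval (Fin.snoc (α := fun _ => ℂ) (fun j => x j.succ) (q * x 0)) f := by
  rw [shift, eval_aeval]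
  congr 1
  congr 1
  funext i
  refine Fin.lastCases ?_ (fun j => ?_) i <;> simp

lemma eval_unshift (q : ℂ) (x : Fin (m + 1) → ℂ) (f : MvPolynomial (Fin (m + 1)) ℂ) :
    eval x (unshift q f) =
      eval (Fin.cons (α := fun _ => ℂ) (q⁻¹ * x (Fin.last m)) (fun j => x j.castSucc)) f := by
  rw [unshift, eval_aeval]
  congr 1
  congr 1
  funext i
  refine Fin.cases ?_ (fun j => ?_) i <;> simp

lemma eval_spec_shift (q t : ℂ) (u : Fin (m + 1) → ℕ) (f : MvPolynomial (Fin (m + 1)) ℂ) :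
    eval (spec q t u) (shift q f) = eval (spec q t (raise u)) f := by
  rw [eval_shift, spec_raise]

lemma totalDegree_C_mul_X_le {σ : Type*} (c : ℂ) (i : σ) :
    (C c * X i : MvPolynomial σ ℂ).totalDegree ≤ 1 := by
  refine (totalDegree_mul _ _).trans ?_
  simp [totalDegree_C, totalDegree_X]

lemma totalDegree_shift_le (q : ℂ) (f : MvPolynomial (Fin (m + 1)) ℂ) :
    (shift q f).totalDegree ≤ f.totalDegree := by
  refine totalDegree_aeval_le _ (fun i => ?_) f
  refine Fin.lastCases ?_ (fun j => ?_) i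
  · simpa using totalDegree_C_mul_X_le q (0 : Fin (m + 1))
  · simp [totalDegree_X]

lemma totalDegree_unshift_le (q : ℂ) (f : MvPolynomial (Fin (m + 1)) ℂ) :
    (unshift q f).totalDegree ≤ f.totalDegree := by
  refine totalDegree_aeval_le _ (fun i => ?_) f
  refine Fin.cases ?_ (fun j => ?_) i
  · simpa using totalDegree_C_mul_X_le q⁻¹ (Fin.last m)
  · simp [totalDegree_X]

/-- The restriction `f ↦ f(t x₁, …, t x_m, 1)`. -/
def restrictLast (t : ℂ) : MvPolynomial (Fin (m + 1)) ℂ →ₐ[ℂ] MvPolynomial (Fin m) ℂ :=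
  aeval (Fin.snoc (α := fun _ => MvPolynomial (Fin m) ℂ) (fun j => C t * X j) 1)

lemma eval_restrictLast (t : ℂ) (x : Fin m → ℂ) (f : MvPolynomial (Fin (m + 1)) ℂ) :
    eval x (restrictLast t f) =
      eval (Fin.snoc (α := fun _ => ℂ) (fun j => t * x j) 1) f := by
  rw [restrictLast, eval_aeval]
  congr 1
  congr 1
  funext i
  refine Fin.lastCases ?_ (fun j => ?_) i <;> simp

lemma eval_spec_restrictLast (q t : ℂ) (w : Fin m → ℕ) (f : MvPolynomial (Fin (m + 1)) ℂ) :
    eval (spec q t w) (restrictLast t f) =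
      eval (spec q t (Fin.snoc (α := fun _ => ℕ) w 0 : Fin (m + 1) → ℕ)) f := by
  rw [eval_restrictLast, spec_snoc_zero]

lemma totalDegree_restrictLast_le (t : ℂ) (f : MvPolynomial (Fin (m + 1)) ℂ) :
    (restrictLast t f).totalDegree ≤ f.totalDegree := by
  refine totalDegree_aeval_le _ (fun i => ?_) f
  refine Fin.lastCases ?_ (fun j => ?_) i
  · simp
  · simpa using totalDegree_C_mul_X_le t j

lemma exists_factor_of_restrictLast {t : ℂ} (ht : t ≠ 0) (f : MvPolynomial (Fin (m + 1)) ℂ)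
    (h : restrictLast t f = 0) :
    ∃ g, f = (X (Fin.last m) - 1) * g ∧ (g = 0 ∨ g.totalDegree + 1 = f.totalDegree) := by
  have := exists_factor (Fin.last m) 1 f fun x hx => by
    have h1 := eval_restrictLast t (fun j => t⁻¹ * x j.castSucc) f
    rw [h, map_zero] at h1
    rw [h1]
    congr 2
    funext i
    refine Fin.lastCases ?_ (fun j => ?_) i
    · simp [hx]
    · simp [ht]
  simpa using this

end Shift

/-- A polynomial of degree at most `d` vanishing at all spectral vectors of weight at most `d`
is zero. -/
theorem eq_zero_of_vanish {q t : ℂ} (hq : q ≠ 0) (ht : t ≠ 0) (hg : Generic q t) :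
    ∀ (n d : ℕ) (f : MvPolynomial (Fin n) ℂ), f.totalDegree ≤ d →
      (∀ w, wt w ≤ d → eval (spec q t w) f = 0) → f = 0 := by
  intro n
  induction n with
  | zero =>
    intro d f _ hv
    have := hv 0 (by simp [wt])
    rw [eq_C_of_isEmpty f] at this ⊢
    simpa using this
  | succ m ih =>
    intro d
    induction d with
    | zero =>
      intro f hd hv
      obtain ⟨g, hfg, h0 | h1⟩ := exists_factor_of_restrictLast ht f
        (ih 0 _ ((totalDegree_restrictLast_le t f).trans hd) fun w hw => by
          rw [eval_spec_restrictLast]; exact hv _ (by rwa [wt_snoc_zero]))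
      · rw [hfg, h0, mul_zero]
      · omega
    | succ d ihd =>
      intro f hd hv
      obtain ⟨g, hfg, hgd⟩ := exists_factor_of_restrictLast ht f
        (ih (d + 1) _ ((totalDegree_restrictLast_le t f).trans hd) fun w hw => by
          rw [eval_spec_restrictLast]; exact hv _ (by rwa [wt_snoc_zero]))
      have hgd' : g.totalDegree ≤ d := by
        rcases hgd with h | h
        · simp [h]
        · omega
      have h0 : shift q g = 0 := by
        refine ihd _ ((totalDegree_shift_le q g).trans hgd') fun w hw => ?_
        have h1 := hv (raise w) (by rw [wt_raise]; omega)
        rw [hfg, map_mul, map_sub, eval_X, map_one, spec_raise, Fin.snoc_last, ← spec_raise,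
          mul_eq_zero, sub_eq_zero] at h1
        rw [eval_spec_shift]
        exact h1.resolve_left (hg.mul_spec_ne_one w 0)
      rw [hfg, ← unshift_shift hq g, h0, map_zero, mul_zero]

/-- The exponent vector of the monomial `x^u`. -/
abbrev expo (u : Fin n → ℕ) : Fin n →₀ ℕ := Finsupp.equivFunOnFinite.symm u

lemma prod_X_pow (u : Fin n → ℕ) :
    ∏ i, (X i : MvPolynomial (Fin n) ℂ) ^ u i = monomial (expo u) 1 := by
  rw [monomial_eq, Finsupp.prod_fintype _ _ (by simp)]
  simp

lemma aeval_expo {m : ℕ} (g : Fin n → MvPolynomial (Fin m) ℂ) (u : Fin n → ℕ) (c : ℂ) :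
    aeval g (monomial (expo u) c) = C c * ∏ i, g i ^ u i := by
  rw [aeval_monomial, Finsupp.prod_fintype _ _ (by simp)]
  rfl

lemma degree_expo (u : Fin n → ℕ) : (expo u).degree = wt u := by
  rw [Finsupp.degree_eq_sum]; rfl

lemma coeff_shift {m : ℕ} (q : ℂ) (u : Fin (m + 1) → ℕ) (f : MvPolynomial (Fin (m + 1)) ℂ) :
    coeff (expo u) (shift q f) = q ^ u 0 *
      coeff (expo (Fin.snoc (α := fun _ => ℕ) (fun j => u j.succ) (u 0))) f := by
  induction f using MvPolynomial.induction_on' with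
  | add p r hp hr => simp only [map_add, coeff_add, hp, hr]; ring
  | monomial s c =>
    obtain ⟨s, rfl⟩ := Finsupp.equivFunOnFinite.symm.surjective s
    have h1 : shift q (monomial (expo s) c) = monomial (expo (Fin.cons (α := fun _ => ℕ)
        (s (Fin.last m)) (fun j => s j.castSucc))) (c * q ^ s (Fin.last m)) := by
      rw [shift, aeval_expo, ← mul_one (c * q ^ _), ← C_mul_monomial, ← prod_X_pow,
        Fin.prod_univ_castSucc, Fin.prod_univ_succ]
      simp [mul_pow, C_mul, C_pow]
      ring
    rw [h1, coeff_monomial, coeff_monomial]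
    simp only [EmbeddingLike.apply_eq_iff_eq]
    have h2 : (Fin.cons (α := fun _ => ℕ) (s (Fin.last m)) (fun j => s j.castSucc) = u) ↔
        s = Fin.snoc (α := fun _ => ℕ) (fun j => u j.succ) (u 0) := by
      constructor
      · rintro rfl
        funext i
        refine Fin.lastCases ?_ (fun j => ?_) i <;> simp
      · rintro rfl
        funext i
        refine Fin.cases ?_ (fun j => ?_) i <;> simp
    simp only [h2]
    split_ifs with h
    · rw [h]; simp; ring
    · simp

lemma coeff_restrictLast {m : ℕ} (t : ℂ) (u : Fin m → ℕ) (f : MvPolynomial (Fin (m + 1)) ℂ)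
    (hf : f.totalDegree ≤ wt u) :
    coeff (expo u) (restrictLast t f) = t ^ wt u *
      coeff (expo (Fin.snoc (α := fun _ => ℕ) u 0)) f := by
  have key : ∀ s : Fin (m + 1) → ℕ, wt s ≤ wt u → ∀ c : ℂ,
      coeff (expo u) (restrictLast t (monomial (expo s) c)) = t ^ wt u *
      coeff (expo (Fin.snoc (α := fun _ => ℕ) u 0)) (monomial (expo s) c) := by
    intro s hs c
    have h1 : restrictLast t (monomial (expo s) c) = monomial (expo fun j => s j.castSucc)
        (c * t ^ wt (fun j => s j.castSucc)) := by
      rw [restrictLast, aeval_expo, ← mul_one (c * t ^ _), ← C_mul_monomial, ← prod_X_pow,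
        Fin.prod_univ_castSucc]
      simp [mul_pow, C_mul, C_pow, Finset.prod_mul_distrib, wt, Finset.prod_pow_eq_pow_sum]
      ring
    rw [h1, coeff_monomial, coeff_monomial]
    simp only [EmbeddingLike.apply_eq_iff_eq]
    have h2 : (fun j => s j.castSucc) = u ↔ s = Fin.snoc (α := fun _ => ℕ) u 0 := by
      constructor
      · rintro rfl
        funext i
        refine Fin.lastCases ?_ (fun j => ?_) i
        · simp only [wt, Fin.sum_univ_castSucc] at hs
          simp; omega
        · simp
      · rintro rfl
        funext i
        simp
    simp only [h2]
    split_ifs with h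
    · rw [h]; simp; ring
    · simp
  have h3 := f.as_sum
  rw [h3, map_sum, coeff_sum, coeff_sum, Finset.mul_sum]
  refine Finset.sum_congr rfl fun s hs => ?_
  obtain ⟨s, rfl⟩ := Finsupp.equivFunOnFinite.symm.surjective s
  refine key s ?_ _
  refine le_trans ?_ hf
  rw [← degree_expo]
  exact le_totalDegree hs

lemma coeff_eq_zero_of_lt {f : MvPolynomial (Fin n) ℂ} (u : Fin n → ℕ)
    (h : f.totalDegree < wt u) : coeff (expo u) f = 0 := by
  refine coeff_eq_zero_of_totalDegree_lt ?_
  rwa [← degree_expo] at h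

/-- The value at `⟨u⟩` of a polynomial of degree at most `|u|` which vanishes at all other
spectral vectors of weight at most `|u|`. -/
theorem eval_spec_self {q t : ℂ} (hq : q ≠ 0) (ht : t ≠ 0) (hg : Generic q t) :
    ∀ (n d : ℕ) (u : Fin n → ℕ) (f : MvPolynomial (Fin n) ℂ), wt u = d →
      f.totalDegree ≤ wt u → (∀ w, wt w ≤ wt u → w ≠ u → eval (spec q t w) f = 0) →
      eval (spec q t u) f * t ^ nstat u = coeff (expo u) f * cp q t u * diagVal q t u := by
  intro n
  induction n with
  | zero =>
    intro d u f _ hd hv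
    rw [eq_C_of_isEmpty f]
    have : expo u = 0 := Subsingleton.elim _ _
    simp [nstat, cp, diagVal, wt, nmax, nstat', this]
  | succ m ih =>
    intro d
    induction d with
    | zero =>
      intro u f hu hd hv
      have hu0 : u = fun _ => 0 := by
        funext i
        have := Finset.sum_eq_zero_iff.mp hu
        exact this i (Finset.mem_univ _)
      subst hu0
      rw [hu] at hd
      rw [totalDegree_eq_zero_iff_eq_C.mp (Nat.le_zero.mp hd)]
      have : expo (fun _ : Fin (m + 1) => 0) = 0 := by ext; simp
      simp [nstat, cp, diagVal, wt, nmax, nstat', this]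
    | succ d ihd =>
      intro u f hu hd hv
      by_cases hl : u (Fin.last m) = 0
      · obtain ⟨w, rfl⟩ : ∃ w : Fin m → ℕ, u = Fin.snoc (α := fun _ => ℕ) w 0 :=
          ⟨fun j => u j.castSucc, by
            funext i
            refine Fin.lastCases ?_ (fun j => ?_) i <;> simp [hl]⟩
        rw [wt_snoc_zero] at hu hd hv
        have := ih (d + 1) w (restrictLast t f) hu ((totalDegree_restrictLast_le t f).trans hd)
          fun w' hw' hne => by
            rw [eval_spec_restrictLast]
            refine hv _ (by rwa [wt_snoc_zero]) fun h => hne ?_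
            funext i
            have := congrFun h i.castSucc
            simpa using this
        rw [eval_spec_restrictLast, coeff_restrictLast t w f hd] at this
        rw [nstat_snoc_zero, this, cp_snoc_zero, diagVal_snoc_zero]
        ring
      · obtain ⟨w, rfl⟩ := exists_raise_eq u hl
        rw [wt_raise] at hu hd hv
        have hwd : wt w = d := by omega
        obtain ⟨g, hfg, hgd⟩ := exists_factor_of_restrictLast ht f
          (eq_zero_of_vanish hq ht hg m (wt w + 1) _
            ((totalDegree_restrictLast_le t f).trans hd) fun w' hw' => by
              rw [eval_spec_restrictLast]
              refine hv _ (by rwa [wt_snoc_zero]) fun h => hl ?_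
              rw [← h]; simp)
        have hgd' : g.totalDegree ≤ wt w := by
          rcases hgd with h | h
          · simp [h]
          · omega
        have hev : ∀ w' : Fin (m + 1) → ℕ, eval (spec q t (raise w')) f =
            (q * spec q t w' 0 - 1) * eval (spec q t w') (shift q g) := by
          intro w'
          rw [eval_spec_shift, hfg, map_mul, map_sub, eval_X, map_one]
          congr 2
          rw [spec_raise, Fin.snoc_last]
        have hco : coeff (expo (raise w)) f =
            coeff (expo (Fin.snoc (α := fun _ => ℕ) (fun j => w j.succ) (w 0))) g := by
          have h1 : expo (raise w) = Finsupp.single (Fin.last m) 1 +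
              expo (Fin.snoc (α := fun _ => ℕ) (fun j => w j.succ) (w 0)) := by
            ext i
            refine Fin.lastCases ?_ (fun j => ?_) i
            · simp [add_comm]
            · simp
          rw [hfg, sub_mul, coeff_sub, one_mul, coeff_eq_zero_of_lt (f := g) (raise w)
            (by rw [wt_raise]; omega), h1, coeff_X_mul, sub_zero]
        have h2 := ihd w (shift q g) hwd ((totalDegree_shift_le q g).trans hgd')
          fun w' hw' hne => by
            have h3 := hv (raise w') (by rw [wt_raise]; omega) fun h => hne (raise_injective h)
            rw [hev, mul_eq_zero, sub_eq_zero] at h3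
            exact h3.resolve_left (hg.mul_spec_ne_one w' 0)
        rw [hev, nstat_raise, cp_raise, diagVal_raise, hco, pow_add]
        rw [coeff_shift] at h2
        have h4 : spec q t w 0 = q ^ w 0 * t ^ (m - lp w 0) := rfl
        linear_combination (q * spec q t w 0 - 1) * t ^ (m - lp w 0) * h2 +
          (q * spec q t w 0 - 1) * (-1) * cp q t w * diagVal q t w *
          coeff (expo (Fin.snoc (α := fun _ => ℕ) (fun j => w j.succ) (w 0))) g * h4

/-- The properties of the normalised interpolation polynomials used in the sequel. -/
structure NormInterp (q t : ℂ) (P : (Fin n → ℕ) → MvPolynomial (Fin n) ℂ) : Prop where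
  deg : ∀ u, (P u).totalDegree ≤ wt u
  van : ∀ u w, wt w ≤ wt u → w ≠ u → eval (spec q t w) (P u) = 0
  diag : ∀ u, eval (spec q t u) (P u) = diagVal q t u

theorem IsInterpFamily.normInterp {q t : ℂ} (hq : q ≠ 0) (ht : t ≠ 0) (hg : Generic q t)
    {M : (Fin n → ℕ) → MvPolynomial (Fin n) ℂ} (hM : IsInterpFamily q t M) :
    NormInterp q t (MM q t M) where
  deg u := by
    refine (totalDegree_mul _ _).trans ?_
    rw [totalDegree_C, zero_add]
    exact (hM u).1
  van u w hw hne := by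
    rw [MM, map_mul, (hM u).2.2 w hw hne, mul_zero]
  diag u := by
    have h1 := eval_spec_self hq ht hg n _ u (M u) rfl (hM u).1 (hM u).2.2
    have h2 : coeff (expo u) (M u) = _ := (hM u).2.1
    rw [h2] at h1
    have h3 := cp_ne_zero hg u
    have h4 : q ^ nstat' u ≠ 0 := pow_ne_zero _ hq
    rw [MM, map_mul, eval_C]
    field_simp at h1 ⊢
    linear_combination h1

section
variable {m : ℕ}

lemma X_sub_X_dvd (i : Fin m) (f : MvPolynomial (Fin (m + 1)) ℂ) :
    (X i.succ - X i.castSucc) ∣ rename (adj i) f - f := by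
  rw [← Ideal.mem_span_singleton, ← Ideal.Quotient.mk_eq_mk_iff_sub_mem]
  set I := Ideal.span {(X i.succ - X i.castSucc : MvPolynomial (Fin (m + 1)) ℂ)} with hI
  have h0 : (Ideal.Quotient.mk I) (X i.succ) = Ideal.Quotient.mk I (X i.castSucc) := by
    rw [Ideal.Quotient.mk_eq_mk_iff_sub_mem]
    exact Ideal.mem_span_singleton_self _
  have : (Ideal.Quotient.mkₐ ℂ I).comp (rename (adj i)) = Ideal.Quotient.mkₐ ℂ I := by
    refine MvPolynomial.algHom_ext fun j => ?_
    simp only [AlgHom.comp_apply, rename_X, Ideal.Quotient.mkₐ_eq_mk, adj, Equiv.swap_apply_def]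
    split_ifs with h1 h2
    · rw [h1, h0]
    · rw [h2, h0]
    · rfl
  exact DFunLike.congr_fun this f

/-- The divided difference `(s_i f - f) / (x_{i+1} - x_i)`. -/
def divDiff (i : Fin m) (f : MvPolynomial (Fin (m + 1)) ℂ) : MvPolynomial (Fin (m + 1)) ℂ :=
  Classical.choose (X_sub_X_dvd i f)

lemma mul_divDiff (i : Fin m) (f : MvPolynomial (Fin (m + 1)) ℂ) :
    (X i.succ - X i.castSucc) * divDiff i f = rename (adj i) f - f :=
  (Classical.choose_spec (X_sub_X_dvd i f)).symm

lemma X_sub_X_ne_zero (i : Fin m) :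
    (X i.succ - X i.castSucc : MvPolynomial (Fin (m + 1)) ℂ) ≠ 0 := by
  rw [sub_ne_zero]
  intro h
  exact Fin.castSucc_lt_succ.ne' (X_injective h)

/-- The Demazure–Lusztig operator. -/
def heckeFun (t : ℂ) (i : Fin m) (f : MvPolynomial (Fin (m + 1)) ℂ) :
    MvPolynomial (Fin (m + 1)) ℂ :=
  C t * f + (C t * X i.succ - X i.castSucc) * divDiff i f

lemma mul_heckeFun (t : ℂ) (i : Fin m) (f : MvPolynomial (Fin (m + 1)) ℂ) :
    (X i.succ - X i.castSucc) * heckeFun t i f =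
      (C t * X i.succ - X i.castSucc) * rename (adj i) f + (1 - C t) * X i.castSucc * f := by
  rw [heckeFun]
  linear_combination (C t * X i.succ - X i.castSucc) * mul_divDiff i f

/-- The Demazure–Lusztig operator, as a linear map. -/
def hecke (t : ℂ) (i : Fin m) : Module.End ℂ (MvPolynomial (Fin (m + 1)) ℂ) where
  toFun := heckeFun t i
  map_add' f g := by
    apply mul_left_cancel₀ (X_sub_X_ne_zero i)
    rw [mul_add, mul_heckeFun, mul_heckeFun, mul_heckeFun, map_add]
    ring
  map_smul' c f := by
    apply mul_left_cancel₀ (X_sub_X_ne_zero i)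
    rw [RingHom.id_apply, mul_smul_comm, mul_heckeFun, mul_heckeFun, map_smul]
    simp only [smul_eq_C_mul]
    ring

lemma mul_hecke (t : ℂ) (i : Fin m) (f : MvPolynomial (Fin (m + 1)) ℂ) :
    (X i.succ - X i.castSucc) * hecke t i f =
      (C t * X i.succ - X i.castSucc) * rename (adj i) f + (1 - C t) * X i.castSucc * f :=
  mul_heckeFun t i f

@[simp] lemma rename_adj_rename_adj (i : Fin m) (f : MvPolynomial (Fin (m + 1)) ℂ) :
    rename (adj i) (rename (adj i) f) = f := by
  rw [rename_rename]
  have : (adj i : Fin (m + 1) → Fin (m + 1)) ∘ adj i = id := by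
    funext x; simp
  rw [this, rename_id, AlgHom.id_apply]

@[simp] lemma rename_adj_X_castSucc (i : Fin m) :
    rename (adj i) (X i.castSucc : MvPolynomial (Fin (m + 1)) ℂ) = X i.succ := by
  simp

@[simp] lemma rename_adj_X_succ (i : Fin m) :
    rename (adj i) (X i.succ : MvPolynomial (Fin (m + 1)) ℂ) = X i.castSucc := by
  simp

lemma hecke_sq (t : ℂ) (i : Fin m) (f : MvPolynomial (Fin (m + 1)) ℂ) :
    hecke t i (hecke t i f) = C (t - 1) * hecke t i f + C t * f := by
  have h1 := mul_hecke t i f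
  have h2 := mul_hecke t i (hecke t i f)
  have h3 := congrArg (rename (adj i)) h1
  simp only [map_mul, map_add, map_sub, rename_adj_X_castSucc, rename_adj_X_succ,
    rename_adj_rename_adj, algHom_C, map_one] at h3
  apply mul_left_cancel₀ (X_sub_X_ne_zero i)
  apply mul_left_cancel₀ (X_sub_X_ne_zero i)
  simp only [map_sub, map_one]
  linear_combination (X i.succ - X i.castSucc) * h2 -
    (C t * X i.succ - X i.castSucc) * h3 + (1 - C t) * X i.castSucc * h1 +
    (1 - C t) * (X i.succ - X i.castSucc) * h1

lemma hecke_injective {t : ℂ} (ht : t ≠ 0) (i : Fin m) : Function.Injective (hecke t i) := by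
  rw [← LinearMap.ker_eq_bot, LinearMap.ker_eq_bot']
  intro f hf
  have := hecke_sq t i f
  rw [hf, map_zero, mul_zero, zero_add] at this
  simpa [ht] using this.symm

lemma hecke_mul_of_symm (t : ℂ) (i : Fin m) (g f : MvPolynomial (Fin (m + 1)) ℂ)
    (hg : rename (adj i) g = g) : hecke t i (g * f) = g * hecke t i f := by
  apply mul_left_cancel₀ (X_sub_X_ne_zero i)
  have h1 := mul_hecke t i f
  rw [mul_hecke, map_mul, hg]
  linear_combination -g * h1

lemma hecke_X_succ_mul (t : ℂ) (i : Fin m) (f : MvPolynomial (Fin (m + 1)) ℂ) :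
    hecke t i (X i.succ * f) = X i.castSucc * (hecke t i f - C (t - 1) * f) := by
  apply mul_left_cancel₀ (X_sub_X_ne_zero i)
  have h1 := mul_hecke t i f
  rw [mul_hecke, map_mul, rename_adj_X_succ]
  simp only [map_sub, map_one]
  linear_combination -X i.castSucc * h1

lemma hecke_X_castSucc_mul (t : ℂ) (i : Fin m) (f : MvPolynomial (Fin (m + 1)) ℂ) :
    hecke t i (X i.castSucc * f) = X i.succ * hecke t i f + C (t - 1) * (X i.castSucc * f) := by
  apply mul_left_cancel₀ (X_sub_X_ne_zero i)
  have h1 := mul_hecke t i f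
  rw [mul_hecke, map_mul, rename_adj_X_castSucc]
  simp only [map_sub, map_one]
  linear_combination -X i.succ * h1

lemma hecke_X_mul_of_ne (t : ℂ) (i : Fin m) (j : Fin (m + 1)) (h1 : j ≠ i.castSucc)
    (h2 : j ≠ i.succ) (f : MvPolynomial (Fin (m + 1)) ℂ) :
    hecke t i (X j * f) = X j * hecke t i f :=
  hecke_mul_of_symm t i _ _ (by rw [rename_X, adj, Equiv.swap_apply_of_ne_of_ne h1 h2])

lemma hecke_X_hecke (t : ℂ) (i : Fin m) (f : MvPolynomial (Fin (m + 1)) ℂ) :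
    hecke t i (X i.succ * hecke t i f) = C t * (X i.castSucc * f) := by
  rw [hecke_X_succ_mul, hecke_sq]
  ring

lemma eval_hecke_of_eq_zero (t : ℂ) (i : Fin m) (f : MvPolynomial (Fin (m + 1)) ℂ)
    (x : Fin (m + 1) → ℂ) (hx : x i.castSucc = 0) :
    eval x (hecke t i f) = t * eval (x ∘ adj i) f := by
  have h1 := congrArg (eval x) (mul_divDiff i f)
  have h2 : hecke t i f = C t * f + (C t * X i.succ - X i.castSucc) * divDiff i f := rfl
  rw [h2]
  simp only [map_mul, map_add, map_sub, eval_X, eval_rename, eval_C, hx] at h1 ⊢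
  linear_combination t * h1

lemma mul_eval_hecke (t : ℂ) (i : Fin m) (f : MvPolynomial (Fin (m + 1)) ℂ)
    (x : Fin (m + 1) → ℂ) :
    (x i.succ - x i.castSucc) * eval x (hecke t i f) =
      (t * x i.succ - x i.castSucc) * eval (x ∘ adj i) f +
        (1 - t) * x i.castSucc * eval x f := by
  have h1 := congrArg (eval x) (mul_hecke t i f)
  simpa only [map_mul, map_add, map_sub, eval_X, eval_rename, eval_C, map_one] using h1

lemma Generic.t_ne_one {q t : ℂ} (hg : Generic q t) : t ≠ 1 := by
  have := hg 0 1 (by simp)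
  simpa using this

lemma Generic.pow_mul_pow_inj {q t : ℂ} (hq : q ≠ 0) (ht : t ≠ 0) (hg : Generic q t)
    {a b c d : ℕ} (hab : a ≠ b) : q ^ a * t ^ c ≠ q ^ b * t ^ d := by
  intro h
  refine hg (a - b) (c - d) (by intro h; apply hab; have := h.1; omega) ?_
  rw [zpow_sub₀ hq, zpow_sub₀ ht]
  simp only [zpow_natCast]
  rw [div_mul_div_comm, h, div_self]
  simp [hq, ht]

/-- The off-diagonal coefficient in the action of `hecke t i` at `⟨u⟩`. -/
def offCoeff (q t : ℂ) (i : Fin m) (u : Fin (m + 1) → ℕ) : ℂ :=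
  (t * spec q t u i.succ - spec q t u i.castSucc) /
    (spec q t u i.succ - spec q t u i.castSucc)

lemma spec_ne_spec {q t : ℂ} (hq : q ≠ 0) (ht : t ≠ 0) (hg : Generic q t) {i j : Fin n}
    {u : Fin n → ℕ} (h : u i ≠ u j) : spec q t u i ≠ spec q t u j :=
  hg.pow_mul_pow_inj hq ht h

lemma offCoeff_ne_zero {q t : ℂ} (hq : q ≠ 0) (ht : t ≠ 0) (hg : Generic q t) (i : Fin m)
    {u : Fin (m + 1) → ℕ} (h : u i.castSucc ≠ u i.succ) : offCoeff q t i u ≠ 0 := by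
  refine div_ne_zero (sub_ne_zero.mpr ?_)
    (sub_ne_zero.mpr (spec_ne_spec hq ht hg h.symm))
  have := hg.pow_mul_pow_inj hq ht h.symm (c := m + 1 - 1 - lp u i.succ + 1)
    (d := m + 1 - 1 - lp u i.castSucc)
  rw [pow_succ] at this
  intro h0
  apply this
  rw [show spec q t u i.castSucc = q ^ u i.castSucc * t ^ (m + 1 - 1 - lp u i.castSucc) from rfl]
    at h0
  rw [← h0, spec]
  ring

lemma eval_spec_hecke_of_ne {q t : ℂ} (hq : q ≠ 0) (ht : t ≠ 0) (hg : Generic q t) (i : Fin m)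
    {u : Fin (m + 1) → ℕ} (h : u i.castSucc ≠ u i.succ) (f : MvPolynomial (Fin (m + 1)) ℂ) :
    eval (spec q t u) (hecke t i f) = (t - offCoeff q t i u) * eval (spec q t u) f +
      offCoeff q t i u * eval (spec q t (u ∘ adj i)) f := by
  have h1 := mul_eval_hecke t i f (spec q t u)
  have h2 := sub_ne_zero.mpr (spec_ne_spec hq ht hg h.symm)
  apply mul_left_cancel₀ h2
  rw [h1, spec_comp_adj q t u i h, offCoeff]
  field_simp
  ring

lemma eval_hecke_of_eq_mul {t : ℂ} (ht : t ≠ 1) (i : Fin m) (x : Fin (m + 1) → ℂ)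
    (hx : x i.succ ≠ 0) (h : x i.castSucc = t * x i.succ) (f : MvPolynomial (Fin (m + 1)) ℂ) :
    eval x (hecke t i f) = t * eval x f := by
  have h1 := mul_eval_hecke t i f x
  rw [h] at h1
  have h2 : (1 - t) * x i.succ ≠ 0 := mul_ne_zero (sub_ne_zero.mpr ht.symm) hx
  apply mul_left_cancel₀ h2
  linear_combination h1

lemma eval_spec_hecke_of_eq {q t : ℂ} (hq : q ≠ 0) (ht : t ≠ 0) (hg : Generic q t) (i : Fin m)
    {u : Fin (m + 1) → ℕ} (h : u i.castSucc = u i.succ) (f : MvPolynomial (Fin (m + 1)) ℂ) :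
    eval (spec q t u) (hecke t i f) = t * eval (spec q t u) f :=
  eval_hecke_of_eq_mul hg.t_ne_one i _ (spec_ne_zero hq ht u _) (spec_castSucc_of_eq q t u i h) f

lemma totalDegree_hecke_le (t : ℂ) (i : Fin m) (f : MvPolynomial (Fin (m + 1)) ℂ) :
    (hecke t i f).totalDegree ≤ f.totalDegree := by
  rcases eq_or_ne (hecke t i f) 0 with h0 | h0
  · simp [h0]
  have hD : (X i.succ - X i.castSucc : MvPolynomial (Fin (m + 1)) ℂ).totalDegree = 1 :=
    ((isHomogeneous_X ℂ i.succ).sub (isHomogeneous_X ℂ i.castSucc)).totalDegree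
      (X_sub_X_ne_zero i)
  have h1 := congrArg totalDegree (mul_hecke t i f)
  rw [totalDegree_mul_of_isDomain (X_sub_X_ne_zero i) h0, hD] at h1
  have h2 : ((C t * X i.succ - X i.castSucc) * rename (adj i) f +
      (1 - C t) * X i.castSucc * f).totalDegree ≤ 1 + f.totalDegree := by
    refine (totalDegree_add _ _).trans (max_le ?_ ?_)
    · refine (totalDegree_mul _ _).trans (add_le_add ?_ (totalDegree_rename_le _ _))
      refine (totalDegree_sub _ _).trans (max_le (totalDegree_C_mul_X_le _ _) ?_)
      simp [totalDegree_X]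
    · refine (totalDegree_mul _ _).trans (add_le_add ?_ le_rfl)
      rw [← C_1, ← C_sub]
      exact totalDegree_C_mul_X_le _ _
  omega

lemma homogeneousComponent_X_mul {σ : Type*} (d : ℕ) (k : σ) (f : MvPolynomial σ ℂ) :
    homogeneousComponent (d + 1) (X k * f) = X k * homogeneousComponent d f := by
  induction f using MvPolynomial.induction_on' with
  | add p r hp hr => simp only [mul_add, map_add, hp, hr]
  | monomial s c =>
    have h1 : (monomial s c : MvPolynomial σ ℂ) ∈ homogeneousSubmodule σ ℂ s.degree :=
      isHomogeneous_monomial c rfl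
    have h2 : X k * (monomial s c : MvPolynomial σ ℂ) ∈ homogeneousSubmodule σ ℂ (1 + s.degree) :=
      (isHomogeneous_X ℂ k).mul (isHomogeneous_monomial c rfl)
    rw [homogeneousComponent_of_mem h1, homogeneousComponent_of_mem h2]
    by_cases h : d = s.degree
    · rw [if_pos h, if_pos (by omega)]
    · rw [if_neg h, if_neg (by omega), mul_zero]

lemma homogeneousComponent_aeval {σ τ : Type*} (g : σ → MvPolynomial τ ℂ)
    (hg : ∀ i, (g i).IsHomogeneous 1) (d : ℕ) (f : MvPolynomial σ ℂ) :
    homogeneousComponent d (aeval g f) = aeval g (homogeneousComponent d f) := by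
  induction f using MvPolynomial.induction_on' with
  | add p r hp hr => simp only [map_add, hp, hr]
  | monomial s c =>
    have h1 : (monomial s c : MvPolynomial σ ℂ).IsHomogeneous s.degree :=
      isHomogeneous_monomial c rfl
    have h2 : (aeval g (monomial s c)) ∈ homogeneousSubmodule τ ℂ (1 * s.degree) :=
      h1.aeval g hg
    rw [homogeneousComponent_of_mem h1, homogeneousComponent_of_mem h2, one_mul]
    split_ifs <;> simp

lemma homogeneousComponent_C_mul' {σ : Type*} (d : ℕ) (c : ℂ) (f : MvPolynomial σ ℂ) :
    homogeneousComponent d (C c * f) = C c * homogeneousComponent d f :=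
  homogeneousComponent_C_mul f d c

lemma homogeneousComponent_rename (s : Fin n → Fin n) (d : ℕ) (f : MvPolynomial (Fin n) ℂ) :
    homogeneousComponent d (rename s f) = rename s (homogeneousComponent d f) := by
  have : (rename s : MvPolynomial (Fin n) ℂ →ₐ[ℂ] _) = aeval (fun i => X (s i)) :=
    MvPolynomial.algHom_ext fun i => by simp
  rw [this, homogeneousComponent_aeval _ fun i => isHomogeneous_X ℂ _]

lemma homogeneousComponent_unshift (q : ℂ) (d : ℕ) (f : MvPolynomial (Fin (m + 1)) ℂ) :
    homogeneousComponent d (unshift q f) = unshift q (homogeneousComponent d f) := by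
  refine homogeneousComponent_aeval _ (fun i => ?_) d f
  refine Fin.cases ?_ (fun j => ?_) i
  · simpa using isHomogeneous_C_mul_X q⁻¹ (Fin.last m)
  · simpa using isHomogeneous_X ℂ _

lemma homogeneousComponent_hecke (t : ℂ) (i : Fin m) (d : ℕ) (f : MvPolynomial (Fin (m + 1)) ℂ) :
    homogeneousComponent d (hecke t i f) = hecke t i (homogeneousComponent d f) := by
  apply mul_left_cancel₀ (X_sub_X_ne_zero i)
  have h := congrArg (homogeneousComponent (d + 1)) (mul_hecke t i f)
  rw [mul_hecke]
  have e : ∀ (k : Fin (m + 1)) (c : ℂ) (f : MvPolynomial (Fin (m + 1)) ℂ),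
    homogeneousComponent (d + 1) (C c * X k * f) = C c * X k * homogeneousComponent d f := by
    intro k c f
    rw [mul_assoc, homogeneousComponent_C_mul', homogeneousComponent_X_mul, mul_assoc]
  simp only [sub_mul, map_sub, map_add, e, homogeneousComponent_X_mul, one_mul,
    homogeneousComponent_rename] at h ⊢
  exact h

/-- The operators `T₀ ⋯ T_{j-1}`. -/
def ascOp (t : ℂ) : Fin (m + 1) → Module.End ℂ (MvPolynomial (Fin (m + 1)) ℂ) :=
  Fin.induction (motive := fun _ => Module.End ℂ (MvPolynomial (Fin (m + 1)) ℂ)) 1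
    (fun i P => P * hecke t i)

/-- The operators `T_{j-1} ⋯ T₀`. -/
def descOp (t : ℂ) : Fin (m + 1) → Module.End ℂ (MvPolynomial (Fin (m + 1)) ℂ) :=
  Fin.induction (motive := fun _ => Module.End ℂ (MvPolynomial (Fin (m + 1)) ℂ)) 1
    (fun i P => hecke t i * P)

@[simp] lemma ascOp_zero (t : ℂ) (f : MvPolynomial (Fin (m + 1)) ℂ) : ascOp t 0 f = f := rfl

@[simp] lemma descOp_zero (t : ℂ) (f : MvPolynomial (Fin (m + 1)) ℂ) : descOp t 0 f = f := rfl

lemma ascOp_succ (t : ℂ) (i : Fin m) (f : MvPolynomial (Fin (m + 1)) ℂ) :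
    ascOp t i.succ f = ascOp t i.castSucc (hecke t i f) := by
  simp only [ascOp, Fin.induction_succ, Module.End.mul_apply]

lemma descOp_succ (t : ℂ) (i : Fin m) (f : MvPolynomial (Fin (m + 1)) ℂ) :
    descOp t i.succ f = hecke t i (descOp t i.castSucc f) := by
  simp only [descOp, Fin.induction_succ, Module.End.mul_apply]

lemma ascOp_injective {t : ℂ} (ht : t ≠ 0) (j : Fin (m + 1)) :
    Function.Injective (ascOp t j) := by
  induction j using Fin.induction with
  | zero => exact fun f g h => h
  | succ i ih =>
    intro f g h
    rw [ascOp_succ, ascOp_succ] at h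
    exact hecke_injective ht i (ih h)

lemma C_mul_eq_smul {σ : Type*} (c : ℂ) (f : MvPolynomial σ ℂ) : C c * f = c • f :=
  (smul_eq_C_mul f c).symm

lemma map_C_mul {σ τ : Type*} (L : MvPolynomial σ ℂ →ₗ[ℂ] MvPolynomial τ ℂ) (c : ℂ)
    (f : MvPolynomial σ ℂ) : L (C c * f) = C c * L f := by
  rw [C_mul_eq_smul, map_smul, C_mul_eq_smul]

lemma ascOp_X_descOp (t : ℂ) (j : Fin (m + 1)) (f : MvPolynomial (Fin (m + 1)) ℂ) :
    ascOp t j (X j * descOp t j f) = C (t ^ (j : ℕ)) * (X 0 * f) := by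
  induction j using Fin.induction with
  | zero => simp
  | succ i ih =>
    rw [ascOp_succ, descOp_succ, hecke_X_hecke, map_C_mul, ih, Fin.val_castSucc, Fin.val_succ,
      pow_succ', C_mul, mul_assoc]

lemma totalDegree_ascOp_le (t : ℂ) (j : Fin (m + 1)) (f : MvPolynomial (Fin (m + 1)) ℂ) :
    (ascOp t j f).totalDegree ≤ f.totalDegree := by
  induction j using Fin.induction generalizing f with
  | zero => simp
  | succ i ih => rw [ascOp_succ]; exact (ih _).trans (totalDegree_hecke_le t i f)

lemma homogeneousComponent_ascOp (t : ℂ) (j : Fin (m + 1)) (d : ℕ)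
    (f : MvPolynomial (Fin (m + 1)) ℂ) :
    homogeneousComponent d (ascOp t j f) = ascOp t j (homogeneousComponent d f) := by
  induction j using Fin.induction generalizing f with
  | zero => simp
  | succ i ih => rw [ascOp_succ, ascOp_succ, ih, homogeneousComponent_hecke]

lemma insertNth_comp_adj (i : Fin m) (x : Fin m → ℂ) :
    (i.castSucc.insertNth (α := fun _ => ℂ) 0 x) ∘ adj i =
      i.succ.insertNth (α := fun _ => ℂ) 0 x := by
  funext k
  rcases Fin.eq_self_or_eq_succAbove i.succ k with rfl | ⟨p, rfl⟩
  · simp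
  · have : adj i (i.succ.succAbove p) = i.castSucc.succAbove p := by
      simp only [adj, Equiv.swap_apply_def, Fin.succAbove, Fin.lt_def, Fin.ext_iff]
      split_ifs <;> simp_all <;> omega
    rw [Function.comp_apply, this]
    simp

lemma eval_ascOp (t : ℂ) (j : Fin (m + 1)) (f : MvPolynomial (Fin (m + 1)) ℂ)
    (x : Fin (m + 1) → ℂ) (hx : x 0 = 0) :
    eval x (ascOp t j f) =
      t ^ (j : ℕ) * eval (j.insertNth (α := fun _ => ℂ) 0 (fun k => x k.succ)) f := by
  induction j using Fin.induction generalizing f with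
  | zero =>
    simp only [ascOp_zero, Fin.val_zero, pow_zero, one_mul]
    congr 2
    funext k
    refine Fin.cases ?_ (fun k => ?_) k <;> simp [hx]
  | succ i ih =>
    rw [ascOp_succ, ih, eval_hecke_of_eq_zero _ _ _ _ (by simp), insertNth_comp_adj]
    simp [pow_succ]
    ring

lemma eval_ascOp_last (t : ℂ) (f : MvPolynomial (Fin (m + 1)) ℂ)
    (x : Fin (m + 1) → ℂ) (hx : x 0 = 0) :
    eval x (ascOp t (Fin.last m) f) =
      t ^ m * eval (Fin.snoc (α := fun _ => ℂ) (fun k => x k.succ) 0) f := by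
  rw [eval_ascOp t _ f x hx, Fin.insertNth_last]
  simp

/-- Nonzero generic parameters. -/
structure GoodParams (q t : ℂ) : Prop where
  hq : q ≠ 0
  ht : t ≠ 0
  generic : Generic q t

/-- Induction on compositions by raising and by adjacent transpositions. -/
theorem composition_induction {p : (Fin (m + 1) → ℕ) → Prop} (h0 : p fun _ => 0)
    (hr : ∀ u, p u → p (raise u))
    (ha : ∀ (i : Fin m) (u), u i.castSucc ≠ u i.succ → p u → p (u ∘ adj i)) (u) : p u := by
  suffices h : ∀ d u, wt u = d → p u from h _ u rfl
  intro d
  induction d with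
  | zero =>
    intro u hu
    have : u = fun _ => 0 := funext fun i => Finset.sum_eq_zero_iff.mp hu i (Finset.mem_univ _)
    rw [this]; exact h0
  | succ d ih =>
    have key : ∀ (j : Fin (m + 1)) (u), wt u = d + 1 → u j ≠ 0 → p u := by
      intro j
      induction j using Fin.reverseInduction with
      | last =>
        intro u hu hj
        obtain ⟨w, rfl⟩ := exists_raise_eq u hj
        rw [wt_raise] at hu
        exact hr w (ih w (by omega))
      | cast i ihi =>
        intro u hu hj
        by_cases h : u i.succ = 0
        · have h1 := ihi (u ∘ adj i) (by rw [wt_comp_perm, hu]) (by simpa using hj)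
          have h2 := ha i (u ∘ adj i) (by simp [h]; exact hj.symm) h1
          have h3 : (u ∘ adj i) ∘ adj i = u := by funext x; simp
          rwa [h3] at h2
        · exact ihi u hu h
    intro u hu
    obtain ⟨j, hj⟩ : ∃ j, u j ≠ 0 := by
      by_contra! h
      simp [wt, h] at hu
    exact key j u hu hj

lemma eq_of_eval_spec {q t : ℂ} (hp : GoodParams q t) (d : ℕ) {f g : MvPolynomial (Fin n) ℂ}
    (hf : f.totalDegree ≤ d) (hg : g.totalDegree ≤ d)
    (h : ∀ w, wt w ≤ d → eval (spec q t w) f = eval (spec q t w) g) : f = g := by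
  rw [← sub_eq_zero]
  refine eq_zero_of_vanish hp.hq hp.ht hp.generic n d _
    ((totalDegree_sub _ _).trans (max_le hf hg)) fun w hw => ?_
  rw [map_sub, h w hw, sub_self]

lemma totalDegree_C_mul_le {σ : Type*} (c : ℂ) (f : MvPolynomial σ ℂ) :
    (C c * f).totalDegree ≤ f.totalDegree := by
  refine (totalDegree_mul _ _).trans ?_
  simp [totalDegree_C]

lemma comp_adj_comp_adj {α : Type*} (u : Fin (m + 1) → α) (i : Fin m) :
    (u ∘ adj i) ∘ adj i = u := by
  funext x; simp

/-- The top homogeneous components. -/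
def topPart (P : (Fin n → ℕ) → MvPolynomial (Fin n) ℂ) (u : Fin n → ℕ) :
    MvPolynomial (Fin n) ℂ := homogeneousComponent (wt u) (P u)

section Relations
variable {q t : ℂ} {P : (Fin (m + 1) → ℕ) → MvPolynomial (Fin (m + 1)) ℂ}

lemma NormInterp.hecke_of_eq (hP : NormInterp q t P) (hp : GoodParams q t) (i : Fin m)
    (u : Fin (m + 1) → ℕ) (h : u i.castSucc = u i.succ) :
    hecke t i (P u) = C t * P u := by
  refine eq_of_eval_spec hp (wt u) ((totalDegree_hecke_le _ _ _).trans (hP.deg u))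
    ((totalDegree_C_mul_le _ _).trans (hP.deg u)) fun w hw => ?_
  rw [map_mul, eval_C]
  by_cases hw' : w i.castSucc = w i.succ
  · rw [eval_spec_hecke_of_eq hp.hq hp.ht hp.generic i hw']
  · have h1 : w ≠ u := by rintro rfl; exact hw' h
    have h2 : w ∘ adj i ≠ u := by
      rintro rfl
      apply hw'
      simpa using h.symm
    rw [eval_spec_hecke_of_ne hp.hq hp.ht hp.generic i hw', hP.van u w hw h1,
      hP.van u (w ∘ adj i) (by rwa [wt_comp_perm]) h2]
    ring

lemma NormInterp.hecke_of_ne (hP : NormInterp q t P) (hp : GoodParams q t) (i : Fin m)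
    (u : Fin (m + 1) → ℕ) (h : u i.castSucc ≠ u i.succ) :
    hecke t i (P u) = C (t - offCoeff q t i u) * P u +
      C (offCoeff q t i (u ∘ adj i)) * P (u ∘ adj i) := by
  have hne : u ∘ adj i ≠ u := by
    intro h'
    apply h
    have := congrFun h' i.succ
    simpa using this
  have hwu : wt (u ∘ adj i) = wt u := wt_comp_perm _ _
  refine eq_of_eval_spec hp (wt u) ((totalDegree_hecke_le _ _ _).trans (hP.deg u))
    ((totalDegree_add _ _).trans (max_le ((totalDegree_C_mul_le _ _).trans (hP.deg u))
      ((totalDegree_C_mul_le _ _).trans (hwu ▸ hP.deg (u ∘ adj i))))) fun w hw => ?_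
  rw [map_add, map_mul, map_mul, eval_C, eval_C]
  by_cases hw' : w i.castSucc = w i.succ
  · have h1 : w ≠ u := by rintro rfl; exact h hw'
    have h2 : w ≠ u ∘ adj i := by
      rintro rfl
      apply h
      simpa using hw'.symm
    rw [eval_spec_hecke_of_eq hp.hq hp.ht hp.generic i hw', hP.van u w hw h1,
      hP.van (u ∘ adj i) w (by rwa [wt_comp_perm]) h2]
    ring
  · rw [eval_spec_hecke_of_ne hp.hq hp.ht hp.generic i hw']
    by_cases h1 : w = u
    · subst h1
      rw [hP.van w (w ∘ adj i) hwu.le hne, hP.van (w ∘ adj i) w hwu.ge hne.symm]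
      ring
    · by_cases h2 : w = u ∘ adj i
      · subst h2
        rw [comp_adj_comp_adj, hP.van u _ hwu.le hne, hP.diag, hP.diag, diagVal_comp_perm]
        ring
      · have h3 : w ∘ adj i ≠ u := by
          rintro rfl
          exact h2 (comp_adj_comp_adj _ _).symm
        rw [hP.van u w hw h1, hP.van (u ∘ adj i) w (by rwa [wt_comp_perm]) h2,
          hP.van u (w ∘ adj i) (by rwa [wt_comp_perm]) h3]
        ring

lemma spec_last_of_eq_zero (w : Fin (m + 1) → ℕ) (h : w (Fin.last m) = 0) :
    spec q t w (Fin.last m) = 1 := by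
  have : w = Fin.snoc (α := fun _ => ℕ) (fun j => w j.castSucc) 0 := by
    funext i
    refine Fin.lastCases ?_ (fun j => ?_) i <;> simp [h]
  rw [this, spec_snoc_zero]
  simp

lemma eval_spec_raise_unshift (hp : GoodParams q t) (w : Fin (m + 1) → ℕ)
    (f : MvPolynomial (Fin (m + 1)) ℂ) :
    eval (spec q t (raise w)) ((X (Fin.last m) - 1) * unshift q f) =
      (q * spec q t w 0 - 1) * eval (spec q t w) f := by
  rw [map_mul, map_sub, eval_X, map_one, ← eval_spec_shift, shift_unshift hp.hq, spec_raise]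
  simp

lemma eval_spec_unshift_of_eq_zero (w : Fin (m + 1) → ℕ) (h : w (Fin.last m) = 0)
    (f : MvPolynomial (Fin (m + 1)) ℂ) :
    eval (spec q t w) ((X (Fin.last m) - 1) * f) = 0 := by
  rw [map_mul, map_sub, eval_X, map_one, spec_last_of_eq_zero w h]
  simp

lemma totalDegree_X_sub_one_mul_le {σ : Type*} (k : σ) (f : MvPolynomial σ ℂ) (d : ℕ)
    (hf : f.totalDegree ≤ d) : ((X k - 1) * f).totalDegree ≤ d + 1 := by
  refine (totalDegree_mul _ _).trans ?_
  have := totalDegree_X_sub_C k (1 : ℂ)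
  rw [C_1] at this
  omega

lemma NormInterp.raise_eq (hP : NormInterp q t P) (hp : GoodParams q t) (u : Fin (m + 1) → ℕ) :
    P (raise u) = C (spec q t u 0 / (1 - q * spec q t u 0)) *
      ((X (Fin.last m) - 1) * unshift q (P u)) := by
  refine eq_of_eval_spec hp (wt u + 1) (wt_raise u ▸ hP.deg _)
    ((totalDegree_C_mul_le _ _).trans (totalDegree_X_sub_one_mul_le _ _ _
      ((totalDegree_unshift_le _ _).trans (hP.deg u)))) fun w hw => ?_
  rw [map_mul, eval_C]
  by_cases h : w (Fin.last m) = 0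
  · rw [eval_spec_unshift_of_eq_zero w h, hP.van _ _ (by rwa [wt_raise]), mul_zero]
    rintro rfl
    simp at h
  · obtain ⟨w, rfl⟩ := exists_raise_eq w h
    rw [eval_spec_raise_unshift hp]
    rw [wt_raise] at hw
    by_cases h1 : w = u
    · subst h1
      rw [hP.diag, hP.diag, diagVal_raise]
      have h2 := sub_ne_zero.mpr (hp.generic.mul_spec_ne_one w 0).symm
      rw [div_mul_eq_mul_div, eq_div_iff h2]
      ring
    · rw [hP.van u w (by omega) h1, hP.van _ _ (by rw [wt_raise, wt_raise]; omega)
        fun h2 => h1 (raise_injective h2)]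
      ring

lemma eval_spec_hecke_eq_zero (hp : GoodParams q t) (i : Fin m) (d : ℕ)
    (f : MvPolynomial (Fin (m + 1)) ℂ) (hf : ∀ w, wt w ≤ d → eval (spec q t w) f = 0) (w)
    (hw : wt w ≤ d) : eval (spec q t w) (hecke t i f) = 0 := by
  by_cases h : w i.castSucc = w i.succ
  · rw [eval_spec_hecke_of_eq hp.hq hp.ht hp.generic i h, hf w hw, mul_zero]
  · rw [eval_spec_hecke_of_ne hp.hq hp.ht hp.generic i h, hf w hw,
      hf _ ((wt_comp_perm w (adj i)).le.trans hw)]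
    ring

lemma eval_spec_ascOp_eq_zero (hp : GoodParams q t) (j : Fin (m + 1)) (d : ℕ)
    (f : MvPolynomial (Fin (m + 1)) ℂ) (hf : ∀ w, wt w ≤ d → eval (spec q t w) f = 0) (w)
    (hw : wt w ≤ d) : eval (spec q t w) (ascOp t j f) = 0 := by
  induction j using Fin.induction generalizing f with
  | zero => exact hf w hw
  | succ i ih =>
    rw [ascOp_succ]
    exact ih _ (eval_spec_hecke_eq_zero hp i d f hf)

/-- The eigenvalue equation for the interpolation polynomials. -/
lemma NormInterp.knop (hP : NormInterp q t P) (hp : GoodParams q t) (u : Fin (m + 1) → ℕ) :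
    P u + C (t ^ m)⁻¹ * ascOp t (Fin.last m) ((X (Fin.last m) - 1) * unshift q (P u)) =
      C (spec q t u 0)⁻¹ * (X 0 * P u) := by
  set F := (X (Fin.last m) - 1) * unshift q (P u) with hF
  have htm : t ^ m ≠ 0 := pow_ne_zero _ hp.ht
  have hFdeg : F.totalDegree ≤ wt u + 1 := totalDegree_X_sub_one_mul_le _ _ _
      ((totalDegree_unshift_le _ _).trans (hP.deg u))
  obtain ⟨g, hg, hgd⟩ := exists_factor 0 0
    (P u + C (t ^ m)⁻¹ * ascOp t (Fin.last m) F) fun x hx => by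
      rw [map_add, map_mul, eval_ascOp_last _ _ _ hx, hF, map_mul, eval_unshift]
      have : (Fin.cons (α := fun _ => ℂ) (0 : ℂ) fun j : Fin m => x j.succ) = x := by
        funext i
        refine Fin.cases ?_ (fun j => ?_) i <;> simp [hx]
      simp only [map_sub, eval_X, map_one, Fin.snoc_last, Fin.snoc_castSucc, eval_C, mul_zero, this]
      field_simp
      ring
  rw [C_0, sub_zero] at hg
  have hLdeg : (P u + C (t ^ m)⁻¹ * ascOp t (Fin.last m) F).totalDegree ≤ wt u + 1 := by
    refine (totalDegree_add _ _).trans (max_le ((hP.deg u).trans (Nat.le_succ _)) ?_)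
    exact (totalDegree_C_mul_le _ _).trans ((totalDegree_ascOp_le _ _ _).trans hFdeg)
  have hFv : ∀ w, wt w ≤ wt u → eval (spec q t w) F = 0 := by
    intro w hw
    by_cases h : w (Fin.last m) = 0
    · exact eval_spec_unshift_of_eq_zero w h _
    · obtain ⟨w, rfl⟩ := exists_raise_eq w h
      rw [wt_raise] at hw
      rw [hF, eval_spec_raise_unshift hp, hP.van u w (by omega) (by rintro rfl; omega), mul_zero]
  have hgeq : g = C (spec q t u 0)⁻¹ * P u := by
    refine eq_of_eval_spec hp (wt u) ?_ ((totalDegree_C_mul_le _ _).trans (hP.deg u))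
      fun w hw => ?_
    · rcases hgd with h | h
      · simp [h]
      · omega
    · have h1 := congrArg (eval (spec q t w)) hg
      rw [map_add, map_mul, eval_spec_ascOp_eq_zero hp _ _ F hFv w hw, map_mul, eval_X] at h1
      have h2 := spec_ne_zero hp.hq hp.ht w 0
      apply mul_left_cancel₀ h2
      rw [← h1, map_mul, eval_C]
      by_cases h3 : w = u
      · subst h3
        rw [mul_zero, add_zero, eval_C, mul_inv_cancel_left₀ h2]
      · rw [hP.van u w hw h3]
        ring
  rw [hg, hgeq]
  ring

lemma topPart_hecke_of_eq (hP : NormInterp q t P) (hp : GoodParams q t) (i : Fin m)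
    (u : Fin (m + 1) → ℕ) (h : u i.castSucc = u i.succ) :
    hecke t i (topPart P u) = C t * topPart P u := by
  rw [topPart, ← homogeneousComponent_hecke, hP.hecke_of_eq hp i u h, homogeneousComponent_C_mul']

lemma topPart_hecke_of_ne (hP : NormInterp q t P) (hp : GoodParams q t) (i : Fin m)
    (u : Fin (m + 1) → ℕ) (h : u i.castSucc ≠ u i.succ) :
    hecke t i (topPart P u) = C (t - offCoeff q t i u) * topPart P u +
      C (offCoeff q t i (u ∘ adj i)) * topPart P (u ∘ adj i) := by
  rw [topPart, topPart, ← homogeneousComponent_hecke, hP.hecke_of_ne hp i u h, map_add,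
    homogeneousComponent_C_mul', homogeneousComponent_C_mul', wt_comp_perm]

lemma homogeneousComponent_succ_X_sub_one_mul {σ : Type*} (k : σ) (f : MvPolynomial σ ℂ) (d : ℕ)
    (hf : f.totalDegree ≤ d) :
    homogeneousComponent (d + 1) ((X k - 1) * f) = X k * homogeneousComponent d f := by
  rw [sub_mul, one_mul, map_sub, homogeneousComponent_X_mul,
    homogeneousComponent_eq_zero (d + 1) f (by omega), sub_zero]

lemma topPart_raise (hP : NormInterp q t P) (hp : GoodParams q t) (u : Fin (m + 1) → ℕ) :
    topPart P (raise u) = C (spec q t u 0 / (1 - q * spec q t u 0)) *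
      (X (Fin.last m) * unshift q (topPart P u)) := by
  rw [topPart, wt_raise, hP.raise_eq hp, homogeneousComponent_C_mul',
    homogeneousComponent_succ_X_sub_one_mul _ _ _ ((totalDegree_unshift_le _ _).trans (hP.deg u)),
    homogeneousComponent_unshift, topPart]

lemma descOp_topPart (hP : NormInterp q t P) (hp : GoodParams q t) (u : Fin (m + 1) → ℕ) :
    descOp t (Fin.last m) (topPart P u) = C (spec q t u 0) * unshift q (topPart P u) := by
  have htm : t ^ m ≠ 0 := pow_ne_zero _ hp.ht
  have hz := spec_ne_zero hp.hq hp.ht u 0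
  have h1 := congrArg (homogeneousComponent (wt u + 1)) (hP.knop hp u)
  rw [map_add, homogeneousComponent_eq_zero (wt u + 1) (P u) (Nat.lt_succ_of_le (hP.deg u)),
    zero_add, homogeneousComponent_C_mul', homogeneousComponent_C_mul', homogeneousComponent_ascOp,
    homogeneousComponent_succ_X_sub_one_mul _ _ _ ((totalDegree_unshift_le _ _).trans (hP.deg u)),
    homogeneousComponent_unshift, homogeneousComponent_X_mul] at h1
  change C (t ^ m)⁻¹ * ascOp t (Fin.last m) (X (Fin.last m) * unshift q (topPart P u)) =
    C (spec q t u 0)⁻¹ * (X 0 * topPart P u) at h1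
  have h2 := ascOp_X_descOp t (Fin.last m) (topPart P u)
  rw [Fin.val_last] at h2
  refine mul_left_cancel₀ (X_ne_zero (R := ℂ) (Fin.last m)) ?_
  apply ascOp_injective hp.ht (Fin.last m)
  rw [h2, mul_left_comm (X (Fin.last m)), map_C_mul]
  have h3 : C (t ^ m) * C (t ^ m)⁻¹ = (1 : MvPolynomial (Fin (m + 1)) ℂ) := by
    rw [← C_mul, mul_inv_cancel₀ htm, C_1]
  have h4 : C (spec q t u 0) * C (spec q t u 0)⁻¹ = (1 : MvPolynomial (Fin (m + 1)) ℂ) := by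
    rw [← C_mul, mul_inv_cancel₀ hz, C_1]
  linear_combination (-C (t ^ m) * C (spec q t u 0)) * h1 +
    C (spec q t u 0) * ascOp t (Fin.last m) (X (Fin.last m) * unshift q (topPart P u)) * h3 -
    C (t ^ m) * (X 0 * topPart P u) * h4

lemma shift_descOp_topPart (hP : NormInterp q t P) (hp : GoodParams q t) (u : Fin (m + 1) → ℕ) :
    shift q (descOp t (Fin.last m) (topPart P u)) = C (spec q t u 0) * topPart P u := by
  rw [descOp_topPart hP hp, map_mul, algHom_C, shift_unshift hp.hq]

lemma GoodParams.one_sub_ne_zero (hp : GoodParams q t) (u : Fin n → ℕ) (i : Fin n) :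
    1 - q * spec q t u i ≠ 0 :=
  sub_ne_zero.mpr (hp.generic.mul_spec_ne_one u i).symm

lemma X_last_mul_descOp_topPart (hP : NormInterp q t P) (hp : GoodParams q t)
    (u : Fin (m + 1) → ℕ) :
    X (Fin.last m) * descOp t (Fin.last m) (topPart P u) =
      C (1 - q * spec q t u 0) * topPart P (raise u) := by
  rw [descOp_topPart hP hp, topPart_raise hP hp, ← mul_assoc (C (1 - q * spec q t u 0)), ← C_mul,
    mul_div_cancel₀ _ (hp.one_sub_ne_zero u 0)]
  ring

lemma X_zero_mul_topPart (hP : NormInterp q t P) (hp : GoodParams q t)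
    (u : Fin (m + 1) → ℕ) :
    C (t ^ m) * (X 0 * topPart P u) =
      C (1 - q * spec q t u 0) * ascOp t (Fin.last m) (topPart P (raise u)) := by
  rw [← map_C_mul, ← X_last_mul_descOp_topPart hP hp, ascOp_X_descOp, Fin.val_last]

/-- `E_u(⟨0⟩)`. -/
def topVal (q t : ℂ) (P : (Fin n → ℕ) → MvPolynomial (Fin n) ℂ) (u : Fin n → ℕ) : ℂ :=
  eval (spec q t fun _ => 0) (topPart P u)

lemma eval_spec_zero_hecke (hp : GoodParams q t) (i : Fin m) (f : MvPolynomial (Fin (m + 1)) ℂ) :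
    eval (spec q t fun _ => 0) (hecke t i f) = t * eval (spec q t fun _ => 0) f :=
  eval_spec_hecke_of_eq hp.hq hp.ht hp.generic i rfl f

lemma eval_spec_zero_descOp (hp : GoodParams q t) (j : Fin (m + 1))
    (f : MvPolynomial (Fin (m + 1)) ℂ) :
    eval (spec q t fun _ => 0) (descOp t j f) = t ^ (j : ℕ) * eval (spec q t fun _ => 0) f := by
  induction j using Fin.induction with
  | zero => simp
  | succ i ih =>
    rw [descOp_succ, eval_spec_zero_hecke hp, ih]
    simp [pow_succ]
    ring

lemma topVal_comp_adj (hP : NormInterp q t P) (hp : GoodParams q t) (i : Fin m)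
    (u : Fin (m + 1) → ℕ) (h : u i.castSucc ≠ u i.succ) :
    offCoeff q t i (u ∘ adj i) * topVal q t P (u ∘ adj i) = offCoeff q t i u * topVal q t P u := by
  have h1 := eval_spec_zero_hecke hp i (topPart P u)
  rw [topPart_hecke_of_ne hP hp i u h, map_add, map_mul, map_mul, eval_C, eval_C] at h1
  simp only [topVal]
  linear_combination h1

lemma topVal_raise (hP : NormInterp q t P) (hp : GoodParams q t) (u : Fin (m + 1) → ℕ) :
    (1 - q * spec q t u 0) * topVal q t P (raise u) = t ^ m * topVal q t P u := by
  have h1 := congrArg (eval (spec q t fun _ => 0)) (X_last_mul_descOp_topPart hP hp u)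
  rw [map_mul, map_mul, eval_X, eval_C, spec_last_of_eq_zero _ rfl, eval_spec_zero_descOp hp,
    Fin.val_last, one_mul] at h1
  exact h1.symm

lemma topPart_zero (hP : NormInterp q t P) : topPart P (fun _ => 0) = 1 := by
  have h0 : wt (fun _ : Fin (m + 1) => 0) = 0 := by simp [wt]
  have h1 := hP.deg (fun _ => 0)
  rw [h0, Nat.le_zero, totalDegree_eq_zero_iff_eq_C] at h1
  have h2 := hP.diag (fun _ => 0)
  rw [h1, eval_C] at h2
  rw [topPart, h0, homogeneousComponent_zero, h2]
  simp [diagVal, wt, nstat', nmax]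

lemma topVal_ne_zero (hP : NormInterp q t P) (hp : GoodParams q t) (u : Fin (m + 1) → ℕ) :
    topVal q t P u ≠ 0 := by
  induction u using composition_induction with
  | h0 => simp [topVal, topPart_zero hP]
  | hr u hu =>
    intro h
    have := topVal_raise hP hp u
    rw [h, mul_zero] at this
    exact mul_ne_zero (pow_ne_zero _ hp.ht) hu this.symm
  | ha i u hne hu =>
    intro h
    have := topVal_comp_adj hP hp i u hne
    rw [h, mul_zero] at this
    exact mul_ne_zero (offCoeff_ne_zero hp.hq hp.ht hp.generic i hne) hu this.symm

end Relations

/-- The finset of compositions of weight `d`. -/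
def comps (n d : ℕ) : Finset (Fin n → ℕ) := Finset.piAntidiag Finset.univ d

@[simp] lemma mem_comps {d : ℕ} {u : Fin n → ℕ} : u ∈ comps n d ↔ wt u = d := by
  simp [comps, wt]

lemma eq_zero_of_homogeneousComponent {q t : ℂ} (hp : GoodParams q t) (d : ℕ)
    (f : MvPolynomial (Fin n) ℂ) (hd : f.totalDegree ≤ d) (hc : homogeneousComponent d f = 0)
    (hv : ∀ w, wt w < d → eval (spec q t w) f = 0) : f = 0 := by
  cases d with
  | zero =>
    rw [Nat.le_zero, totalDegree_eq_zero_iff_eq_C] at hd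
    rwa [homogeneousComponent_zero, ← hd] at hc
  | succ d =>
    refine eq_zero_of_vanish hp.hq hp.ht hp.generic n d f ?_ fun w hw => hv w (by omega)
    refine Finset.sup_le fun s hs => ?_
    have h1 : s.degree ≤ d + 1 := (le_totalDegree hs).trans hd
    have h2 : s.degree ≠ d + 1 := by
      intro h
      have h3 := congrArg (coeff s) hc
      rw [coeff_homogeneousComponent, if_pos h, coeff_zero] at h3
      exact mem_support_iff.mp hs h3
    change s.degree ≤ d
    omega

/-- The linear combination `Σ_{|u| = d} κ_u E_u`. -/
def topComb (P : (Fin n → ℕ) → MvPolynomial (Fin n) ℂ) (d : ℕ) (κ : (Fin n → ℕ) → ℂ) :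
    MvPolynomial (Fin n) ℂ := ∑ u ∈ comps n d, C (κ u) * topPart P u

lemma topComb_add (P : (Fin n → ℕ) → MvPolynomial (Fin n) ℂ) (d : ℕ)
    (κ μ : (Fin n → ℕ) → ℂ) :
    topComb P d (fun u => κ u + μ u) = topComb P d κ + topComb P d μ := by
  simp only [topComb, C_add, add_mul, Finset.sum_add_distrib]

lemma C_mul_topComb (P : (Fin n → ℕ) → MvPolynomial (Fin n) ℂ) (d : ℕ) (c : ℂ)
    (κ : (Fin n → ℕ) → ℂ) :
    C c * topComb P d κ = topComb P d (fun u => c * κ u) := by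
  simp only [topComb, C_mul, Finset.mul_sum, mul_assoc]

lemma topComb_congr {P : (Fin n → ℕ) → MvPolynomial (Fin n) ℂ} {d : ℕ}
    {κ μ : (Fin n → ℕ) → ℂ} (h : ∀ u, wt u = d → κ u = μ u) : topComb P d κ = topComb P d μ :=
  Finset.sum_congr rfl fun u hu => by rw [h u (mem_comps.mp hu)]

lemma sum_comps_comp_adj {α : Type*} [AddCommMonoid α] (i : Fin m) (d : ℕ)
    (f : (Fin (m + 1) → ℕ) → α) :
    ∑ u ∈ comps (m + 1) d, f (u ∘ adj i) = ∑ u ∈ comps (m + 1) d, f u :=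
  Finset.sum_nbij' (fun u => u ∘ adj i) (fun u => u ∘ adj i)
    (fun u hu => by rw [mem_comps] at *; rw [wt_comp_perm, hu])
    (fun u hu => by rw [mem_comps] at *; rw [wt_comp_perm, hu])
    (fun u _ => comp_adj_comp_adj u i) (fun u _ => comp_adj_comp_adj u i) (fun _ _ => rfl)

lemma sum_comps_raise {α : Type*} [AddCommMonoid α] (d : ℕ)
    (f : (Fin (m + 1) → ℕ) → α) (hf : ∀ u, u (Fin.last m) = 0 → f u = 0) :
    ∑ u ∈ comps (m + 1) (d + 1), f u = ∑ u ∈ comps (m + 1) d, f (raise u) := by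
  symm
  refine Finset.sum_of_injOn raise raise_injective.injOn ?_ ?_ fun _ _ => rfl
  · intro u hu
    rw [Finset.mem_coe, mem_comps] at *
    rw [wt_raise, hu]
  · intro u hu h
    by_contra hne
    obtain ⟨w, rfl⟩ := exists_raise_eq u fun h0 => hne (hf u h0)
    rw [mem_comps, wt_raise] at hu
    exact h ⟨w, by rw [Finset.mem_coe, mem_comps]; omega, rfl⟩

section Hecke
variable {q t : ℂ} {P : (Fin (m + 1) → ℕ) → MvPolynomial (Fin (m + 1)) ℂ}

lemma topComb_eq_zero_iff (hP : NormInterp q t P) (hp : GoodParams q t) (d : ℕ)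
    (κ : (Fin (m + 1) → ℕ) → ℂ) :
    topComb P d κ = 0 ↔ ∀ u, wt u = d → κ u = 0 := by
  constructor
  · intro h
    have h1 : ∑ u ∈ comps (m + 1) d, C (κ u) * P u = 0 := by
      refine eq_zero_of_homogeneousComponent hp d _ ?_ ?_ ?_
      · refine totalDegree_finsetSum_le fun u hu => (totalDegree_C_mul_le _ _).trans ?_
        exact (hP.deg u).trans (mem_comps.mp hu).le
      · rw [map_sum, ← h]
        refine Finset.sum_congr rfl fun u hu => ?_
        rw [homogeneousComponent_C_mul', topPart, mem_comps.mp hu]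
      · intro w hw
        rw [map_sum]
        refine Finset.sum_eq_zero fun u hu => ?_
        rw [mem_comps] at hu
        rw [map_mul, hP.van u w (by omega) (by rintro rfl; omega), mul_zero]
    intro w hw
    have h2 := congrArg (eval (spec q t w)) h1
    rw [map_sum, map_zero, Finset.sum_eq_single w] at h2
    · rw [map_mul, hP.diag, eval_C] at h2
      exact (mul_eq_zero.mp h2).resolve_right (diagVal_ne_zero hp.hq hp.ht w)
    · intro u hu hne
      rw [map_mul, hP.van u w (by rw [mem_comps.mp hu, hw]) hne.symm, mul_zero]
    · intro h; exact absurd (mem_comps.mpr hw) h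
  · intro h
    exact Finset.sum_eq_zero fun u hu => by rw [h u (mem_comps.mp hu), C_0, zero_mul]

/-- The action of `T_i` on coefficients. -/
def heckeCoeff (q t : ℂ) (i : Fin m) (κ : (Fin (m + 1) → ℕ) → ℂ) (u : Fin (m + 1) → ℕ) : ℂ :=
  if u i.castSucc = u i.succ then t * κ u
  else (t - offCoeff q t i u) * κ u + offCoeff q t i u * κ (u ∘ adj i)

lemma hecke_topComb (hP : NormInterp q t P) (hp : GoodParams q t) (i : Fin m) (d : ℕ)
    (κ : (Fin (m + 1) → ℕ) → ℂ) :
    hecke t i (topComb P d κ) = topComb P d (heckeCoeff q t i κ) := by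
  have h1 : ∀ u, hecke t i (C (κ u) * topPart P u) =
      (C (if u i.castSucc = u i.succ then t * κ u else (t - offCoeff q t i u) * κ u) * topPart P u)
      + (C (if u i.castSucc = u i.succ then 0 else offCoeff q t i (u ∘ adj i) * κ u) *
        topPart P (u ∘ adj i)) := by
    intro u
    rw [map_C_mul]
    split_ifs with h
    · rw [topPart_hecke_of_eq hP hp i u h]; simp only [C_mul, C_0]; ring
    · rw [topPart_hecke_of_ne hP hp i u h]; simp only [C_mul]; ring
  rw [topComb, map_sum, Finset.sum_congr rfl fun u _ => h1 u, Finset.sum_add_distrib,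
    ← sum_comps_comp_adj i d (fun u =>
      C (if u i.castSucc = u i.succ then 0 else offCoeff q t i (u ∘ adj i) * κ u) *
        topPart P (u ∘ adj i)), ← Finset.sum_add_distrib, topComb]
  refine Finset.sum_congr rfl fun u _ => ?_
  simp only [comp_adj_comp_adj]
  rw [heckeCoeff]
  simp only [Function.comp, adj, Equiv.swap_apply_left, Equiv.swap_apply_right,
    eq_comm (a := u i.succ)]
  split_ifs with h
  · simp
  · rw [C_add, add_mul]

/-- The kernel `Σ_{|u| = d} L(E_u) E_u / ε_u` attached to a linear form `L`. -/
def kern (q t : ℂ) (P : (Fin n → ℕ) → MvPolynomial (Fin n) ℂ)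
    (d : ℕ) (L : MvPolynomial (Fin n) ℂ →ₗ[ℂ] ℂ) : MvPolynomial (Fin n) ℂ :=
  topComb P d fun u => L (topPart P u) / topVal q t P u

lemma apply_C_mul {σ : Type*} (L : MvPolynomial σ ℂ →ₗ[ℂ] ℂ) (c : ℂ) (f : MvPolynomial σ ℂ) :
    L (C c * f) = c * L f := by
  rw [C_mul_eq_smul, map_smul, smul_eq_mul]

lemma hecke_kern (hP : NormInterp q t P) (hp : GoodParams q t) (i : Fin m) (d : ℕ)
    (L : MvPolynomial (Fin (m + 1)) ℂ →ₗ[ℂ] ℂ) :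
    hecke t i (kern q t P d L) = kern q t P d (L ∘ₗ hecke t i) := by
  rw [kern, hecke_topComb hP hp, kern]
  refine topComb_congr fun u _ => ?_
  rw [heckeCoeff, LinearMap.comp_apply]
  have h0 := topVal_ne_zero hP hp u
  have h1 := topVal_ne_zero hP hp (u ∘ adj i)
  split_ifs with h
  · rw [topPart_hecke_of_eq hP hp i u h, apply_C_mul]; ring
  · rw [topPart_hecke_of_ne hP hp i u h, map_add, apply_C_mul, apply_C_mul]
    have h2 := topVal_comp_adj hP hp i u h
    field_simp
    linear_combination -L (topPart P (u ∘ adj i)) * h2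

lemma ascOp_kern (hP : NormInterp q t P) (hp : GoodParams q t) (j : Fin (m + 1)) (d : ℕ)
    (L : MvPolynomial (Fin (m + 1)) ℂ →ₗ[ℂ] ℂ) :
    ascOp t j (kern q t P d L) = kern q t P d (L ∘ₗ descOp t j) := by
  induction j using Fin.induction generalizing L with
  | zero => rfl
  | succ i ih =>
    rw [ascOp_succ, hecke_kern hP hp, ih]
    congr 1

/-- The linear form `f ↦ f(x)`. -/
def evalForm (x : Fin n → ℂ) : MvPolynomial (Fin n) ℂ →ₗ[ℂ] ℂ := (aeval x).toLinearMap

@[simp] lemma evalForm_apply (x : Fin n → ℂ) (f : MvPolynomial (Fin n) ℂ) :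
    evalForm x f = eval x f := by simp [evalForm, aeval_eq_eval]

lemma ascOp_kern_spec_raise (hP : NormInterp q t P) (hp : GoodParams q t) (d : ℕ)
    (w : Fin (m + 1) → ℕ) :
    ascOp t (Fin.last m) (kern q t P d (evalForm (spec q t (raise w)))) =
      shift q (descOp t (Fin.last m) (kern q t P d (evalForm (spec q t w)))) := by
  rw [ascOp_kern hP hp, kern, kern, topComb, topComb, map_sum, map_sum]
  refine Finset.sum_congr rfl fun u _ => ?_
  rw [map_C_mul, map_mul, algHom_C, shift_descOp_topPart hP hp, ← mul_assoc, ← C_mul]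
  congr 2
  rw [LinearMap.comp_apply, evalForm_apply, evalForm_apply, ← eval_spec_shift,
    shift_descOp_topPart hP hp, map_mul, eval_C]
  ring

lemma kern_spec_comp_adj (hP : NormInterp q t P) (hp : GoodParams q t) (d : ℕ)
    (i : Fin m) (w : Fin (m + 1) → ℕ) (h : w i.castSucc ≠ w i.succ) :
    C (offCoeff q t i w) * kern q t P d (evalForm (spec q t (w ∘ adj i))) =
      hecke t i (kern q t P d (evalForm (spec q t w))) -
        C (t - offCoeff q t i w) * kern q t P d (evalForm (spec q t w)) := by
  rw [hecke_kern hP hp, eq_sub_iff_add_eq, kern, kern, kern, C_mul_topComb, C_mul_topComb,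
    ← topComb_add]
  refine topComb_congr fun u _ => ?_
  rw [LinearMap.comp_apply, evalForm_apply, evalForm_apply, evalForm_apply,
    eval_spec_hecke_of_ne hp.hq hp.ht hp.generic i h]
  ring

/-- The sum of all `E_u` with `|u| = d`. -/
def topSum (P : (Fin n → ℕ) → MvPolynomial (Fin n) ℂ) (d : ℕ) : MvPolynomial (Fin n) ℂ :=
  topComb P d fun _ => 1

lemma kern_spec_zero (hP : NormInterp q t P) (hp : GoodParams q t) (d : ℕ) :
    kern q t P d (evalForm (spec q t fun _ => 0)) = topSum P d :=
  topComb_congr fun u _ => by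
    rw [evalForm_apply]; exact div_self (topVal_ne_zero hP hp u)

lemma hecke_topSum (hP : NormInterp q t P) (hp : GoodParams q t) (i : Fin m) (d : ℕ) :
    hecke t i (topSum P d) = C t * topSum P d := by
  rw [topSum, hecke_topComb hP hp, C_mul_topComb]
  refine topComb_congr fun u _ => ?_
  rw [heckeCoeff]
  split_ifs <;> ring

lemma ascOp_topSum (hP : NormInterp q t P) (hp : GoodParams q t) (j : Fin (m + 1)) (d : ℕ) :
    ascOp t j (topSum P d) = C (t ^ (j : ℕ)) * topSum P d := by
  induction j using Fin.induction with
  | zero => simp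
  | succ i ih =>
    rw [ascOp_succ, hecke_topSum hP hp, map_C_mul, ih, ← mul_assoc, ← C_mul, Fin.val_succ,
      Fin.val_castSucc, pow_succ']

lemma descOp_topSum (hP : NormInterp q t P) (hp : GoodParams q t) (j : Fin (m + 1)) (d : ℕ) :
    descOp t j (topSum P d) = C (t ^ (j : ℕ)) * topSum P d := by
  induction j using Fin.induction with
  | zero => simp [descOp]
  | succ i ih =>
    rw [descOp_succ, ih, map_C_mul, hecke_topSum hP hp, ← mul_assoc, ← C_mul, Fin.val_succ,
      Fin.val_castSucc, pow_succ]

lemma ascOp_topComb_spec (hP : NormInterp q t P) (hp : GoodParams q t) (j : Fin (m + 1)) (d : ℕ) :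
    ascOp t j (topComb P d fun u => spec q t u j) = topComb P d fun u => spec q t u 0 := by
  induction j using Fin.induction with
  | zero => simp
  | succ i ih =>
    rw [ascOp_succ, hecke_topComb hP hp, ← ih]
    congr 1
    refine topComb_congr fun u _ => ?_
    rw [heckeCoeff]
    split_ifs with h
    · rw [spec_castSucc_of_eq q t u i h]
    · rw [spec_comp_adj q t u i h, Function.comp, adj, Equiv.swap_apply_right, offCoeff]
      have := sub_ne_zero.mpr (spec_ne_spec hp.hq hp.ht hp.generic (Ne.symm h))
      field_simp
      ring

lemma shift_topSum_succ (hP : NormInterp q t P) (hp : GoodParams q t) (d : ℕ) :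
    shift q (topSum P (d + 1)) = topSum P (d + 1) - X 0 * topSum P d := by
  have htm : (C (t ^ m) : MvPolynomial (Fin (m + 1)) ℂ) ≠ 0 :=
    C_ne_zero.mpr (pow_ne_zero _ hp.ht)
  apply mul_left_cancel₀ htm
  have h1 : C (t ^ m) * shift q (topSum P (d + 1)) =
      topComb P (d + 1) fun u => spec q t u 0 := by
    have := congrArg (shift q) (descOp_topSum hP hp (Fin.last m) (d + 1))
    rw [map_mul, algHom_C, Fin.val_last] at this
    rw [← this, topSum, topComb, topComb, map_sum, map_sum]
    refine Finset.sum_congr rfl fun u _ => ?_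
    rw [C_1, one_mul, shift_descOp_topPart hP hp]
  have h2 := ascOp_topSum hP hp (Fin.last m) (d + 1)
  rw [Fin.val_last] at h2
  rw [mul_sub, h1, ← ascOp_topComb_spec hP hp (Fin.last m), ← h2, eq_sub_iff_add_eq,
    ← eq_sub_iff_add_eq', ← map_sub]
  have h3 : topSum P (d + 1) - topComb P (d + 1) (fun u => spec q t u (Fin.last m)) =
      ∑ u ∈ comps (m + 1) d, C (1 - q * spec q t u 0) * topPart P (raise u) := by
    rw [topSum, topComb, topComb, ← Finset.sum_sub_distrib, sum_comps_raise]
    · refine Finset.sum_congr rfl fun u _ => ?_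
      rw [spec_raise, Fin.snoc_last, C_sub, sub_mul]
    · intro u hu
      rw [spec_last_of_eq_zero u hu, sub_self]
  rw [h3, map_sum, topSum, topComb, Finset.mul_sum, Finset.mul_sum]
  refine Finset.sum_congr rfl fun u _ => ?_
  rw [map_C_mul, ← X_zero_mul_topPart hP hp, C_1, one_mul]

end Hecke

/-- The coefficients of `(bz; q)_∞ / (az; q)_∞`. -/
def binCoeff (q a b : ℂ) : ℕ → ℂ
  | 0 => 1
  | k + 1 => binCoeff q a b k * (a - b * q ^ k) / (1 - q ^ (k + 1))

/-- The power series `(bz; q)_∞ / (az; q)_∞`. -/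
def binSeries (q a b : ℂ) : PowerSeries ℂ := PowerSeries.mk (binCoeff q a b)

lemma coeff_succ_one_sub_mul {R : Type*} [CommRing R] (c : R) (F : PowerSeries R) (k : ℕ) :
    PowerSeries.coeff (k + 1) ((1 - PowerSeries.C c * PowerSeries.X) * F) =
      PowerSeries.coeff (k + 1) F - c * PowerSeries.coeff k F := by
  rw [sub_mul, one_mul, map_sub, mul_assoc, PowerSeries.coeff_C_mul, PowerSeries.coeff_succ_X_mul]

lemma coeff_zero_one_sub_mul {R : Type*} [CommRing R] (c : R) (F : PowerSeries R) :
    PowerSeries.coeff 0 ((1 - PowerSeries.C c * PowerSeries.X) * F) = PowerSeries.coeff 0 F := by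
  rw [sub_mul, one_mul, map_sub, mul_assoc, PowerSeries.coeff_C_mul]
  simp

lemma Generic.one_sub_pow_ne {q t : ℂ} (h : Generic q t) (k : ℕ) : 1 - q ^ (k + 1) ≠ 0 := by
  have := h.pow_mul_pow_ne (k + 1) 0 (by omega)
  rw [pow_zero, mul_one] at this
  exact sub_ne_zero.mpr this.symm

lemma binSeries_functional {q : ℂ} (hq : ∀ k : ℕ, 1 - q ^ (k + 1) ≠ 0) (a b : ℂ) :
    (1 - PowerSeries.C a * PowerSeries.X) * binSeries q a b =
      (1 - PowerSeries.C b * PowerSeries.X) * PowerSeries.rescale q (binSeries q a b) := by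
  ext k
  cases k with
  | zero => rw [coeff_zero_one_sub_mul, coeff_zero_one_sub_mul, PowerSeries.coeff_rescale]; simp
  | succ k =>
    rw [coeff_succ_one_sub_mul, coeff_succ_one_sub_mul, PowerSeries.coeff_rescale,
      PowerSeries.coeff_rescale, binSeries, PowerSeries.coeff_mk, PowerSeries.coeff_mk, binCoeff]
    have := hq k
    field_simp
    ring

lemma series_unique {q : ℂ} (hq : ∀ k : ℕ, 1 - q ^ (k + 1) ≠ 0) (c : ℂ) {F G : PowerSeries ℂ}
    (hF : F = (1 - PowerSeries.C c * PowerSeries.X) * PowerSeries.rescale q F)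
    (hG : G = (1 - PowerSeries.C c * PowerSeries.X) * PowerSeries.rescale q G)
    (h0 : PowerSeries.coeff 0 F = PowerSeries.coeff 0 G) : F = G := by
  ext k
  induction k with
  | zero => exact h0
  | succ k ih =>
    have h1 := congrArg (PowerSeries.coeff (k + 1)) hF
    have h2 := congrArg (PowerSeries.coeff (k + 1)) hG
    rw [coeff_succ_one_sub_mul, PowerSeries.coeff_rescale, PowerSeries.coeff_rescale] at h1 h2
    rw [← ih] at h2
    apply mul_left_cancel₀ (hq k)
    linear_combination h1 - h2

@[simp] lemma coeff_zero_binSeries (q a b : ℂ) : PowerSeries.coeff 0 (binSeries q a b) = 1 := by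
  rw [binSeries, PowerSeries.coeff_mk, binCoeff]

lemma rescale_one_sub {R : Type*} [CommRing R] (a c : R) :
    PowerSeries.rescale a (1 - PowerSeries.C c * PowerSeries.X) =
      1 - PowerSeries.C (a * c) * PowerSeries.X := by
  ext k
  rw [PowerSeries.coeff_rescale, map_sub, map_sub, PowerSeries.coeff_C_mul,
    PowerSeries.coeff_C_mul, PowerSeries.coeff_one, PowerSeries.coeff_X]
  rcases k with _ | _ | k <;> simp

lemma rescale_comm {R : Type*} [CommRing R] (a c : R) (F : PowerSeries R) :
    PowerSeries.rescale a (PowerSeries.rescale c F) =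
      PowerSeries.rescale c (PowerSeries.rescale a F) := by
  rw [PowerSeries.rescale_rescale, PowerSeries.rescale_rescale, mul_comm]

lemma binSeries_zero_one_eq {q : ℂ} (hq : ∀ k : ℕ, 1 - q ^ (k + 1) ≠ 0) :
    binSeries q 0 1 =
      (1 - PowerSeries.C 1 * PowerSeries.X) * PowerSeries.rescale q (binSeries q 0 1) := by
  have h := binSeries_functional hq 0 1
  rwa [map_zero, zero_mul, sub_zero, one_mul] at h

lemma rescale_binSeries_zero_one_eq {q : ℂ} (hq : ∀ k : ℕ, 1 - q ^ (k + 1) ≠ 0) (c : ℂ) :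
    PowerSeries.rescale c (binSeries q 0 1) =
      (1 - PowerSeries.C c * PowerSeries.X) *
        PowerSeries.rescale q (PowerSeries.rescale c (binSeries q 0 1)) := by
  have h := congrArg (PowerSeries.rescale c) (binSeries_zero_one_eq hq)
  rwa [map_mul, rescale_one_sub, mul_one, rescale_comm] at h

lemma binSeries_mul {q : ℂ} (hq : ∀ k : ℕ, 1 - q ^ (k + 1) ≠ 0) (a b : ℂ) :
    binSeries q a b * PowerSeries.rescale a (binSeries q 0 1) =
      PowerSeries.rescale b (binSeries q 0 1) := by
  refine series_unique hq b ?_ (rescale_binSeries_zero_one_eq hq b) ?_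
  · rw [map_mul, ← mul_assoc, ← binSeries_functional hq a b]
    conv_lhs => rw [rescale_binSeries_zero_one_eq hq a]
    ring
  · rw [PowerSeries.coeff_mul, PowerSeries.coeff_rescale]
    simp [-PowerSeries.coeff_zero_eq_constantCoeff]

/-- The product `∏_i (b x_i z; q)_∞ / (a x_i z; q)_∞` as a power series in `z`. -/
def prodSeries (n : ℕ) (q a b : ℂ) : PowerSeries (MvPolynomial (Fin n) ℂ) :=
  ∏ i, PowerSeries.rescale (X i) (PowerSeries.map C (binSeries q a b))

lemma map_rescale_map_C {σ : Type*} {R : Type*} [CommRing R] (φ : MvPolynomial σ ℂ →+* R)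
    (r : MvPolynomial σ ℂ) (f : PowerSeries ℂ) :
    PowerSeries.map φ (PowerSeries.rescale r (PowerSeries.map C f)) =
      PowerSeries.rescale (φ r) (PowerSeries.map (φ.comp C) f) := by
  ext k
  simp [PowerSeries.coeff_rescale]

lemma map_rename_prodSeries (s : Equiv.Perm (Fin n)) (q a b : ℂ) :
    PowerSeries.map (rename s : MvPolynomial (Fin n) ℂ →ₐ[ℂ] MvPolynomial (Fin n) ℂ).toRingHom
      (prodSeries n q a b) = prodSeries n q a b := by
  rw [prodSeries, map_prod, ← Equiv.prod_comp s fun i =>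
    PowerSeries.rescale (X i) (PowerSeries.map C (binSeries q a b))]
  refine Finset.prod_congr rfl fun i _ => ?_
  rw [map_rescale_map_C]
  congr 1
  · simp
  · congr 1
    ext
    simp

lemma rename_coeff_prodSeries (s : Equiv.Perm (Fin n)) (q a b : ℂ) (k : ℕ) :
    rename s (PowerSeries.coeff k (prodSeries n q a b)) =
      PowerSeries.coeff k (prodSeries n q a b) := by
  conv_rhs => rw [← map_rename_prodSeries s]
  rw [PowerSeries.coeff_map]
  rfl

lemma prodSeries_eq_mul_map_shift {q : ℂ} (hq : ∀ k : ℕ, 1 - q ^ (k + 1) ≠ 0) :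
    prodSeries (m + 1) q 0 1 = (1 - PowerSeries.C (X 0) * PowerSeries.X) *
      PowerSeries.map (shift q).toRingHom (prodSeries (m + 1) q 0 1) := by
  have hC : (shift (m := m) q).toRingHom.comp C = C := by
    ext1 c
    exact (shift q).commutes c
  have h1 : PowerSeries.rescale (X 0 : MvPolynomial (Fin (m + 1)) ℂ)
      (PowerSeries.map C (binSeries q 0 1)) = (1 - PowerSeries.C (X 0) * PowerSeries.X) *
      PowerSeries.rescale (C q * X 0) (PowerSeries.map C (binSeries q 0 1)) := by
    conv_lhs => rw [binSeries_zero_one_eq hq]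
    rw [map_mul, map_mul]
    congr 1
    · have : PowerSeries.map (C : ℂ →+* MvPolynomial (Fin (m + 1)) ℂ)
          (1 - PowerSeries.C 1 * PowerSeries.X) = 1 - PowerSeries.C 1 * PowerSeries.X := by
        simp
      rw [this, rescale_one_sub, mul_one]
    · ext1 k
      simp [PowerSeries.coeff_rescale, mul_pow]
      ring
  rw [prodSeries, map_prod]
  conv_rhs => rw [Fin.prod_univ_castSucc]
  rw [Fin.prod_univ_succ]
  simp only [map_rescale_map_C, hC]
  have h2 : (shift q).toRingHom (X (Fin.last m)) = C q * X 0 := shift_X_last q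
  have h3 : ∀ j : Fin m, (shift q).toRingHom (X j.castSucc) = X j.succ := shift_X_castSucc q
  rw [h1, h2]
  simp only [h3]
  ring

lemma coeff_prodSeries_isHomogeneous (q a b : ℂ) (k : ℕ) :
    (PowerSeries.coeff k (prodSeries n q a b)).IsHomogeneous k := by
  have : ∀ (s : Finset (Fin n)) (k : ℕ), (PowerSeries.coeff k
      (∏ i ∈ s, PowerSeries.rescale (X i : MvPolynomial (Fin n) ℂ)
        (PowerSeries.map C (binSeries q a b)))).IsHomogeneous k := by
    classical
    intro s
    induction s using Finset.induction with
    | empty =>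
      intro k
      rw [Finset.prod_empty, PowerSeries.coeff_one]
      split_ifs with h
      · rw [h]; exact isHomogeneous_one _ _
      · exact isHomogeneous_zero _ _ _
    | insert i s hi ih =>
      intro k
      rw [Finset.prod_insert hi, PowerSeries.coeff_mul]
      refine IsHomogeneous.sum _ _ _ fun p hp => ?_
      rw [← Finset.HasAntidiagonal.mem_antidiagonal.mp hp]
      refine IsHomogeneous.mul ?_ (ih _)
      rw [PowerSeries.coeff_rescale, PowerSeries.coeff_map]
      have := (isHomogeneous_X_pow (R := ℂ) i p.1).mul (isHomogeneous_C (Fin n)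
        (PowerSeries.coeff p.1 (binSeries q a b)))
      rwa [add_zero] at this
  exact this _ k

lemma coeff_zero_prodSeries (q a b : ℂ) : PowerSeries.coeff 0 (prodSeries n q a b) = 1 := by
  rw [PowerSeries.coeff_zero_eq_constantCoeff, prodSeries, map_prod]
  refine Finset.prod_eq_one fun i _ => ?_
  rw [← PowerSeries.coeff_zero_eq_constantCoeff_apply, PowerSeries.coeff_rescale,
    PowerSeries.coeff_map]
  simp

lemma IsHomogeneous.aeval_scale {σ : Type*} {d : ℕ} {f : MvPolynomial σ ℂ}
    (hf : f.IsHomogeneous d) (c : ℂ) :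
    aeval (fun i => C c * X i : σ → MvPolynomial σ ℂ) f = C (c ^ d) * f := by
  conv_lhs => rw [f.as_sum, map_sum]
  conv_rhs => rw [f.as_sum, Finset.mul_sum]
  refine Finset.sum_congr rfl fun s hs => ?_
  have hd : s.degree = d := by
    by_contra h
    exact mem_support_iff.mp hs (hf.coeff_eq_zero h)
  rw [aeval_monomial, monomial_eq, Finsupp.prod, Finsupp.prod, ← hd, Finsupp.degree_apply]
  simp only [mul_pow, Finset.prod_mul_distrib, Finset.prod_pow_eq_pow_sum, C_pow]
  rw [← C_eq_algebraMap']
  ring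

lemma eval_scale_of_isHomogeneous {σ : Type*} {d : ℕ} {f : MvPolynomial σ ℂ}
    (hf : f.IsHomogeneous d) (c : ℂ) (x : σ → ℂ) :
    eval (fun i => c * x i) f = c ^ d * eval x f := by
  have := congrArg (eval x) (IsHomogeneous.aeval_scale hf c)
  rw [eval_aeval] at this
  simpa using this

section Vanishing
variable {q t : ℂ} {P : (Fin (m + 1) → ℕ) → MvPolynomial (Fin (m + 1)) ℂ}

/-- The coefficient of `z^d` in `∏_i (x_i z; q)_∞ · Σ_k e_k z^k`. -/
def mulCoeff (q : ℂ) (e : ℕ → MvPolynomial (Fin n) ℂ) (d : ℕ) : MvPolynomial (Fin n) ℂ :=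
  PowerSeries.coeff d (prodSeries n q 0 1 * PowerSeries.mk e)

lemma mulCoeff_eq_sum (q : ℂ) (e : ℕ → MvPolynomial (Fin n) ℂ) (d : ℕ) :
    mulCoeff q e d = ∑ p ∈ Finset.HasAntidiagonal.antidiagonal d,
      PowerSeries.coeff p.1 (prodSeries n q 0 1) * e p.2 := by
  rw [mulCoeff, PowerSeries.coeff_mul]
  simp

lemma hecke_mulCoeff (t : ℂ) (i : Fin m) (e : ℕ → MvPolynomial (Fin (m + 1)) ℂ) (d : ℕ) :
    hecke t i (mulCoeff q e d) = mulCoeff q (fun k => hecke t i (e k)) d := by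
  rw [mulCoeff_eq_sum, mulCoeff_eq_sum, map_sum]
  exact Finset.sum_congr rfl fun p _ =>
    hecke_mul_of_symm t i _ _ (rename_coeff_prodSeries _ _ _ _ _)

lemma ascOp_mulCoeff (t : ℂ) (j : Fin (m + 1)) (e : ℕ → MvPolynomial (Fin (m + 1)) ℂ) (d : ℕ) :
    ascOp t j (mulCoeff q e d) = mulCoeff q (fun k => ascOp t j (e k)) d := by
  induction j using Fin.induction generalizing e with
  | zero => rfl
  | succ i ih => simp only [ascOp_succ, hecke_mulCoeff, ih]

lemma descOp_mulCoeff (t : ℂ) (j : Fin (m + 1)) (e : ℕ → MvPolynomial (Fin (m + 1)) ℂ) (d : ℕ) :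
    descOp t j (mulCoeff q e d) = mulCoeff q (fun k => descOp t j (e k)) d := by
  induction j using Fin.induction with
  | zero => rfl
  | succ i ih => simp only [descOp_succ, hecke_mulCoeff, ih]

lemma mulCoeff_shift (hq : ∀ k : ℕ, 1 - q ^ (k + 1) ≠ 0)
    (e : ℕ → MvPolynomial (Fin (m + 1)) ℂ) (d : ℕ) :
    mulCoeff q (fun k => shift q (e k)) d =
      PowerSeries.coeff d ((1 - PowerSeries.C (X 0) * PowerSeries.X) *
        PowerSeries.mk fun k => shift q (mulCoeff q e k)) := by
  have h1 : (PowerSeries.mk fun k => shift q (mulCoeff q e k)) =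
      PowerSeries.map (shift q).toRingHom (prodSeries (m + 1) q 0 1) *
        PowerSeries.mk fun k => shift q (e k) := by
    have : PowerSeries.map (shift q).toRingHom (prodSeries (m + 1) q 0 1 * PowerSeries.mk e) =
      PowerSeries.mk fun k => shift q (mulCoeff q e k) := by
      ext1 k
      rw [PowerSeries.coeff_map, PowerSeries.coeff_mk]
      rfl
    rw [← this, map_mul]
    congr 1
  rw [h1, ← mul_assoc, ← prodSeries_eq_mul_map_shift hq, mulCoeff]

lemma shift_iterate_X (q : ℂ) (j : Fin (m + 1)) (k : ℕ) (h : (j : ℕ) + k < m + 1) :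
    (shift q)^[k] (X j) = X (⟨j + k, h⟩ : Fin (m + 1)) := by
  induction k with
  | zero => rfl
  | succ k ih =>
    rw [Function.iterate_succ_apply', ih (by omega)]
    exact shift_X_castSucc q (⟨j + k, by omega⟩ : Fin m)

lemma shift_iterate_eq_scale (q : ℂ) (f : MvPolynomial (Fin (m + 1)) ℂ) :
    (shift q)^[m + 1] f = aeval (fun i => C q * X i) f := by
  rw [← AlgHom.coe_pow]
  congr 1
  refine MvPolynomial.algHom_ext fun j => ?_
  have h1 : (shift (m := m) q)^[m + 1] = (shift q)^[j + (1 + (m - j))] := by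
    congr 1
    omega
  rw [AlgHom.coe_pow, aeval_X, h1]
  rw [Function.iterate_add_apply, Function.iterate_add_apply, shift_iterate_X q j _ (by omega)]
  have h2 : (⟨j + (m - j), by omega⟩ : Fin (m + 1)) = Fin.last m := by
    ext; simp; omega
  rw [h2, Function.iterate_one, shift_X_last, ← AlgHom.coe_pow, map_mul, algHom_C, AlgHom.coe_pow,
    shift_iterate_X q 0 j (by simp; omega)]
  congr 2
  ext; simp

lemma eq_zero_of_shift_eq (hq : ∀ k : ℕ, 1 - q ^ (k + 1) ≠ 0) {d : ℕ}
    {f : MvPolynomial (Fin (m + 1)) ℂ} (hf : f.IsHomogeneous (d + 1)) (h : shift q f = f) :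
    f = 0 := by
  have h1 : (shift q)^[m + 1] f = f := Function.iterate_fixed h _
  rw [shift_iterate_eq_scale, IsHomogeneous.aeval_scale hf] at h1
  have h2 : C (1 - q ^ (d + 1)) * f = 0 := by rw [C_sub, sub_mul, h1, C_1, one_mul, sub_self]
  exact (mul_eq_zero.mp h2).resolve_left (C_ne_zero.mpr (hq d))

lemma topComb_isHomogeneous (P : (Fin n → ℕ) → MvPolynomial (Fin n) ℂ) (d : ℕ)
    (κ : (Fin n → ℕ) → ℂ) : (topComb P d κ).IsHomogeneous d := by
  refine IsHomogeneous.sum _ _ _ fun u hu => ?_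
  rw [mem_comps] at hu
  have := (isHomogeneous_C (Fin n) (κ u)).mul (homogeneousComponent_isHomogeneous (wt u) (P u))
  rw [zero_add] at this
  exact hu ▸ this

lemma mulCoeff_isHomogeneous (q : ℂ) (e : ℕ → MvPolynomial (Fin n) ℂ)
    (he : ∀ k, (e k).IsHomogeneous k) (d : ℕ) : (mulCoeff q e d).IsHomogeneous d := by
  rw [mulCoeff_eq_sum]
  refine IsHomogeneous.sum _ _ _ fun p hp => ?_
  have := (coeff_prodSeries_isHomogeneous (n := n) q 0 1 p.1).mul (he p.2)
  rwa [Finset.HasAntidiagonal.mem_antidiagonal.mp hp] at this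

lemma comps_zero (n : ℕ) : comps n 0 = {fun _ => 0} := by
  ext u
  rw [mem_comps, Finset.mem_singleton, wt, Finset.sum_eq_zero_iff, funext_iff]
  simp

lemma topSum_zero (hP : NormInterp q t P) : topSum P 0 = 1 := by
  rw [topSum, topComb, comps_zero, Finset.sum_singleton, topPart_zero hP, C_1, one_mul]

lemma shift_mulCoeff_topSum (hP : NormInterp q t P) (hp : GoodParams q t) (d : ℕ) :
    shift q (mulCoeff q (topSum P) d) = mulCoeff q (topSum P) d := by
  have h1 : (PowerSeries.mk fun k => shift q (topSum P k)) =
      (1 - PowerSeries.C (X 0) * PowerSeries.X) * PowerSeries.mk (topSum P) := by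
    ext1 k
    rw [PowerSeries.coeff_mk]
    cases k with
    | zero => rw [coeff_zero_one_sub_mul, PowerSeries.coeff_mk, topSum_zero hP, map_one]
    | succ k =>
      rw [coeff_succ_one_sub_mul, PowerSeries.coeff_mk, PowerSeries.coeff_mk,
        shift_topSum_succ hP hp]
  have h2 : (1 - PowerSeries.C (X 0) * PowerSeries.X) *
      (PowerSeries.mk fun k => shift q (mulCoeff q (topSum P) k)) =
      (1 - PowerSeries.C (X 0) * PowerSeries.X) * PowerSeries.mk (mulCoeff q (topSum P)) := by
    have h3 : (PowerSeries.mk (mulCoeff q (topSum P))) =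
        prodSeries (m + 1) q 0 1 * PowerSeries.mk (topSum P) := by
      ext1 k; rw [PowerSeries.coeff_mk]; rfl
    rw [h3, mul_left_comm, ← h1]
    ext1 k
    rw [← mulCoeff_shift hp.generic.one_sub_pow_ne]
    rfl
  have hne : (1 - PowerSeries.C (X 0) * PowerSeries.X :
      PowerSeries (MvPolynomial (Fin (m + 1)) ℂ)) ≠ 0 := by
    intro h
    have := congrArg PowerSeries.constantCoeff h
    simp at this
  have := congrArg (PowerSeries.coeff d) (mul_left_cancel₀ hne h2)
  rwa [PowerSeries.coeff_mk, PowerSeries.coeff_mk] at this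

theorem mulCoeff_kern_eq_zero (hP : NormInterp q t P) (hp : GoodParams q t)
    (w : Fin (m + 1) → ℕ) : ∀ d, wt w < d →
      mulCoeff q (fun k => kern q t P k (evalForm (spec q t w))) d = 0 := by
  induction w using composition_induction with
  | h0 =>
    intro d hd
    obtain ⟨d, rfl⟩ : ∃ e, d = e + 1 := ⟨d - 1, by omega⟩
    have h1 : (fun k => kern q t P k (evalForm (spec q t fun _ => 0))) = topSum P :=
      funext fun k => kern_spec_zero hP hp k
    rw [h1]
    exact eq_zero_of_shift_eq hp.generic.one_sub_pow_ne
      (mulCoeff_isHomogeneous q _ (fun k => topComb_isHomogeneous P k _) _)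
      (shift_mulCoeff_topSum hP hp _)
  | hr w ih =>
    intro d hd
    rw [wt_raise] at hd
    obtain ⟨d, rfl⟩ : ∃ e, d = e + 1 := ⟨d - 1, by omega⟩
    apply ascOp_injective hp.ht (Fin.last m)
    rw [map_zero, ascOp_mulCoeff]
    simp only [ascOp_kern_spec_raise hP hp]
    rw [mulCoeff_shift hp.generic.one_sub_pow_ne, coeff_succ_one_sub_mul, PowerSeries.coeff_mk,
      PowerSeries.coeff_mk, ← descOp_mulCoeff, ← descOp_mulCoeff, ih _ (by omega),
      ih _ (by omega), map_zero, map_zero, mul_zero, sub_zero]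
  | ha i w hne ih =>
    intro d hd
    rw [wt_comp_perm] at hd
    have h1 : C (offCoeff q t i w) *
        mulCoeff q (fun k => kern q t P k (evalForm (spec q t (w ∘ adj i)))) d =
        hecke t i (mulCoeff q (fun k => kern q t P k (evalForm (spec q t w))) d) -
        C (t - offCoeff q t i w) *
          mulCoeff q (fun k => kern q t P k (evalForm (spec q t w))) d := by
      rw [hecke_mulCoeff, mulCoeff_eq_sum, mulCoeff_eq_sum, mulCoeff_eq_sum, Finset.mul_sum,
        Finset.mul_sum, ← Finset.sum_sub_distrib]
      refine Finset.sum_congr rfl fun p _ => ?_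
      rw [mul_left_comm, kern_spec_comp_adj hP hp _ i w hne]
      ring
    rw [ih d hd, map_zero, mul_zero, sub_zero] at h1
    exact (mul_eq_zero.mp h1).resolve_left
      (C_ne_zero.mpr (offCoeff_ne_zero hp.hq hp.ht hp.generic i hne))

end Vanishing

/-- The finset of compositions of weight at most `d`. -/
def compsLE (n d : ℕ) : Finset (Fin n → ℕ) := (Finset.range (d + 1)).biUnion (comps n)

lemma mem_compsLE {d : ℕ} {u : Fin n → ℕ} : u ∈ compsLE n d ↔ wt u ≤ d := by
  simp [compsLE]

lemma sum_compsLE {α : Type*} [AddCommMonoid α] (d : ℕ) (f : (Fin n → ℕ) → α) :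
    ∑ u ∈ compsLE n d, f u = ∑ k ∈ Finset.range (d + 1), ∑ u ∈ comps n k, f u := by
  refine Finset.sum_biUnion fun i _ j _ hij => ?_
  rw [Function.onFun, Finset.disjoint_left]
  intro u hu hu'
  rw [mem_comps] at hu hu'
  exact hij (hu.symm.trans hu')

/-- The substitution `f(x) ↦ f(c x)`. -/
def scale (c : ℂ) : MvPolynomial (Fin n) ℂ →ₐ[ℂ] MvPolynomial (Fin n) ℂ :=
  aeval fun i => C c * X i

lemma eval_scale (c : ℂ) (x : Fin n → ℂ) (f : MvPolynomial (Fin n) ℂ) :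
    eval x (scale c f) = eval (fun i => c * x i) f := by
  rw [scale, eval_aeval]
  simp

lemma prodSeries_mul {q : ℂ} (hq : ∀ k : ℕ, 1 - q ^ (k + 1) ≠ 0) (a b : ℂ) :
    prodSeries n q a b * PowerSeries.rescale (C a) (prodSeries n q 0 1) =
      PowerSeries.rescale (C b) (prodSeries n q 0 1) := by
  rw [prodSeries, prodSeries, map_prod, map_prod, ← Finset.prod_mul_distrib]
  refine Finset.prod_congr rfl fun i _ => ?_
  rw [rescale_comm (C a), rescale_comm (C b), PowerSeries.rescale_map, PowerSeries.rescale_map,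
    ← map_mul, ← map_mul, binSeries_mul hq a b]

section Connection
variable {q t : ℂ} {P : (Fin (m + 1) → ℕ) → MvPolynomial (Fin (m + 1)) ℂ}

/-- The normalised value `E_u(x) / E_u(⟨0⟩)`. -/
def normVal (q t : ℂ) (P : (Fin n → ℕ) → MvPolynomial (Fin n) ℂ) (x : Fin n → ℂ)
    (u : Fin n → ℕ) : ℂ := eval x (topPart P u) / topVal q t P u

/-- The kernel `Σ_{|u| = d} E_u(x) P_u / E_u(⟨0⟩)`. -/
def interpKern (q t : ℂ) (P : (Fin n → ℕ) → MvPolynomial (Fin n) ℂ) (x : Fin n → ℂ) (d : ℕ) :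
    MvPolynomial (Fin n) ℂ := ∑ u ∈ comps n d, C (normVal q t P x u) * P u

lemma kern_evalForm (x : Fin n → ℂ) (P : (Fin n → ℕ) → MvPolynomial (Fin n) ℂ) (d : ℕ) :
    kern q t P d (evalForm x) = topComb P d (normVal q t P x) :=
  topComb_congr fun u _ => by rw [evalForm_apply, normVal]

lemma eval_kern_comm (x y : Fin n → ℂ) (P : (Fin n → ℕ) → MvPolynomial (Fin n) ℂ) (d : ℕ) :
    eval y (kern q t P d (evalForm x)) = eval x (kern q t P d (evalForm y)) := by
  rw [kern_evalForm, kern_evalForm, topComb, topComb, map_sum, map_sum]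
  refine Finset.sum_congr rfl fun u _ => ?_
  rw [map_mul, map_mul, eval_C, eval_C, normVal, normVal]
  ring

lemma interpKern_eq (hP : NormInterp q t P) (hp : GoodParams q t) (x : Fin (m + 1) → ℂ) (d : ℕ) :
    interpKern q t P x d = ∑ p ∈ Finset.HasAntidiagonal.antidiagonal d,
      C (eval x (PowerSeries.coeff p.1 (prodSeries (m + 1) q 0 1))) *
        kern q t P p.2 (evalForm x) := by
  rw [← sub_eq_zero]
  have hhom : ∀ k, (kern q t P k (evalForm x)).IsHomogeneous k :=
    fun k => topComb_isHomogeneous P k _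
  refine eq_zero_of_homogeneousComponent hp d _ ?_ ?_ ?_
  · refine (totalDegree_sub _ _).trans (max_le ?_ ?_)
    · refine totalDegree_finsetSum_le fun u hu => (totalDegree_C_mul_le _ _).trans ?_
      exact (hP.deg u).trans (mem_comps.mp hu).le
    · refine totalDegree_finsetSum_le fun p hp => (totalDegree_C_mul_le _ _).trans ?_
      have := Finset.HasAntidiagonal.mem_antidiagonal.mp hp
      exact (hhom _).totalDegree_le.trans (by omega)
  · rw [map_sub, sub_eq_zero, interpKern, map_sum, map_sum, Finset.sum_eq_single (0, d)]
    · rw [coeff_zero_prodSeries, map_one, C_1, one_mul, homogeneousComponent_of_mem (hhom d),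
        if_pos rfl, kern_evalForm]
      refine Finset.sum_congr rfl fun u hu => ?_
      rw [homogeneousComponent_C_mul', topPart, mem_comps.mp hu]
    · intro p hp hne
      have := Finset.HasAntidiagonal.mem_antidiagonal.mp hp
      rw [homogeneousComponent_C_mul', homogeneousComponent_of_mem (hhom p.2), if_neg, mul_zero]
      rintro h
      refine hne (Prod.ext ?_ h.symm)
      simp only; omega
    · intro h
      exact absurd (Finset.HasAntidiagonal.mem_antidiagonal.mpr (zero_add d)) h
  · intro w hw
    rw [map_sub, sub_eq_zero]
    trans 0
    · rw [interpKern, map_sum]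
      refine Finset.sum_eq_zero fun u hu => ?_
      rw [mem_comps] at hu
      rw [map_mul, hP.van u w (by omega) (by rintro rfl; omega), mul_zero]
    · have h := congrArg (eval x) (mulCoeff_kern_eq_zero hP hp w d hw)
      rw [map_zero, mulCoeff_eq_sum, map_sum] at h
      rw [map_sum]
      refine Eq.trans h.symm (Finset.sum_congr rfl fun p _ => ?_)
      rw [map_mul, map_mul, eval_C, eval_kern_comm]

lemma scale_kern (x : Fin n → ℂ) (P : (Fin n → ℕ) → MvPolynomial (Fin n) ℂ) (c : ℂ) (d : ℕ) :
    scale c (kern q t P d (evalForm x)) = C (c ^ d) * kern q t P d (evalForm x) :=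
  IsHomogeneous.aeval_scale (topComb_isHomogeneous P d _) c

lemma interpKern_scale (hP : NormInterp q t P) (hp : GoodParams q t) (x : Fin (m + 1) → ℂ)
    (a b : ℂ) (d : ℕ) :
    C (b ^ d) * scale a (interpKern q t P x d) =
      ∑ p ∈ Finset.HasAntidiagonal.antidiagonal d,
        C (a ^ p.1) * scale b (interpKern q t P x p.1) *
          C (eval x (PowerSeries.coeff p.2 (prodSeries (m + 1) q a b))) := by
  set φ : MvPolynomial (Fin (m + 1)) ℂ →+* MvPolynomial (Fin (m + 1)) ℂ := C.comp (eval x) with hφ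
  have hφC : ∀ c, φ (C c) = C c := fun c => by simp [hφ]
  set K : PowerSeries (MvPolynomial (Fin (m + 1)) ℂ) :=
    PowerSeries.mk fun k => kern q t P k (evalForm x) with hK
  have h1 : ∀ c : ℂ, (PowerSeries.mk fun k => scale c (interpKern q t P x k)) =
      PowerSeries.map φ (prodSeries (m + 1) q 0 1) * PowerSeries.rescale (C c) K := by
    intro c
    ext1 k
    rw [PowerSeries.coeff_mk, PowerSeries.coeff_mul, interpKern_eq hP hp, map_sum]
    refine Finset.sum_congr rfl fun p _ => ?_
    rw [map_mul, algHom_C, scale_kern, PowerSeries.coeff_map, PowerSeries.coeff_rescale,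
      PowerSeries.coeff_mk, C_pow]
    rfl
  have h2 := congrArg (PowerSeries.map φ)
    (prodSeries_mul (n := m + 1) hp.generic.one_sub_pow_ne a b)
  rw [map_mul, ← PowerSeries.rescale_map, ← PowerSeries.rescale_map, hφC, hφC] at h2
  have h3 : PowerSeries.rescale (C b) (PowerSeries.mk fun k => scale a (interpKern q t P x k)) =
      PowerSeries.rescale (C a) (PowerSeries.mk fun k => scale b (interpKern q t P x k)) *
        PowerSeries.map φ (prodSeries (m + 1) q a b) := by
    rw [h1, h1, map_mul, map_mul, rescale_comm (C b), ← h2]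
    ring
  have h4 := congrArg (PowerSeries.coeff d) h3
  rw [PowerSeries.coeff_rescale, PowerSeries.coeff_mk, PowerSeries.coeff_mul] at h4
  rw [C_pow, h4]
  refine Finset.sum_congr rfl fun p _ => ?_
  rw [PowerSeries.coeff_rescale, PowerSeries.coeff_mk, PowerSeries.coeff_map, C_pow]
  rfl

lemma eq_of_sum_scale_eq (hP : NormInterp q t P) (hp : GoodParams q t) {b : ℂ} (hb : b ≠ 0) (d : ℕ)
    (c c' : (Fin (m + 1) → ℕ) → ℂ)
    (h : ∑ v ∈ compsLE (m + 1) d, C (c v) * scale b (P v) =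
      ∑ v ∈ compsLE (m + 1) d, C (c' v) * scale b (P v)) (v) (hv : wt v ≤ d) : c v = c' v := by
  induction hk : wt v using Nat.strong_induction_on generalizing v with
  | _ k ih =>
  have h1 := congrArg (eval fun i => b⁻¹ * spec q t v i) h
  simp only [map_sum, map_mul, eval_C, eval_scale, mul_inv_cancel_left₀ hb] at h1
  rw [← sub_eq_zero, ← Finset.sum_sub_distrib, Finset.sum_eq_single v, hP.diag, ← sub_mul] at h1
  · exact sub_eq_zero.mp ((mul_eq_zero.mp h1).resolve_right (diagVal_ne_zero hp.hq hp.ht v))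
  · intro u hu hne
    rw [mem_compsLE] at hu
    rcases lt_or_ge (wt u) (wt v) with hlt | hle
    · rw [ih (wt u) (hk ▸ hlt) u hu rfl, sub_self]
    · have := hP.van u v hle hne.symm
      rw [show (fun i => spec q t v i) = spec q t v from rfl, this]
      simp
  · intro hnot
    exact absurd (mem_compsLE.mpr hv) hnot

theorem sum_connection (hP : NormInterp q t P) (hp : GoodParams q t) {a b : ℂ} (hb : b ≠ 0)
    {cc : (Fin (m + 1) → ℕ) → (Fin (m + 1) → ℕ) → ℂ} (hcc : ∀ u v, wt u < wt v → cc u v = 0)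
    (hcc' : ∀ u, scale a (P u) = ∑ᶠ v, cc u v • scale b (P v)) (x : Fin (m + 1) → ℂ) (d : ℕ)
    (v : Fin (m + 1) → ℕ) (hv : wt v ≤ d) :
    b ^ d * ∑ u ∈ comps (m + 1) d, normVal q t P x u * cc u v =
      a ^ wt v * normVal q t P x v *
        eval x (PowerSeries.coeff (d - wt v) (prodSeries (m + 1) q a b)) := by
  refine eq_of_sum_scale_eq hP hp hb d
    (fun v => b ^ d * ∑ u ∈ comps (m + 1) d, normVal q t P x u * cc u v)
    (fun v => a ^ wt v * normVal q t P x v *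
        eval x (PowerSeries.coeff (d - wt v) (prodSeries (m + 1) q a b))) ?_ v hv
  trans C (b ^ d) * scale a (interpKern q t P x d)
  · simp only [C_mul, map_sum, Finset.sum_mul, Finset.mul_sum, interpKern]
    rw [Finset.sum_comm]
    refine Finset.sum_congr rfl fun u hu => ?_
    rw [map_mul, algHom_C, hcc' u, finsum_eq_sum_of_support_subset (s := compsLE (m + 1) d),
      Finset.mul_sum,
      Finset.mul_sum]
    · refine Finset.sum_congr rfl fun w _ => ?_
      rw [← C_mul_eq_smul]
      ring
    · intro w hw
      rw [Finset.mem_coe, mem_compsLE]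
      by_contra hlt
      rw [mem_comps] at hu
      refine hw ?_
      simp only
      rw [hcc u w (by omega), zero_smul]
  · rw [interpKern_scale hP hp, Finset.Nat.sum_antidiagonal_eq_sum_range_succ (fun j i =>
      C (a ^ j) * scale b (interpKern q t P x j) *
          C (eval x (PowerSeries.coeff i (prodSeries (m + 1) q a b)))), sum_compsLE]
    refine Finset.sum_congr rfl fun k _ => ?_
    rw [interpKern, map_sum, Finset.mul_sum, Finset.sum_mul]
    refine Finset.sum_congr rfl fun u hu => ?_
    rw [mem_comps.mp hu, map_mul, algHom_C, C_mul, C_mul]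
    ring

end Connection

lemma topPart_MM (q t : ℂ) (M : (Fin n → ℕ) → MvPolynomial (Fin n) ℂ) (u : Fin n → ℕ) :
    topPart (MM q t M) u = C (q ^ nstat' u) * EE q t M u := by
  rw [topPart, MM, homogeneousComponent_C_mul', EE, ← mul_assoc, ← C_mul, mul_div_assoc]

lemma EE_isHomogeneous (q t : ℂ) (M : (Fin n → ℕ) → MvPolynomial (Fin n) ℂ) (u : Fin n → ℕ) :
    (EE q t M u).IsHomogeneous (wt u) := by
  have := (isHomogeneous_C (Fin n) (t ^ nstat u / cp q t u)).mul
    (homogeneousComponent_isHomogeneous (wt u) (M u))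
  rwa [zero_add] at this

lemma eval_spec0div (q t : ℂ) (M : (Fin n → ℕ) → MvPolynomial (Fin n) ℂ) (a : ℂ) (u : Fin n → ℕ) :
    eval (spec0div q t a) (EE q t M u) =
      a⁻¹ ^ wt u * eval (spec q t fun _ => 0) (EE q t M u) := by
  rw [← eval_scale_of_isHomogeneous (EE_isHomogeneous q t M u)]
  congr 2
  funext i
  rw [spec0div, div_eq_inv_mul]

section
variable {q t : ℂ} {M : (Fin (m + 1) → ℕ) → MvPolynomial (Fin (m + 1)) ℂ} {a b : ℂ}
  {cc : (Fin (m + 1) → ℕ) → (Fin (m + 1) → ℕ) → ℂ}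

lemma normVal_MM (hp : GoodParams q t) (x : Fin (m + 1) → ℂ) (u : Fin (m + 1) → ℕ) :
    normVal q t (MM q t M) x u =
      eval x (EE q t M u) / eval (spec q t fun _ => 0) (EE q t M u) := by
  have h := pow_ne_zero (nstat' u) hp.hq
  rw [normVal, topVal, topPart_MM, map_mul, map_mul, eval_C, eval_C, mul_div_mul_left _ _ h]

lemma eval_spec_zero_EE_ne_zero (hP : NormInterp q t (MM q t M)) (hp : GoodParams q t)
    (u : Fin (m + 1) → ℕ) : eval (spec q t fun _ => 0) (EE q t M u) ≠ 0 := by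
  have h := topVal_ne_zero hP hp u
  rw [topVal, topPart_MM, map_mul] at h
  exact right_ne_zero_of_mul h

lemma skew_mul_eval (hp : GoodParams q t) (x : Fin (m + 1) → ℂ)
    (u v : Fin (m + 1) → ℕ) : skew q t M a b cc u v * eval x (EE q t M u) =
      a⁻¹ ^ wt v * eval (spec q t fun _ => 0) (EE q t M v) *
        (b ^ wt u * (normVal q t (MM q t M) x u * cc u v)) := by
  rw [skew, eval_spec0div, eval_spec0div, normVal_MM hp, inv_pow b, div_eq_mul_inv, mul_inv,
    inv_inv]
  ring

theorem sum_skew (hP : NormInterp q t (MM q t M)) (hp : GoodParams q t) (ha : a ≠ 0) (hb : b ≠ 0)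
    (hcc : IsConnection q t M a b cc) (d : ℕ) (v : Fin (m + 1) → ℕ) (hv : wt v ≤ d) :
    ∑ u ∈ comps (m + 1) d, C (skew q t M a b cc u v) * EE q t M u =
      EE q t M v * PowerSeries.coeff (d - wt v) (prodSeries (m + 1) q a b) := by
  refine MvPolynomial.funext fun x => ?_
  have h := sum_connection hP hp hb hcc.1 hcc.2 x d v hv
  rw [map_sum, map_mul]
  simp only [map_mul, eval_C, skew_mul_eval hp]
  rw [← Finset.mul_sum, Finset.sum_congr rfl (g := fun u => b ^ d *
    (normVal q t (MM q t M) x u * cc u v)) fun u hu => by rw [mem_comps.mp hu],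
    ← Finset.mul_sum, h, normVal_MM hp]
  have h0 := eval_spec_zero_EE_ne_zero hP hp v
  have ha' := pow_ne_zero (wt v) ha
  rw [inv_pow]
  field_simp

lemma skew_eq_zero (hcc : IsConnection q t M a b cc) {u v : Fin (m + 1) → ℕ} (h : wt u < wt v) :
    skew q t M a b cc u v = 0 := by
  rw [skew, hcc.1 u v h, mul_zero]

end

/-- `f` is a combination of the `E_u`, `|u| = d`, whose coefficients have `ℓ¹`-norm at most `c`. -/
def CoeffBound (P : (Fin n → ℕ) → MvPolynomial (Fin n) ℂ) (d : ℕ) (f : MvPolynomial (Fin n) ℂ)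
    (c : ℝ) : Prop := ∃ κ, f = topComb P d κ ∧ ∑ u ∈ comps n d, ‖κ u‖ ≤ c

namespace CoeffBound
variable {P : (Fin n → ℕ) → MvPolynomial (Fin n) ℂ} {d : ℕ} {f g : MvPolynomial (Fin n) ℂ}
  {c c' : ℝ}

lemma nonneg (h : CoeffBound P d f c) : 0 ≤ c := by
  obtain ⟨κ, -, h⟩ := h
  exact (Finset.sum_nonneg fun _ _ => norm_nonneg _).trans h

lemma mono (h : CoeffBound P d f c) (hc : c ≤ c') : CoeffBound P d f c' := by
  obtain ⟨κ, h1, h2⟩ := h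
  exact ⟨κ, h1, h2.trans hc⟩

lemma zero : CoeffBound P d 0 0 :=
  ⟨fun _ => 0, by simp [topComb], by simp⟩

lemma add (hf : CoeffBound P d f c) (hg : CoeffBound P d g c') :
    CoeffBound P d (f + g) (c + c') := by
  obtain ⟨κ, rfl, h2⟩ := hf
  obtain ⟨μ, rfl, h4⟩ := hg
  refine ⟨fun u => κ u + μ u, (topComb_add _ _ _ _).symm, ?_⟩
  refine (Finset.sum_le_sum fun u _ => norm_add_le _ _).trans ?_
  rw [Finset.sum_add_distrib]
  exact add_le_add h2 h4

lemma C_mul (hf : CoeffBound P d f c) (z : ℂ) : CoeffBound P d (C z * f) (‖z‖ * c) := by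
  obtain ⟨κ, rfl, h2⟩ := hf
  refine ⟨fun u => z * κ u, C_mul_topComb _ _ _ _, ?_⟩
  simp only [norm_mul]
  rw [← Finset.mul_sum]
  exact mul_le_mul_of_nonneg_left h2 (norm_nonneg _)

lemma sub_C_mul (hf : CoeffBound P d f c) (hg : CoeffBound P d g c') (z : ℂ) :
    CoeffBound P d (f - MvPolynomial.C z * g) (c + ‖z‖ * c') := by
  have := hf.add (hg.C_mul (-z))
  rwa [norm_neg, C_neg, neg_mul, ← sub_eq_add_neg] at this

lemma sum {ι : Type*} (s : Finset ι) {f : ι → MvPolynomial (Fin n) ℂ} {c : ι → ℝ}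
    (h : ∀ i ∈ s, CoeffBound P d (f i) (c i)) : CoeffBound P d (∑ i ∈ s, f i) (∑ i ∈ s, c i) := by
  classical
  induction s using Finset.induction with
  | empty => exact zero
  | insert i s hi ih =>
    rw [Finset.sum_insert hi, Finset.sum_insert hi]
    exact (h i (Finset.mem_insert_self _ _)).add
      (ih fun j hj => h j (Finset.mem_insert_of_mem hj))

lemma topPart {u : Fin n → ℕ} (hu : wt u = d) : CoeffBound P d (topPart P u) 1 := by
  classical
  refine ⟨Pi.single u 1, ?_, ?_⟩
  · rw [topComb, Finset.sum_eq_single u]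
    · simp
    · intro w _ hw
      rw [Pi.single_eq_of_ne hw, C_0, zero_mul]
    · intro h
      exact absurd (mem_comps.mpr hu) h
  · rw [Finset.sum_eq_single u]
    · simp
    · intro w _ hw
      rw [Pi.single_eq_of_ne hw, norm_zero]
    · intro h
      exact absurd (mem_comps.mpr hu) h

lemma map (hf : CoeffBound P d f c) (L : MvPolynomial (Fin n) ℂ →ₗ[ℂ] MvPolynomial (Fin n) ℂ)
    {d' : ℕ} {K : ℝ} (hK : 0 ≤ K) (hL : ∀ u, wt u = d → CoeffBound P d' (L (LRW.topPart P u)) K) :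
    CoeffBound P d' (L f) (K * c) := by
  obtain ⟨κ, rfl, h2⟩ := hf
  rw [topComb, map_sum]
  have := sum (P := P) (d := d') (comps n d)
    (f := fun u => L (MvPolynomial.C (κ u) * LRW.topPart P u))
    (c := fun u => ‖κ u‖ * K) fun u hu => by
      rw [C_mul_eq_smul, map_smul, ← C_mul_eq_smul]
      exact (hL u (mem_comps.mp hu)).C_mul _
  refine this.mono ?_
  rw [← Finset.sum_mul, mul_comm]
  exact mul_le_mul_of_nonneg_left h2 hK

lemma norm_eval_le (hf : CoeffBound P d f c) (x : Fin n → ℂ) {K : ℝ} (hK : 0 ≤ K)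
    (h : ∀ u, wt u = d → ‖eval x (LRW.topPart P u)‖ ≤ K) : ‖eval x f‖ ≤ c * K := by
  obtain ⟨κ, rfl, h2⟩ := hf
  rw [topComb, map_sum]
  refine (norm_sum_le _ _).trans ?_
  refine le_trans ?_ (mul_le_mul_of_nonneg_right h2 hK)
  rw [Finset.sum_mul]
  refine Finset.sum_le_sum fun u hu => ?_
  rw [map_mul, eval_C, norm_mul]
  exact mul_le_mul_of_nonneg_left (h u (mem_comps.mp hu)) (norm_nonneg _)

end CoeffBound

section
variable {q t : ℂ} {P : (Fin (m + 1) → ℕ) → MvPolynomial (Fin (m + 1)) ℂ}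

lemma CoeffBound.sum_norm_le (hP : NormInterp q t P) (hp : GoodParams q t) {d : ℕ}
    {κ : (Fin (m + 1) → ℕ) → ℂ} {c : ℝ} (h : CoeffBound P d (topComb P d κ) c) :
    ∑ u ∈ comps (m + 1) d, ‖κ u‖ ≤ c := by
  obtain ⟨μ, h1, h2⟩ := h
  have h3 : topComb P d (fun u => κ u + (-1) * μ u) = 0 := by
    rw [topComb_add, ← C_mul_topComb, h1, C_neg, C_1]
    ring
  have h4 := (topComb_eq_zero_iff hP hp d _).mp h3
  refine le_of_eq_of_le (Finset.sum_congr rfl fun u hu => ?_) h2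
  congr 1
  linear_combination h4 u (mem_comps.mp hu)

end

/-- Uniform bounds for `1 - q^e t^l` and its inverse, with `e` positive and `l` bounded. -/
lemma exists_bound_one_sub {q t : ℂ} (hp : GoodParams q t) (hq1 : ‖q‖ < 1) (N : ℤ) :
    ∃ K : ℝ, 1 ≤ K ∧ ∀ (e : ℕ) (l : ℤ), -N ≤ l → l ≤ N →
      ‖1 - q ^ (e + 1) * t ^ l‖ ≤ K ∧ ‖(1 - q ^ (e + 1) * t ^ l)⁻¹‖ ≤ K := by
  have hne : ∀ (e : ℕ) (l : ℤ), 1 - q ^ (e + 1) * t ^ l ≠ 0 := by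
    intro e l h
    refine hp.generic (e + 1) l (by omega) ?_
    have := sub_eq_zero.mp h
    exact_mod_cast this.symm
  have h1 : ∀ l : ℤ, ∃ K : ℝ, ∀ e : ℕ, ‖1 - q ^ (e + 1) * t ^ l‖ ≤ K ∧
      ‖(1 - q ^ (e + 1) * t ^ l)⁻¹‖ ≤ K := by
    intro l
    have ht0 : Filter.Tendsto (fun e : ℕ => 1 - q ^ (e + 1) * t ^ l) Filter.atTop (nhds 1) := by
      have h := (tendsto_pow_atTop_nhds_zero_of_norm_lt_one hq1).comp
        (Filter.tendsto_add_atTop_nat 1)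
      have h' := (h.mul_const (t ^ l)).const_sub 1
      simpa using h'
    obtain ⟨K1, hK1⟩ := (Metric.isBounded_range_of_tendsto _ ht0).exists_norm_le
    obtain ⟨K2, hK2⟩ := (Metric.isBounded_range_of_tendsto _ (ht0.inv₀ one_ne_zero)).exists_norm_le
    exact ⟨max K1 K2, fun e => ⟨(hK1 _ ⟨e, rfl⟩).trans (le_max_left _ _),
      (hK2 _ ⟨e, rfl⟩).trans (le_max_right _ _)⟩⟩
  choose K hK using h1
  refine ⟨1 + ∑ l ∈ Finset.Icc (-N) N, |K l|, ?_, fun e l hl hl' => ?_⟩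
  · have := Finset.sum_nonneg fun l (_ : l ∈ Finset.Icc (-N) N) => abs_nonneg (K l)
    linarith
  · have h2 : |K l| ≤ ∑ l ∈ Finset.Icc (-N) N, |K l| :=
      Finset.single_le_sum (f := fun l => |K l|) (fun _ _ => abs_nonneg _)
        (Finset.mem_Icc.mpr ⟨hl, hl'⟩)
    have h3 := le_abs_self (K l)
    obtain ⟨h4, h5⟩ := hK l e
    exact ⟨by linarith, by linarith⟩

lemma spec_eq_mul_of_lt {q t : ℂ} (hp : GoodParams q t) (u : Fin (m + 1) → ℕ) {i j : Fin (m + 1)}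
    (h : u j < u i) : ∃ (e : ℕ) (l : ℤ), -m ≤ l ∧ l ≤ m ∧
      spec q t u i = spec q t u j * (q ^ (e + 1) * t ^ l) := by
  have h1 := lp_lt u i
  have h2 := lp_lt u j
  refine ⟨u i - u j - 1, ((m - lp u i : ℕ) : ℤ) - ((m - lp u j : ℕ) : ℤ), by omega, by omega, ?_⟩
  rw [spec, spec, zpow_sub₀ hp.ht, zpow_natCast, zpow_natCast,
    show u i = u j + (u i - u j - 1 + 1) by omega, pow_add, Nat.add_sub_cancel_left]
  simp only [Nat.add_sub_cancel]
  have := pow_ne_zero (m - lp u j) hp.ht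
  field_simp

lemma exists_bound_offCoeff {q t : ℂ} (hp : GoodParams q t) (hq1 : ‖q‖ < 1) :
    ∃ R : ℝ, 0 ≤ R ∧ ∀ (i : Fin m) (u : Fin (m + 1) → ℕ), u i.castSucc ≠ u i.succ →
      ‖offCoeff q t i u‖ ≤ R ∧ ‖(offCoeff q t i u)⁻¹‖ ≤ R := by
  obtain ⟨K, hK1, hK⟩ := exists_bound_one_sub hp hq1 (m + 1)
  have hK0 : 0 ≤ K := by linarith
  have key : ∀ (z : ℂ) (e : ℕ) (l l' : ℤ), -(m + 1) ≤ l → l ≤ m + 1 → -(m + 1) ≤ l' → l' ≤ m + 1 →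
      ‖z‖ ≤ 1 + ‖t‖ + ‖t⁻¹‖ →
      ‖z * ((1 - q ^ (e + 1) * t ^ l) * (1 - q ^ (e + 1) * t ^ l')⁻¹)‖ ≤
        (1 + ‖t‖ + ‖t⁻¹‖) * (K * K) := by
    intro z e l l' h1 h2 h3 h4 hz
    rw [norm_mul, norm_mul]
    exact mul_le_mul hz (mul_le_mul (hK e l h1 h2).1 (hK e l' h3 h4).2 (norm_nonneg _) hK0)
      (by positivity) (by positivity)
  have ht := hp.ht
  have n1 := norm_nonneg t
  have n2 := norm_nonneg t⁻¹
  have hone : ‖(1 : ℂ)‖ ≤ 1 + ‖t‖ + ‖t⁻¹‖ := by rw [norm_one]; linarith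
  refine ⟨(1 + ‖t‖ + ‖t⁻¹‖) * (K * K), by positivity, fun i u hu => ?_⟩
  rcases lt_or_gt_of_ne hu with h | h
  · obtain ⟨e, l, hl, hl', hs⟩ := spec_eq_mul_of_lt hp u h
    have hz := spec_ne_zero hp.hq hp.ht u i.castSucc
    have hr : offCoeff q t i u =
        (1 - q ^ (e + 1) * t ^ (l + 1)) * (1 - q ^ (e + 1) * t ^ l)⁻¹ := by
      rw [offCoeff, hs, zpow_add_one₀ ht, ← div_eq_mul_inv]
      refine Eq.trans ?_ (mul_div_mul_left _ _ (neg_ne_zero.mpr hz))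
      congr 1 <;> ring
    rw [hr, mul_inv, inv_inv, mul_comm (1 - q ^ (e + 1) * t ^ (l + 1))⁻¹]
    constructor
    · simpa using key 1 e (l + 1) l (by omega) (by omega) (by omega) (by omega) hone
    · simpa using key 1 e l (l + 1) (by omega) (by omega) (by omega) (by omega) hone
  · obtain ⟨e, l, hl, hl', hs⟩ := spec_eq_mul_of_lt hp u h
    have hz := spec_ne_zero hp.hq hp.ht u i.succ
    have hr : offCoeff q t i u =
        t * ((1 - q ^ (e + 1) * t ^ (l - 1)) * (1 - q ^ (e + 1) * t ^ l)⁻¹) := by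
      rw [offCoeff, hs, zpow_sub_one₀ ht, ← div_eq_mul_inv, ← mul_div_assoc]
      refine Eq.trans ?_ (mul_div_mul_left _ _ hz)
      congr 1
      · field_simp
      · ring
    rw [hr]
    constructor
    · exact key t e (l - 1) l (by omega) (by omega) (by omega) (by omega) (by linarith)
    · rw [mul_inv, mul_inv, inv_inv, mul_comm (1 - q ^ (e + 1) * t ^ (l - 1))⁻¹]
      exact key t⁻¹ e l (l - 1) (by omega) (by omega) (by omega) (by omega) (by linarith)

section
variable {q t : ℂ} {P : (Fin (m + 1) → ℕ) → MvPolynomial (Fin (m + 1)) ℂ}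

lemma exists_bound_hecke (hP : NormInterp q t P) (hp : GoodParams q t) (hq1 : ‖q‖ < 1) :
    ∃ K : ℝ, 0 ≤ K ∧ ∀ (i : Fin m) (d : ℕ) (f) (c : ℝ), CoeffBound P d f c →
      CoeffBound P d (hecke t i f) (K * c) := by
  obtain ⟨R, hR0, hR⟩ := exists_bound_offCoeff (m := m) hp hq1
  have hK : 0 ≤ ‖t‖ + 2 * R := by positivity
  refine ⟨‖t‖ + 2 * R, hK, fun i d f c hf => hf.map (hecke t i) hK fun u hu => ?_⟩
  by_cases h : u i.castSucc = u i.succ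
  · rw [topPart_hecke_of_eq hP hp i u h]
    exact ((CoeffBound.topPart hu).C_mul t).mono (by linarith)
  · rw [topPart_hecke_of_ne hP hp i u h]
    refine (((CoeffBound.topPart hu).C_mul _).add
      ((CoeffBound.topPart ((wt_comp_perm u _).trans hu)).C_mul _)).mono ?_
    have h1 := (hR i u h).1
    have h2 := (hR i (u ∘ adj i) (by simpa [adj] using Ne.symm h)).1
    have h3 := norm_sub_le t (offCoeff q t i u)
    linarith

lemma hecke_inverse (ht : t ≠ 0) (i : Fin m) (f : MvPolynomial (Fin (m + 1)) ℂ) :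
    hecke t i (C t⁻¹ * (hecke t i f - C (t - 1) * f)) = f := by
  rw [map_C_mul, map_sub, hecke_sq, map_C_mul, add_sub_cancel_left, ← mul_assoc, ← C_mul,
    inv_mul_cancel₀ ht, C_1, one_mul]

lemma exists_bound_descOp (hP : NormInterp q t P) (hp : GoodParams q t) (hq1 : ‖q‖ < 1)
    (j : Fin (m + 1)) :
    ∃ K : ℝ, 0 ≤ K ∧ ∀ (d : ℕ) (f) (c : ℝ), CoeffBound P d f c →
      CoeffBound P d (descOp t j f) (K * c) := by
  obtain ⟨H, hH0, hH⟩ := exists_bound_hecke hP hp hq1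
  induction j using Fin.induction with
  | zero => exact ⟨1, zero_le_one, fun d f c hf => by simpa using hf⟩
  | succ i ih =>
    obtain ⟨K, hK0, hK⟩ := ih
    refine ⟨H * K, by positivity, fun d f c hf => ?_⟩
    rw [descOp_succ, mul_assoc]
    exact hH _ _ _ _ (hK _ _ _ hf)

lemma exists_bound_descOp_inverse (hP : NormInterp q t P) (hp : GoodParams q t) (hq1 : ‖q‖ < 1)
    (j : Fin (m + 1)) :
    ∃ K : ℝ, 0 ≤ K ∧ ∀ (d : ℕ) (f) (c : ℝ), CoeffBound P d f c →
      ∃ g, descOp t j g = f ∧ CoeffBound P d g (K * c) := by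
  obtain ⟨H, hH0, hH⟩ := exists_bound_hecke hP hp hq1
  induction j using Fin.induction with
  | zero => exact ⟨1, zero_le_one, fun d f c hf => ⟨f, by simp, by simpa using hf⟩⟩
  | succ i ih =>
    obtain ⟨K, hK0, hK⟩ := ih
    refine ⟨K * (‖t⁻¹‖ * (H + ‖t - 1‖)), by positivity, fun d f c hf => ?_⟩
    obtain ⟨g, hg1, hg2⟩ := hK d _ _ (((hH i d f c hf).sub_C_mul hf (t - 1)).C_mul t⁻¹)
    refine ⟨g, by rw [descOp_succ, hg1, hecke_inverse hp.ht], hg2.mono (le_of_eq ?_)⟩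
    ring

lemma exists_bound_one_sub_mul_spec (hp : GoodParams q t) (hq1 : ‖q‖ < 1) :
    ∃ K : ℝ, 0 ≤ K ∧ ∀ u : Fin (m + 1) → ℕ, ‖1 - q * spec q t u 0‖ ≤ K ∧
      ‖(1 - q * spec q t u 0)⁻¹‖ ≤ K := by
  obtain ⟨K, hK1, hK⟩ := exists_bound_one_sub hp hq1 m
  refine ⟨K, by linarith, fun u => ?_⟩
  have h1 := lp_lt u 0
  have h2 := hK (u 0) ((m - lp u 0 : ℕ) : ℤ) (by omega) (by omega)
  rw [zpow_natCast, pow_succ', mul_assoc] at h2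
  exact h2

lemma exists_bound_X_mul (hP : NormInterp q t P) (hp : GoodParams q t) (hq1 : ‖q‖ < 1)
    (k : Fin (m + 1)) :
    ∃ K : ℝ, 0 ≤ K ∧ ∀ (d : ℕ) (f) (c : ℝ), CoeffBound P d f c →
      CoeffBound P (d + 1) (X k * f) (K * c) := by
  obtain ⟨H, hH0, hH⟩ := exists_bound_hecke hP hp hq1
  induction k using Fin.reverseInduction with
  | last =>
    obtain ⟨D, hD0, hD⟩ := exists_bound_descOp_inverse hP hp hq1 (Fin.last m)
    obtain ⟨K, hK0, hK⟩ := exists_bound_one_sub_mul_spec (m := m) hp hq1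
    refine ⟨K * D, by positivity, fun d f c hf => ?_⟩
    obtain ⟨g, rfl, hg⟩ := hD d f c hf
    rw [mul_assoc]
    refine hg.map (LinearMap.mulLeft ℂ (X (Fin.last m)) ∘ₗ descOp t (Fin.last m)) hK0 fun u hu => ?_
    rw [LinearMap.comp_apply, LinearMap.mulLeft_apply, X_last_mul_descOp_topPart hP hp]
    refine ((CoeffBound.topPart ((wt_raise u).trans (by rw [hu]))).C_mul _).mono ?_
    rw [mul_one]
    exact (hK u).1
  | cast i ih =>
    obtain ⟨K, hK0, hK⟩ := ih
    refine ⟨‖t⁻¹‖ * (H * (K * H)), by positivity, fun d f c hf => ?_⟩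
    have h1 := (hH i _ _ _ (hK d _ _ (hH i d f c hf))).C_mul t⁻¹
    rw [hecke_X_hecke, ← mul_assoc, ← C_mul, inv_mul_cancel₀ hp.ht, C_1, one_mul] at h1
    refine h1.mono (le_of_eq ?_)
    ring

lemma exists_uniform_bound_X_mul (hP : NormInterp q t P) (hp : GoodParams q t) (hq1 : ‖q‖ < 1) :
    ∃ K : ℝ, 0 ≤ K ∧ ∀ (k : Fin (m + 1)) (d : ℕ) (f) (c : ℝ), CoeffBound P d f c →
      CoeffBound P (d + 1) (X k * f) (K * c) := by
  choose K hK0 hK using exists_bound_X_mul hP hp hq1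
  refine ⟨∑ k, K k, Finset.sum_nonneg fun k _ => hK0 k, fun k d f c hf => ?_⟩
  refine (hK k d f c hf).mono (mul_le_mul_of_nonneg_right ?_ hf.nonneg)
  exact Finset.single_le_sum (fun k _ => hK0 k) (Finset.mem_univ k)

lemma X_pow_mul_bound {K : ℝ} (hK : ∀ (k : Fin (m + 1)) (d : ℕ) (f) (c : ℝ), CoeffBound P d f c →
      CoeffBound P (d + 1) (X k * f) (K * c)) (k : Fin (m + 1)) (p d : ℕ) (f) (c : ℝ)
    (hf : CoeffBound P d f c) : CoeffBound P (d + p) (X k ^ p * f) (K ^ p * c) := by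
  induction p with
  | zero => simpa using hf
  | succ p ih =>
    rw [pow_succ', pow_succ', mul_assoc, mul_assoc]
    exact hK k _ _ _ ih

lemma exists_bound_binCoeff (hp : GoodParams q t) (hq1 : ‖q‖ < 1) (a b : ℂ) :
    ∃ G : ℝ, 0 ≤ G ∧ ∀ k, ‖binCoeff q a b k‖ ≤ G ^ k := by
  obtain ⟨K, hK1, hK⟩ := exists_bound_one_sub hp hq1 0
  have hG : 0 ≤ (‖a‖ + ‖b‖) * K := by positivity
  refine ⟨(‖a‖ + ‖b‖) * K, hG, fun k => ?_⟩
  induction k with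
  | zero => simp [binCoeff]
  | succ k ih =>
    rw [binCoeff, mul_div_assoc, norm_mul, pow_succ ((‖a‖ + ‖b‖) * K), div_eq_mul_inv, norm_mul]
    have h1 : ‖a - b * q ^ k‖ ≤ ‖a‖ + ‖b‖ := by
      refine (norm_sub_le _ _).trans (add_le_add_right ?_ _)
      rw [norm_mul, norm_pow]
      exact mul_le_of_le_one_right (norm_nonneg _) (pow_le_one₀ (norm_nonneg _) hq1.le)
    have h2 := (hK k 0 (by norm_num) le_rfl).2
    rw [zpow_zero, mul_one] at h2
    gcongr

lemma exists_bound_coeff_prodSeries (hP : NormInterp q t P) (hp : GoodParams q t) (hq1 : ‖q‖ < 1)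
    (a b : ℂ) : ∃ D : ℝ, 0 ≤ D ∧ ∀ (k d : ℕ) (f) (c : ℝ), CoeffBound P d f c →
      CoeffBound P (d + k) (PowerSeries.coeff k (prodSeries (m + 1) q a b) * f) (D ^ k * c) := by
  classical
  obtain ⟨B, hB0, hB⟩ := exists_uniform_bound_X_mul hP hp hq1
  obtain ⟨G, hG0, hG⟩ := exists_bound_binCoeff hp hq1 a b
  suffices h : ∀ s : Finset (Fin (m + 1)), ∃ D : ℝ, 0 ≤ D ∧ ∀ (k d : ℕ) (f) (c : ℝ),
      CoeffBound P d f c → CoeffBound P (d + k) (PowerSeries.coeff k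
        (∏ i ∈ s, PowerSeries.rescale (X i : MvPolynomial (Fin (m + 1)) ℂ)
          (PowerSeries.map C (binSeries q a b))) * f) (D ^ k * c) from h Finset.univ
  intro s
  induction s using Finset.induction with
  | empty =>
    refine ⟨0, le_rfl, fun k d f c hf => ?_⟩
    rw [Finset.prod_empty, PowerSeries.coeff_one]
    rcases k with _ | k
    · simpa using hf
    · simpa using CoeffBound.zero
  | insert i s hi ih =>
    obtain ⟨D, hD0, hD⟩ := ih
    refine ⟨2 * max (G * B) D, by positivity, fun k d f c hf => ?_⟩
    rw [Finset.prod_insert hi, PowerSeries.coeff_mul, Finset.sum_mul]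
    have h1 : ∀ p ∈ Finset.HasAntidiagonal.antidiagonal k, CoeffBound P (d + k)
        (PowerSeries.coeff p.1 (PowerSeries.rescale (X i : MvPolynomial (Fin (m + 1)) ℂ)
          (PowerSeries.map C (binSeries q a b))) * PowerSeries.coeff p.2
          (∏ i ∈ s, PowerSeries.rescale (X i : MvPolynomial (Fin (m + 1)) ℂ)
          (PowerSeries.map C (binSeries q a b))) * f) (max (G * B) D ^ k * c) := by
      intro p hpk
      have hk := Finset.HasAntidiagonal.mem_antidiagonal.mp hpk
      have h2 := (X_pow_mul_bound hB i p.1 _ _ _ (hD p.2 d f c hf)).C_mul (binCoeff q a b p.1)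
      rw [add_assoc, add_comm p.2, hk] at h2
      rw [PowerSeries.coeff_rescale, PowerSeries.coeff_map, binSeries, PowerSeries.coeff_mk]
      have h3 : X i ^ p.1 * C (binCoeff q a b p.1) * PowerSeries.coeff p.2
          (∏ i ∈ s, PowerSeries.rescale (X i : MvPolynomial (Fin (m + 1)) ℂ)
          (PowerSeries.map C (PowerSeries.mk (binCoeff q a b)))) * f = C (binCoeff q a b p.1) *
          (X i ^ p.1 * (PowerSeries.coeff p.2
          (∏ i ∈ s, PowerSeries.rescale (X i : MvPolynomial (Fin (m + 1)) ℂ)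
          (PowerSeries.map C (PowerSeries.mk (binCoeff q a b)))) * f)) := by ring
      rw [h3]
      refine h2.mono ?_
      have hc := hf.nonneg
      calc ‖binCoeff q a b p.1‖ * (B ^ p.1 * (D ^ p.2 * c))
          ≤ G ^ p.1 * (B ^ p.1 * (D ^ p.2 * c)) := by gcongr; exact hG _
        _ = (G * B) ^ p.1 * D ^ p.2 * c := by ring
        _ ≤ max (G * B) D ^ p.1 * max (G * B) D ^ p.2 * c := by
          gcongr
          · exact le_max_left _ _
          · exact le_max_right _ _
        _ = max (G * B) D ^ k * c := by rw [← pow_add, hk]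
    refine (CoeffBound.sum _ h1).mono ?_
    rw [Finset.sum_const, Finset.Nat.card_antidiagonal, nsmul_eq_mul, mul_pow, ← mul_assoc]
    have hc := hf.nonneg
    gcongr
    exact_mod_cast Nat.lt_two_pow_self

end

/-- `g` is a combination `Σ_j x_j f_j` with all `f_j` satisfying a coefficient bound. -/
def LinearBound (P : (Fin n → ℕ) → MvPolynomial (Fin n) ℂ) (d : ℕ) (g : MvPolynomial (Fin n) ℂ)
    (c : ℝ) : Prop := ∃ f : Fin n → MvPolynomial (Fin n) ℂ,
  g = ∑ j, X j * f j ∧ ∀ j, CoeffBound P d (f j) c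

namespace LinearBound
variable {P : (Fin n → ℕ) → MvPolynomial (Fin n) ℂ} {d : ℕ} {f g : MvPolynomial (Fin n) ℂ}
  {c c' : ℝ}

lemma mono (h : LinearBound P d f c) (hc : c ≤ c') : LinearBound P d f c' := by
  obtain ⟨κ, h1, h2⟩ := h
  exact ⟨κ, h1, fun j => (h2 j).mono hc⟩

lemma zero : LinearBound P d 0 0 := ⟨fun _ => 0, by simp, fun _ => CoeffBound.zero⟩

lemma add (hf : LinearBound P d f c) (hg : LinearBound P d g c') :
    LinearBound P d (f + g) (c + c') := by
  obtain ⟨κ, rfl, h2⟩ := hf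
  obtain ⟨μ, rfl, h4⟩ := hg
  exact ⟨fun j => κ j + μ j, by simp only [mul_add, Finset.sum_add_distrib],
    fun j => (h2 j).add (h4 j)⟩

lemma C_mul (hf : LinearBound P d f c) (z : ℂ) : LinearBound P d (C z * f) (‖z‖ * c) := by
  obtain ⟨κ, rfl, h2⟩ := hf
  refine ⟨fun j => C z * κ j, ?_, fun j => (h2 j).C_mul z⟩
  rw [Finset.mul_sum]
  exact Finset.sum_congr rfl fun j _ => by ring

lemma sub_C_mul (hf : LinearBound P d f c) (hg : LinearBound P d g c') (z : ℂ) :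
    LinearBound P d (f - MvPolynomial.C z * g) (c + ‖z‖ * c') := by
  have := hf.add (hg.C_mul (-z))
  rwa [norm_neg, C_neg, neg_mul, ← sub_eq_add_neg] at this

lemma sum {ι : Type*} (s : Finset ι) {f : ι → MvPolynomial (Fin n) ℂ} {c : ι → ℝ}
    (h : ∀ i ∈ s, LinearBound P d (f i) (c i)) : LinearBound P d (∑ i ∈ s, f i) (∑ i ∈ s, c i) := by
  classical
  induction s using Finset.induction with
  | empty => exact zero
  | insert i s hi ih =>
    rw [Finset.sum_insert hi, Finset.sum_insert hi]
    exact (h i (Finset.mem_insert_self _ _)).add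
      (ih fun j hj => h j (Finset.mem_insert_of_mem hj))

lemma X_mul (hf : CoeffBound P d f c) (j : Fin n) : LinearBound P d (X j * f) c := by
  classical
  refine ⟨Pi.single j f, ?_, fun k => ?_⟩
  · rw [Finset.sum_eq_single j]
    · simp
    · intro k _ hk
      rw [Pi.single_eq_of_ne hk, mul_zero]
    · simp
  · rcases eq_or_ne k j with rfl | hk
    · rwa [Pi.single_eq_same]
    · rw [Pi.single_eq_of_ne hk]
      exact CoeffBound.zero.mono hf.nonneg

lemma norm_eval_le (hf : LinearBound P d f c) (x : Fin n → ℂ) {K ρ : ℝ} (hK : 0 ≤ K)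
    (hρ : ∀ i, ‖x i‖ ≤ ρ)
    (h : ∀ u, wt u = d → ‖eval x (topPart P u)‖ ≤ K) : ‖eval x f‖ ≤ n * (ρ * (c * K)) := by
  obtain ⟨κ, rfl, h2⟩ := hf
  rw [map_sum]
  refine (norm_sum_le _ _).trans ?_
  refine (Finset.sum_le_card_nsmul _ _ (ρ * (c * K)) fun j _ => ?_).trans (by simp)
  rw [map_mul, eval_X, norm_mul]
  exact mul_le_mul (hρ j) ((h2 j).norm_eval_le x hK h) (norm_nonneg _)
    ((norm_nonneg _).trans (hρ j))

end LinearBound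

section
variable {q t : ℂ} {P : (Fin (m + 1) → ℕ) → MvPolynomial (Fin (m + 1)) ℂ}

lemma exists_linearBound_hecke (hP : NormInterp q t P) (hp : GoodParams q t) (hq1 : ‖q‖ < 1) :
    ∃ K : ℝ, 0 ≤ K ∧ ∀ (i : Fin m) (d : ℕ) (f) (c : ℝ), LinearBound P d f c →
      LinearBound P d (hecke t i f) (K * c) := by
  obtain ⟨H, hH0, hH⟩ := exists_bound_hecke hP hp hq1
  refine ⟨(m + 1) * (H + ‖t - 1‖), by positivity, fun i d f c hf => ?_⟩
  obtain ⟨g, rfl, hg⟩ := hf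
  rw [map_sum]
  have h : ∀ j ∈ Finset.univ, LinearBound P d (hecke t i (X j * g j)) ((H + ‖t - 1‖) * c) := by
    intro j _
    have h1 := hH i d _ _ (hg j)
    have hc := (hg j).nonneg
    by_cases hj : j = i.succ
    · subst hj
      rw [hecke_X_succ_mul]
      refine LinearBound.mono (LinearBound.X_mul (h1.sub_C_mul (hg _) _) _) (le_of_eq ?_)
      ring
    by_cases hj' : j = i.castSucc
    · subst hj'
      rw [hecke_X_castSucc_mul]
      refine LinearBound.mono ((LinearBound.X_mul h1 _).add ((LinearBound.X_mul (hg _) _).C_mul _))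
        (le_of_eq ?_)
      ring
    · rw [hecke_X_mul_of_ne t i j hj' hj]
      refine LinearBound.mono (LinearBound.X_mul h1 _) ?_
      have := mul_nonneg (norm_nonneg (t - 1)) hc
      linarith
  refine (LinearBound.sum _ h).mono (le_of_eq ?_)
  simp
  ring

lemma exists_linearBound_topPart_of_ne_zero (hP : NormInterp q t P) (hp : GoodParams q t)
    (hq1 : ‖q‖ < 1) (i : Fin (m + 1)) :
    ∃ K : ℝ, 0 ≤ K ∧ ∀ (d : ℕ) (w : Fin (m + 1) → ℕ), wt w = d + 1 → w i ≠ 0 →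
      LinearBound P d (topPart P w) K := by
  induction i using Fin.reverseInduction with
  | last =>
    obtain ⟨D, hD0, hD⟩ := exists_bound_descOp hP hp hq1 (Fin.last m)
    obtain ⟨K, hK0, hK⟩ := exists_bound_one_sub_mul_spec (m := m) hp hq1
    refine ⟨K * D, by positivity, fun d w hw h0 => ?_⟩
    obtain ⟨u, rfl⟩ := exists_raise_eq w h0
    rw [wt_raise] at hw
    have h1 := (LinearBound.X_mul (hD d _ _ (CoeffBound.topPart (P := P) (u := u) (by omega)))
      (Fin.last m)).C_mul (1 - q * spec q t u 0)⁻¹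
    rw [X_last_mul_descOp_topPart hP hp, ← mul_assoc, ← C_mul,
      inv_mul_cancel₀ (hp.one_sub_ne_zero u 0), C_1, one_mul, mul_one] at h1
    exact h1.mono (mul_le_mul_of_nonneg_right (hK u).2 hD0)
  | cast i ih =>
    obtain ⟨K, hK0, hK⟩ := ih
    obtain ⟨H, hH0, hH⟩ := exists_linearBound_hecke hP hp hq1
    obtain ⟨R, hR0, hR⟩ := exists_bound_offCoeff (m := m) hp hq1
    refine ⟨K + R * (H * K + (‖t‖ + R) * K), by positivity, fun d w hw h0 => ?_⟩
    by_cases h1 : w i.succ = 0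
    · have hne : w i.castSucc ≠ w i.succ := by rw [h1]; exact h0
      have hne' : (w ∘ adj i) i.castSucc ≠ (w ∘ adj i) i.succ := by simpa [adj] using hne.symm
      have h2 := hK d (w ∘ adj i) ((wt_comp_perm w _).trans hw) (by simpa [adj] using h0)
      have h3 := topPart_hecke_of_ne hP hp i (w ∘ adj i) hne'
      rw [comp_adj_comp_adj] at h3
      have h4 : topPart P w = C (offCoeff q t i w)⁻¹ * (hecke t i (topPart P (w ∘ adj i)) -
          C (t - offCoeff q t i (w ∘ adj i)) * topPart P (w ∘ adj i)) := by
        rw [h3, add_sub_cancel_left, ← mul_assoc, ← C_mul,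
          inv_mul_cancel₀ (offCoeff_ne_zero hp.hq hp.ht hp.generic i hne), C_1, one_mul]
      rw [h4]
      refine (((hH i d _ _ h2).sub_C_mul h2 _).C_mul _).mono ?_
      have h5 := (hR i w hne).2
      have h6 : ‖t - offCoeff q t i (w ∘ adj i)‖ ≤ ‖t‖ + R :=
        (norm_sub_le _ _).trans (add_le_add_right (hR i _ hne').1 _)
      calc _ ≤ R * (H * K + (‖t‖ + R) * K) := by gcongr
        _ ≤ _ := by linarith
    · refine (hK d w hw h1).mono ?_
      have : 0 ≤ R * (H * K + (‖t‖ + R) * K) := by positivity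
      linarith

lemma exists_linearBound_topPart (hP : NormInterp q t P) (hp : GoodParams q t) (hq1 : ‖q‖ < 1) :
    ∃ K : ℝ, 0 ≤ K ∧ ∀ (d : ℕ) (w : Fin (m + 1) → ℕ), wt w = d + 1 →
      LinearBound P d (topPart P w) K := by
  choose K hK0 hK using exists_linearBound_topPart_of_ne_zero hP hp hq1
  refine ⟨∑ i, K i, Finset.sum_nonneg fun i _ => hK0 i, fun d w hw => ?_⟩
  obtain ⟨i, hi⟩ : ∃ i, w i ≠ 0 := by
    by_contra! h
    simp [wt, h] at hw
  exact (hK i d w hw hi).mono (Finset.single_le_sum (fun k _ => hK0 k) (Finset.mem_univ i))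

lemma exists_bound_eval_topPart (hP : NormInterp q t P) (hp : GoodParams q t) (hq1 : ‖q‖ < 1) :
    ∃ K : ℝ, 0 ≤ K ∧ ∀ (x : Fin (m + 1) → ℂ) (ρ : ℝ), 0 ≤ ρ → (∀ i, ‖x i‖ ≤ ρ) → ∀ u,
      ‖eval x (topPart P u)‖ ≤ (K * ρ) ^ wt u := by
  obtain ⟨K, hK0, hK⟩ := exists_linearBound_topPart hP hp hq1
  refine ⟨(m + 1) * K, by positivity, fun x ρ hρ hx u => ?_⟩
  induction hd : wt u generalizing u with
  | zero =>
    have : u = fun _ => 0 := by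
      funext i
      simpa using (Finset.sum_eq_zero_iff.mp hd) i (Finset.mem_univ i)
    rw [this, topPart_zero hP]
    simp
  | succ d ih =>
    refine ((hK d u hd).norm_eval_le x (by positivity) hx fun w hw => ih w hw).trans (le_of_eq ?_)
    push_cast
    ring

lemma exists_bound_sum_norm (hP : NormInterp q t P) (hp : GoodParams q t) (hq1 : ‖q‖ < 1)
    (a b : ℂ) (v : Fin (m + 1) → ℕ) (z : ℂ) :
    ∃ D : ℝ, 0 ≤ D ∧ ∀ (k : ℕ) (κ : (Fin (m + 1) → ℕ) → ℂ), topComb P (wt v + k) κ =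
      C z * topPart P v * PowerSeries.coeff k (prodSeries (m + 1) q a b) →
      ∑ u ∈ comps (m + 1) (wt v + k), ‖κ u‖ ≤ ‖z‖ * D ^ k := by
  obtain ⟨D, hD0, hD⟩ := exists_bound_coeff_prodSeries hP hp hq1 a b
  refine ⟨D, hD0, fun k κ h => CoeffBound.sum_norm_le hP hp ?_⟩
  have h1 := (hD k _ _ _ (CoeffBound.topPart (P := P) (u := v) rfl)).C_mul z
  rw [h]
  rw [mul_one] at h1
  convert h1 using 1
  ring

end

lemma tsum_coeff_mul {f g : PowerSeries ℂ} (hf : Summable fun k => ‖PowerSeries.coeff k f‖)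
    (hg : Summable fun k => ‖PowerSeries.coeff k g‖) :
    (Summable fun k => ‖PowerSeries.coeff k (f * g)‖) ∧
      ∑' k, PowerSeries.coeff k (f * g) =
        (∑' k, PowerSeries.coeff k f) * ∑' k, PowerSeries.coeff k g := by
  have h : ∀ k, PowerSeries.coeff k (f * g) = ∑ p ∈ Finset.HasAntidiagonal.antidiagonal k,
      PowerSeries.coeff p.1 f * PowerSeries.coeff p.2 g := fun k => PowerSeries.coeff_mul k f g
  constructor
  · have h1 := summable_norm_sum_mul_antidiagonal_of_summable_norm hf hg
    exact h1.congr fun k => by rw [h]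
  · have h2 := tsum_mul_tsum_eq_tsum_sum_antidiagonal_of_summable_norm hf hg
    rw [h2]
    exact tsum_congr h

lemma tsum_coeff_prod {ι : Type*} (s : Finset ι) {f : ι → PowerSeries ℂ}
    (hf : ∀ i ∈ s, Summable fun k => ‖PowerSeries.coeff k (f i)‖) :
    (Summable fun k => ‖PowerSeries.coeff k (∏ i ∈ s, f i)‖) ∧
      ∑' k, PowerSeries.coeff k (∏ i ∈ s, f i) = ∏ i ∈ s, ∑' k, PowerSeries.coeff k (f i) := by
  classical
  induction s using Finset.induction with
  | empty =>
    have h : ∀ k, k ∉ ({0} : Finset ℕ) →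
        PowerSeries.coeff k (∏ i ∈ (∅ : Finset ι), f i) = 0 := by
      intro k hk
      rw [Finset.prod_empty, PowerSeries.coeff_one, if_neg (by simpa using hk)]
    refine ⟨summable_of_ne_finset_zero (s := {0}) fun k hk => by rw [h k hk, norm_zero], ?_⟩
    rw [tsum_eq_sum h]
    simp
  | insert i s hi ih =>
    obtain ⟨h1, h2⟩ := ih fun j hj => hf j (Finset.mem_insert_of_mem hj)
    obtain ⟨h3, h4⟩ := tsum_coeff_mul (hf i (Finset.mem_insert_self _ _)) h1
    rw [Finset.prod_insert hi, Finset.prod_insert hi]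
    exact ⟨h3, by rw [h4, h2]⟩

section
variable {q a b z : ℂ} {G : ℝ}

lemma summable_binCoeff_mul_pow (hG0 : 0 ≤ G) (hG : ∀ k, ‖binCoeff q a b k‖ ≤ G ^ k)
    (hz : G * ‖z‖ < 1) : Summable fun k => ‖binCoeff q a b k * z ^ k‖ := by
  refine Summable.of_nonneg_of_le (fun _ => norm_nonneg _) (fun k => ?_)
    (summable_geometric_of_lt_one (mul_nonneg hG0 (norm_nonneg z)) hz)
  rw [norm_mul, norm_pow, mul_pow]
  exact mul_le_mul_of_nonneg_right (hG k) (by positivity)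

lemma tsum_binCoeff_functional (hq : ∀ k : ℕ, 1 - q ^ (k + 1) ≠ 0) (hq1 : ‖q‖ < 1) (hG0 : 0 ≤ G)
    (hG : ∀ k, ‖binCoeff q a b k‖ ≤ G ^ k) (hz : G * ‖z‖ < 1) :
    (1 - a * z) * ∑' k, binCoeff q a b k * z ^ k =
      (1 - b * z) * ∑' k, binCoeff q a b k * (q * z) ^ k := by
  have h1 := (summable_binCoeff_mul_pow hG0 hG hz).of_norm
  have hz' : G * ‖q * z‖ < 1 := by
    refine lt_of_le_of_lt (mul_le_mul_of_nonneg_left ?_ hG0) hz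
    rw [norm_mul]
    exact mul_le_of_le_one_left (norm_nonneg _) hq1.le
  have h2 := (summable_binCoeff_mul_pow hG0 hG hz').of_norm
  have h3 : ∑' k, binCoeff q a b k * z ^ k - ∑' k, binCoeff q a b k * (q * z) ^ k =
      a * z * ∑' k, binCoeff q a b k * z ^ k - b * z * ∑' k, binCoeff q a b k * (q * z) ^ k := by
    rw [← h1.tsum_sub h2, ← tsum_mul_left, ← tsum_mul_left,
      ← (h1.mul_left (a * z)).tsum_sub (h2.mul_left (b * z)),
      (h1.sub h2).tsum_eq_zero_add]
    rw [pow_zero, pow_zero, sub_self, zero_add]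
    refine tsum_congr fun k => ?_
    have := hq k
    rw [binCoeff]
    field_simp
    ring
  linear_combination h3

lemma tsum_binCoeff_mul_prod (hq : ∀ k : ℕ, 1 - q ^ (k + 1) ≠ 0) (hq1 : ‖q‖ < 1) (hG0 : 0 ≤ G)
    (hG : ∀ k, ‖binCoeff q a b k‖ ≤ G ^ k) (hz : G * ‖z‖ < 1) (N : ℕ) :
    (∑' k, binCoeff q a b k * z ^ k) * ∏ j ∈ Finset.range N, (1 - a * z * q ^ j) =
      (∏ j ∈ Finset.range N, (1 - b * z * q ^ j)) *
        ∑' k, binCoeff q a b k * (q ^ N * z) ^ k := by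
  induction N with
  | zero => simp
  | succ N ih =>
    have hz' : G * ‖q ^ N * z‖ < 1 := by
      refine lt_of_le_of_lt (mul_le_mul_of_nonneg_left ?_ hG0) hz
      rw [norm_mul, norm_pow]
      exact mul_le_of_le_one_left (norm_nonneg _) (pow_le_one₀ (norm_nonneg _) hq1.le)
    have h := tsum_binCoeff_functional hq hq1 hG0 hG hz'
    rw [← mul_assoc q, ← pow_succ'] at h
    rw [Finset.prod_range_succ, Finset.prod_range_succ, ← mul_assoc, ih]
    linear_combination (∏ j ∈ Finset.range N, (1 - b * z * q ^ j)) * h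

lemma tendsto_prod_qpochInf (hq1 : ‖q‖ < 1) (z : ℂ) :
    Filter.Tendsto (fun N => ∏ j ∈ Finset.range N, (1 - z * q ^ j)) Filter.atTop
      (nhds (qpochInf z q)) := by
  have h : Summable fun j : ℕ => ‖-(z * q ^ j)‖ := by
    simp only [norm_neg, norm_mul, norm_pow]
    exact (summable_geometric_of_lt_one (norm_nonneg q) hq1).mul_left _
  have := (multipliable_one_add_of_summable h).hasProd.tendsto_prod_nat
  rw [qpochInf]
  simpa only [← sub_eq_add_neg] using this

lemma tsum_binCoeff_mul_qpochInf (hq : ∀ k : ℕ, 1 - q ^ (k + 1) ≠ 0) (hq1 : ‖q‖ < 1) (hG0 : 0 ≤ G)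
    (hG : ∀ k, ‖binCoeff q a b k‖ ≤ G ^ k) (hz : G * ‖z‖ < 1) :
    (∑' k, binCoeff q a b k * z ^ k) * qpochInf (a * z) q = qpochInf (b * z) q := by
  have h1 := (tendsto_prod_qpochInf hq1 (a * z)).const_mul (∑' k, binCoeff q a b k * z ^ k)
  have h2 : Filter.Tendsto (fun N => ∑' k, binCoeff q a b k * (q ^ N * z) ^ k) Filter.atTop
      (nhds (∑' k, if k = 0 then (1 : ℂ) else 0)) := by
    refine tendsto_tsum_of_dominated_convergence (summable_binCoeff_mul_pow hG0 hG hz)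
      (fun k => ?_) (Filter.Eventually.of_forall fun N k => ?_)
    · rcases k with _ | k
      · simp [binCoeff]
      · have h := ((tendsto_pow_atTop_nhds_zero_of_norm_lt_one hq1).mul_const z).pow (k + 1)
        simpa using h.const_mul (binCoeff q a b (k + 1))
    · rw [norm_mul, norm_mul, norm_pow, norm_pow, norm_mul, norm_pow]
      gcongr
      exact mul_le_of_le_one_left (norm_nonneg _) (pow_le_one₀ (norm_nonneg _) hq1.le)
  rw [tsum_ite_eq] at h2
  have h3 := (tendsto_prod_qpochInf hq1 (b * z)).mul h2
  rw [mul_one] at h3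
  refine tendsto_nhds_unique (h1.congr fun N => ?_) h3
  exact tsum_binCoeff_mul_prod hq hq1 hG0 hG hz N

lemma qpochInf_zero (q : ℂ) : qpochInf 0 q = 1 := by
  simp [qpochInf]

end

theorem exists_hasSum_prodSeries {q t : ℂ} (hp : GoodParams q t) (hq1 : ‖q‖ < 1) (a b : ℂ) :
    ∃ ε > 0, ∀ x : Fin n → ℂ, (∀ i, ‖x i‖ < ε) →
      HasSum (fun k => eval x (PowerSeries.coeff k (prodSeries n q a b)))
        (∏ i, qpochInf (b * x i) q / qpochInf (a * x i) q) := by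
  obtain ⟨G, hG0, hG⟩ := exists_bound_binCoeff hp hq1 a b
  obtain ⟨H, hH0, hH⟩ := exists_bound_binCoeff hp hq1 a 0
  refine ⟨(G + H + 1)⁻¹, by positivity, fun x hx => ?_⟩
  have hlt : ∀ i, (G + H + 1) * ‖x i‖ < 1 := fun i => by
    rw [← lt_inv_mul_iff₀ (by positivity), mul_one]
    exact hx i
  have hx1 : ∀ i, G * ‖x i‖ < 1 := fun i => by
    have := norm_nonneg (x i)
    nlinarith [hlt i, mul_nonneg hH0 this]
  have hx2 : ∀ i, H * ‖x i‖ < 1 := fun i => by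
    have := norm_nonneg (x i)
    nlinarith [hlt i, mul_nonneg hG0 this]
  have hc : ∀ i k, PowerSeries.coeff k (PowerSeries.rescale (x i) (binSeries q a b)) =
      binCoeff q a b k * x i ^ k := fun i k => by
    rw [PowerSeries.coeff_rescale, binSeries, PowerSeries.coeff_mk, mul_comm]
  have hprod : PowerSeries.map (eval x) (prodSeries n q a b) =
      ∏ i, PowerSeries.rescale (x i) (binSeries q a b) := by
    rw [prodSeries, map_prod]
    refine Finset.prod_congr rfl fun i _ => ?_
    rw [map_rescale_map_C, eval_X]
    congr 1
    ext k
    simp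
  have hq := hp.generic.one_sub_pow_ne
  obtain ⟨h1, h2⟩ := tsum_coeff_prod Finset.univ
    (f := fun i => PowerSeries.rescale (x i) (binSeries q a b)) fun i _ => by
      simp only [hc]
      exact summable_binCoeff_mul_pow hG0 hG (hx1 i)
  rw [← hprod] at h1 h2
  simp only [PowerSeries.coeff_map, hc] at h1 h2
  have h3 : ∏ i, qpochInf (b * x i) q / qpochInf (a * x i) q =
      ∏ i, ∑' k, binCoeff q a b k * x i ^ k := by
    refine Finset.prod_congr rfl fun i _ => ?_
    have h4 := tsum_binCoeff_mul_qpochInf hq hq1 hH0 hH (hx2 i)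
    rw [zero_mul, qpochInf_zero] at h4
    rw [div_eq_iff (right_ne_zero_of_mul (h4 ▸ one_ne_zero)),
      tsum_binCoeff_mul_qpochInf hq hq1 hG0 hG (hx1 i)]
  rw [h3, ← h2]
  exact h1.of_norm.hasSum

lemma hasSum_of_comps {f : (Fin n → ℕ) → ℂ} {g : ℕ → ℝ} {s : ℂ} (hg : Summable g)
    (hfg : ∀ d, ∑ u ∈ comps n d, ‖f u‖ ≤ g d)
    (hs : HasSum (fun d => ∑ u ∈ comps n d, f u) s) :
    (Summable fun u => ‖f u‖) ∧ ∑' u, f u = s := by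
  have hsum : Summable fun u => ‖f u‖ := by
    refine summable_of_sum_le (c := ∑' d, g d) (fun _ => norm_nonneg _) fun S => ?_
    have hg0 : ∀ d, 0 ≤ g d := fun d =>
      (Finset.sum_nonneg fun u _ => norm_nonneg (f u)).trans (hfg d)
    have h1 : ∀ u ∈ S, wt u ∈ S.image wt := fun u hu => Finset.mem_image_of_mem _ hu
    rw [← Finset.sum_fiberwise_of_maps_to h1]
    refine le_trans (Finset.sum_le_sum fun d _ => ?_) (hg.sum_le_tsum (S.image wt) fun d _ => hg0 d)
    refine le_trans (Finset.sum_le_sum_of_subset_of_nonneg (fun u hu => ?_)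
      fun u _ _ => norm_nonneg _) (hfg d)
    exact mem_comps.mpr (Finset.mem_filter.mp hu).2
  refine ⟨hsum, ?_⟩
  have h2 : HasSum (fun p : Σ d, {u : Fin n → ℕ // wt u = d} => f p.2) (∑' u, f u) :=
    (Equiv.sigmaFiberEquiv (wt : (Fin n → ℕ) → ℕ)).hasSum_iff.mpr hsum.of_norm.hasSum
  refine (h2.sigma fun d => ?_).unique hs
  have h3 := hasSum_subtype_iff_of_support_subset (f := fun u => f u) (s := {u | wt u = d})
    (a := ∑ u ∈ comps n d, f u)
  have h4 : HasSum (fun u : (comps n d : Set (Fin n → ℕ)) => f u) (∑ u ∈ comps n d, f u) :=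
    Finset.hasSum (comps n d) f
  have h5 : (comps n d : Set (Fin n → ℕ)) = {u | wt u = d} := by
    ext u
    simp
  rw [h5] at h4
  exact h4

theorem exists_hasSum_skew {q t : ℂ} {M : (Fin (m + 1) → ℕ) → MvPolynomial (Fin (m + 1)) ℂ}
    {a b : ℂ} {cc : (Fin (m + 1) → ℕ) → (Fin (m + 1) → ℕ) → ℂ}
    (hP : NormInterp q t (MM q t M)) (hp : GoodParams q t) (hq1 : ‖q‖ < 1)
    (ha : a ≠ 0) (hb : b ≠ 0) (hcc : IsConnection q t M a b cc) (v : Fin (m + 1) → ℕ) :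
    ∃ ε > 0, ∀ x : Fin (m + 1) → ℂ, (∀ i, ‖x i‖ < ε) →
      Summable (fun u : Fin (m + 1) → ℕ => ‖skew q t M a b cc u v * eval x (EE q t M u)‖) ∧
      ∑' u : Fin (m + 1) → ℕ, skew q t M a b cc u v * eval x (EE q t M u) =
        eval x (EE q t M v) * ∏ i, qpochInf (b * x i) q / qpochInf (a * x i) q := by
  obtain ⟨ε₀, hε₀, h₀⟩ := exists_hasSum_prodSeries (n := m + 1) hp hq1 a b
  obtain ⟨K, hK0, hK⟩ := exists_bound_eval_topPart hP hp hq1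
  obtain ⟨D, hD0, hD⟩ := exists_bound_sum_norm hP hp hq1 a b v (q ^ nstat' v)⁻¹
  have hqn : ∀ u : Fin (m + 1) → ℕ, q ^ nstat' u ≠ 0 := fun u => pow_ne_zero _ hp.hq
  have hEE : ∀ u, EE q t M u = C (q ^ nstat' u)⁻¹ * topPart (MM q t M) u := fun u => by
    rw [topPart_MM, ← mul_assoc, ← C_mul, inv_mul_cancel₀ (hqn u), C_1, one_mul]
  have hσ : ∀ k, ∑ u ∈ comps (m + 1) (wt v + k), ‖skew q t M a b cc u v * (q ^ nstat' u)⁻¹‖ ≤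
      ‖(q ^ nstat' v)⁻¹‖ * D ^ k := fun k => by
    refine hD k _ ?_
    have h := sum_skew hP hp ha hb hcc (wt v + k) v (Nat.le_add_right _ _)
    rw [Nat.add_sub_cancel_left] at h
    rw [← hEE, ← h, topComb]
    exact Finset.sum_congr rfl fun u _ => by rw [hEE u, C_mul, mul_assoc]
  have hlow : ∀ x : Fin (m + 1) → ℂ, ∀ d, d < wt v → ∀ u ∈ comps (m + 1) d,
      skew q t M a b cc u v * eval x (EE q t M u) = 0 := fun x d hd u hu => by
    rw [skew_eq_zero hcc (by rwa [mem_comps.mp hu]), zero_mul]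
  set r : ℝ := min ε₀ (D * K + 1)⁻¹ with hr
  have hr0 : 0 < r := lt_min hε₀ (by positivity)
  have hr1 : D * (K * r) < 1 := by
    have h1 : r * (D * K + 1) ≤ 1 := by
      rw [← le_mul_inv_iff₀ (by positivity), one_mul]
      exact min_le_right _ _
    linarith
  have hr1' : 0 ≤ D * (K * r) := by positivity
  refine ⟨r, hr0, fun x hx => ?_⟩
  have hbound : ∀ k, ∑ u ∈ comps (m + 1) (k + wt v),
      ‖skew q t M a b cc u v * eval x (EE q t M u)‖ ≤
        ‖(q ^ nstat' v)⁻¹‖ * (K * r) ^ wt v * (D * (K * r)) ^ k := fun k => by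
    rw [add_comm k]
    calc ∑ u ∈ comps (m + 1) (wt v + k), ‖skew q t M a b cc u v * eval x (EE q t M u)‖
        ≤ ∑ u ∈ comps (m + 1) (wt v + k),
            ‖skew q t M a b cc u v * (q ^ nstat' u)⁻¹‖ * (K * r) ^ (wt v + k) := by
          refine Finset.sum_le_sum fun u hu => ?_
          rw [hEE u, map_mul, eval_C, ← mul_assoc, norm_mul, ← mem_comps.mp hu]
          exact mul_le_mul_of_nonneg_left (hK x r hr0.le (fun i => (hx i).le) u) (norm_nonneg _)
      _ ≤ (‖(q ^ nstat' v)⁻¹‖ * D ^ k) * (K * r) ^ (wt v + k) := by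
          rw [← Finset.sum_mul]
          exact mul_le_mul_of_nonneg_right (hσ k) (by positivity)
      _ = _ := by ring
  refine hasSum_of_comps (g := fun d => ∑ u ∈ comps (m + 1) d,
    ‖skew q t M a b cc u v * eval x (EE q t M u)‖) ?_ (fun _ => le_rfl) ?_
  · refine (summable_nat_add_iff (wt v)).mp ?_
    exact Summable.of_nonneg_of_le (fun _ => Finset.sum_nonneg fun _ _ => norm_nonneg _) hbound
      ((summable_geometric_of_lt_one hr1' hr1).mul_left _)
  · have h1 := (h₀ x fun i => (hx i).trans_le (min_le_left _ _)).mul_left (eval x (EE q t M v))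
    refine (hasSum_nat_add_iff' (wt v)).mp ?_
    rw [Finset.sum_eq_zero fun d hd => Finset.sum_eq_zero (hlow x d (Finset.mem_range.mp hd)),
      sub_zero]
    refine (congrArg (HasSum · _) (funext fun k => ?_)).mpr h1
    have h := congrArg (eval x) (sum_skew hP hp ha hb hcc (k + wt v) v (Nat.le_add_left _ _))
    rw [Nat.add_sub_cancel, map_sum, map_mul] at h
    simpa only [map_mul, eval_C] using h

end

/-- **sl_n q-binomial theorem I** (Corollary 7.3). -/
theorem sln_q_binomial_theorem_I
    (hn : 0 < n) (q t : ℂ) (hq0 : q ≠ 0) (hq1 : ‖q‖ < 1) (ht : t ≠ 0)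
    (hqt : ∀ i j : ℤ, ¬(i = 0 ∧ j = 0) → q ^ i * t ^ j ≠ 1)
    (M : (Fin n → ℕ) → MvPolynomial (Fin n) ℂ) (hM : IsInterpFamily q t M)
    (v : Fin n → ℕ) (a b : ℂ) (ha : a ≠ 0) (hb : b ≠ 0)
    (cc : (Fin n → ℕ) → (Fin n → ℕ) → ℂ) (hcc : IsConnection q t M a b cc) :
    ∃ ε > 0, ∀ x : Fin n → ℂ, (∀ i, ‖x i‖ < ε) →
      Summable (fun u : Fin n → ℕ =>
        ‖skew q t M a b cc u v * eval x (EE q t M u)‖) ∧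
      ∑' u : Fin n → ℕ, skew q t M a b cc u v * eval x (EE q t M u) =
        eval x (EE q t M v) *
          ∏ i, qpochInf (b * x i) q / qpochInf (a * x i) q := by
  obtain ⟨m, rfl⟩ := Nat.exists_eq_succ_of_ne_zero hn.ne'
  exact exists_hasSum_skew (hM.normInterp hq0 ht hqt) ⟨hq0, ht, hqt⟩ hq1 ha hb hcc v

end LRW
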